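/- arXiv:2409.06915 — 2 statements merged into one kernel-verified Lean document; each statement's English description precedes it below -/
import Mathlib

section
/- Let u be a bound state with exactly k ≥ 1 zeros z₁ < ⋯ < z_k, let c_k > z_k be the largest critical point of u (the unique point r > z_k with u'(r) = 0), and let v be the variation associated with u. Then v has exactly one zero τ_{k+1} in [z_k, ∞), this zero satisfies τ_{k+1} > c_k, v is strictly monotone for all sufficiently large r, and |v(r)| → ∞ as r → ∞. -/
open Real Filter Set

/-- The nonlinearity `f(s) = -s + |s|^(p-1) s`. -/
noncomputable def f (p s : ℝ) : ℝ := -s + |s| ^ (p - 1) * s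

/-- The derivative of the nonlinearity, `f'(s) = -1 + p |s|^(p-1)`. -/
noncomputable def fder (p s : ℝ) : ℝ := -1 + p * |s| ^ (p - 1)

/-- The primitive `F(s) = -s^2/2 + |s|^(p+1)/(p+1)`. -/
noncomputable def F (p s : ℝ) : ℝ := -s ^ 2 / 2 + |s| ^ (p + 1) / (p + 1)

/-- `u : [0,∞) → ℝ` (modeled on `Set.Ici 0`) is a C² solution of the IVP
`u'' + ((n-1)/r) u' + f(u) = 0`, `u(0) = α`, `u'(0) = 0`; the data `u'`, `u''`
are its first and second derivatives on `[0,∞)`. -/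
structure IsSolution (n : ℕ) (p α : ℝ) (u u' u'' : ℝ → ℝ) : Prop where
  init : u 0 = α
  initDeriv : u' 0 = 0
  hasDeriv1 : ∀ r ∈ Set.Ici (0:ℝ), HasDerivWithinAt u (u' r) (Set.Ici 0) r
  hasDeriv2 : ∀ r ∈ Set.Ici (0:ℝ), HasDerivWithinAt u' (u'' r) (Set.Ici 0) r
  cont2 : ContinuousOn u'' (Set.Ici 0)
  ode : ∀ r : ℝ, 0 < r → u'' r + ((n : ℝ) - 1) / r * u' r + f p (u r) = 0

/-- The variation `v` associated with a solution `u`: the C² solution of the linearized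
equation `v'' + ((n-1)/r) v' + f'(u) v = 0`, `v(0) = 1`, `v'(0) = 0`. -/
structure IsVariation (n : ℕ) (p : ℝ) (u v v' v'' : ℝ → ℝ) : Prop where
  init : v 0 = 1
  initDeriv : v' 0 = 0
  hasDeriv1 : ∀ r ∈ Set.Ici (0:ℝ), HasDerivWithinAt v (v' r) (Set.Ici 0) r
  hasDeriv2 : ∀ r ∈ Set.Ici (0:ℝ), HasDerivWithinAt v' (v'' r) (Set.Ici 0) r
  cont2 : ContinuousOn v'' (Set.Ici 0)
  ode : ∀ r : ℝ, 0 < r → v'' r + ((n : ℝ) - 1) / r * v' r + fder p (u r) * v r = 0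

/-- `u` is decaying: `u(r) → 0` and `u'(r) → 0` as `r → ∞`. -/
def Decaying (u u' : ℝ → ℝ) : Prop :=
  Filter.Tendsto u Filter.atTop (nhds 0) ∧ Filter.Tendsto u' Filter.atTop (nhds 0)

/-- `u` changes sign on `(0,∞)`. -/
def ChangesSign (u : ℝ → ℝ) : Prop :=
  (∃ r : ℝ, 0 < r ∧ u r < 0) ∧ (∃ r : ℝ, 0 < r ∧ 0 < u r)

/-- `z 0 < z 1 < ⋯ < z (k-1)` are exactly the zeros of `u` in `(0,∞)`. -/
def ExactZeros (u : ℝ → ℝ) (k : ℕ) (z : Fin k → ℝ) : Prop :=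
  StrictMono z ∧ (∀ i, 0 < z i ∧ u (z i) = 0) ∧
    ∀ r : ℝ, 0 < r → u r = 0 → ∃ i, r = z i

lemma w_identity (η p ρ W t : ℝ) (hp : p + 1 ≠ 0) (ht : t ≠ 0) (hj : t + η ≠ 0) :
    let φ := W / (p + 1) - 1 / 2
    let n := 2 * η + 2
    let m := 2 * η + 1
    let j := t + η
    let t' := -2 * η * t - ρ * (W - 1) - t ^ 2
    let W' := (p - 1) * W * t
    let φ' := (p - 1) * W * t / (p + 1)
    let h := η ^ 2 / j - ρ * (W - 1) / t + n * ρ * φ / t ^ 2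
    (-η ^ 2 * t' / j ^ 2 - (2 * ρ * (W - 1) + ρ * W') / t + ρ * (W - 1) * t' / t ^ 2
      + n * (2 * ρ * φ + ρ * φ') / t ^ 2 - 2 * n * ρ * φ * t' / t ^ 3) + h ^ 2 - η ^ 2 + ρ * (p * W - 1)
    = ρ * (η ^ 2 * (W - 1) / j ^ 2 - 2 * η ^ 2 * (W - 1) / (j * t) + 2 * η ^ 2 * n * φ / (j * t ^ 2)
      + 2 * n * m * φ / t ^ 2 + n ^ 2 * ρ * φ ^ 2 / t ^ 4) := by
  intro φ n m j t' W' φ' h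
  simp only [φ, n, m, j, t', W', φ', h]
  field_simp
  ring

lemma w_nonpos (η p ρ W t : ℝ) (hη : 1 / 2 ≤ η) (hp : 1 < p) (hρ : 0 < ρ) (hW : 0 < W) (ht : t ≠ 0)
    (hφ : W / (p + 1) - 1 / 2 ≤ 0) (hE : 0 < t ^ 2 / 2 + ρ * (W / (p + 1) - 1 / 2))
    (hP : 0 < (t + η) ^ 2 / 2 + (ρ * (W / (p + 1) - 1 / 2) - η ^ 2 / 2)) :
    η ^ 2 * (W - 1) / (t + η) ^ 2 - 2 * η ^ 2 * (W - 1) / ((t + η) * t)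
      + 2 * η ^ 2 * (2 * η + 2) * (W / (p + 1) - 1 / 2) / ((t + η) * t ^ 2)
      + 2 * (2 * η + 2) * (2 * η + 1) * (W / (p + 1) - 1 / 2) / t ^ 2
      + (2 * η + 2) ^ 2 * ρ * (W / (p + 1) - 1 / 2) ^ 2 / t ^ 4 ≤ 0 := by
  have hW1 : 1 - W ≤ -2 * (W / (p + 1) - 1 / 2) := by
    have : W / (p + 1) ≤ W / 2 := by
      apply div_le_div_of_nonneg_left hW.le <;> linarith
    linarith
  generalize hφd : W / (p + 1) - 1 / 2 = φ at *
  have hj : t + η ≠ 0 ∧ 0 ≤ t / (t + η) ∧ t / (t + η) ≤ 2 ∧ -1 ≤ η / (t + η) := by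
    rcases lt_or_gt_of_ne ht with h | h
    · have h1 : t + η < -η := by
        by_contra hc
        have : (t + η) ^ 2 ≤ η ^ 2 := by nlinarith
        nlinarith
      have h2 : t + η < 0 := by linarith
      refine ⟨h2.ne, (div_pos_of_neg_of_neg h h2).le, ?_, ?_⟩
      · rw [div_le_iff_of_neg h2]; linarith
      · rw [le_div_iff_of_neg h2]; linarith
    · have h2 : 0 < t + η := by linarith
      refine ⟨h2.ne', by positivity, ?_, ?_⟩
      · rw [div_le_iff₀ h2]; linarith
      · have : 0 ≤ η / (t + η) := by positivity
        linarith
  obtain ⟨hj, s0, s2, r1⟩ := hj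
  set s := t / (t + η) with hs
  set r := η / (t + η) with hr
  have hB : ρ * φ ^ 2 / t ^ 2 ≤ -φ / 2 := by
    have : 0 < t ^ 2 := by positivity
    rw [div_le_iff₀ this]; nlinarith
  have e : η ^ 2 * (W - 1) / (t + η) ^ 2 - 2 * η ^ 2 * (W - 1) / ((t + η) * t)
      + 2 * η ^ 2 * (2 * η + 2) * φ / ((t + η) * t ^ 2)
      + 2 * (2 * η + 2) * (2 * η + 1) * φ / t ^ 2
      + (2 * η + 2) ^ 2 * ρ * φ ^ 2 / t ^ 4 = (η ^ 2 * ((1 - W) * (s * (2 - s)))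
      + 2 * η * (2 * η + 2) * (φ * r) + 2 * (2 * η + 2) * (2 * η + 1) * φ
      + (2 * η + 2) ^ 2 * (ρ * φ ^ 2 / t ^ 2)) / t ^ 2 := by
    simp only [hs, hr]; field_simp; ring
  rw [e]
  apply div_nonpos_of_nonpos_of_nonneg _ (by positivity)
  have h1 : (1 - W) * (s * (2 - s)) ≤ -2 * φ := by
    have a1 : 0 ≤ s * (2 - s) := mul_nonneg s0 (by linarith)
    have a2 : s * (2 - s) ≤ 1 := by nlinarith [sq_nonneg (s - 1)]
    nlinarith
  have h2 : φ * r ≤ -φ := by nlinarith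
  have h1' := mul_le_mul_of_nonneg_left h1 (by positivity : 0 ≤ η ^ 2)
  have h2' := mul_le_mul_of_nonneg_left h2 (by positivity : 0 ≤ 2 * η * (2 * η + 2))
  have h3' := mul_le_mul_of_nonneg_left hB (by positivity : 0 ≤ (2 * η + 2) ^ 2)
  nlinarith [mul_nonneg (neg_nonneg.2 hφ) (by linarith : 0 ≤ η)]

lemma II_identity (η p ρ W t : ℝ) (hp : p + 1 ≠ 0) :
    let φ := W / (p + 1) - 1 / 2
    let n := 2 * η + 2
    let j := t + η
    let N := ρ * (W - 1) - η ^ 2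
    let g := n * φ - η * (W - 1)
    let T := N * j + ρ * g
    let W' := (p - 1) * W * t
    let N' := 2 * ρ * (W - 1) + ρ * W'
    let g' := n * W' / (p + 1) - η * W'
    let T' := N' * j + N * (-N - j ^ 2) + 2 * ρ * g + ρ * g'
    let B := ρ * W / (p + 1)
    let κ := 2 - η * (p - 1)
    let G := κ * B - ρ
    let c := κ ^ 2 * B - 2 * ρ
    let N₁ := κ * (p + 1) * B - 2 * ρ
    let A := N ^ 2 * c - 2 * N * N₁ * G + (ρ * (p * W - 1) - η ^ 2) * G ^ 2
    N ^ 2 * T' - 2 * N * N' * T + N ^ 4 + (ρ * (p * W - 1) - η ^ 2) * T ^ 2 = A := by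
  intro φ n j N g T W' N' g' T' B κ G c N₁ A
  simp only [φ, n, j, N, g, T, W', N', g', T', B, κ, G, c, N₁, A]
  field_simp
  ring

lemma II_neg (η p ρ W : ℝ) (hη : 1 / 2 ≤ η) (hp : 1 < p) (hρ : 0 < ρ) (hW : 0 < W)
    (hΦ : 0 ≤ ρ * (W / (p + 1) - 1 / 2) - η ^ 2 / 2) :
    let N := ρ * (W - 1) - η ^ 2
    let B := ρ * W / (p + 1)
    let κ := 2 - η * (p - 1)
    let G := κ * B - ρ
    let c := κ ^ 2 * B - 2 * ρ
    let N₁ := κ * (p + 1) * B - 2 * ρ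
    N ^ 2 * c - 2 * N * N₁ * G + (ρ * (p * W - 1) - η ^ 2) * G ^ 2 < 0 := by
  intro N B κ G c N₁
  have hB : 0 < B := by positivity
  have hWB : ρ * W = (p + 1) * B := by simp only [B]; field_simp
  obtain ⟨a, ha⟩ : ∃ a, ρ = a * B := ⟨ρ / B, by field_simp⟩
  obtain ⟨ν, hν⟩ : ∃ ν, N = ν * B := ⟨N / B, by field_simp⟩
  have ha0 : 0 < a := by by_contra h; nlinarith
  have hNe : N = (p + 1) * B - ρ - η ^ 2 := by simp only [N]; rw [← hWB]; ring
  have hη2 : 0 < η ^ 2 := by positivity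
  have h1 : η ^ 2 = (p + 1 - ν - a) * B := by
    rw [ha] at hNe; rw [hν] at hNe; linarith
  have h2 : 0 < p + 1 - ν - a := by
    by_contra h; nlinarith
  have h3 : p - 1 ≤ ν := by
    have : ρ * (W / (p + 1) - 1 / 2) = B - ρ / 2 := by simp only [B]; ring
    rw [this, h1, ha] at hΦ
    by_contra h; nlinarith
  have hV : ρ * (p * W - 1) - η ^ 2 = (p ^ 2 - 1 + ν) * B := by
    rw [h1, show ρ * (p * W - 1) = p * (ρ * W) - ρ by ring, hWB]
    nth_rw 1 [ha]; ring
  have e : N ^ 2 * c - 2 * N * N₁ * G + (ρ * (p * W - 1) - η ^ 2) * G ^ 2 =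
      B ^ 3 * (ν ^ 2 * (κ ^ 2 - 2 * a) - 2 * ν * (κ * (p + 1) - 2 * a) * (κ - a)
        + (p ^ 2 - 1 + ν) * (κ - a) ^ 2) := by
    rw [hV, hν]; simp only [c, N₁, G]; rw [ha]; ring
  rw [e]
  generalize κ = k
  apply mul_neg_of_pos_of_neg (by positivity)
  have hf : 0 < p + 1 - ν := by linarith
  have c1pos : 0 < (2 * p + 1) * ν - ν ^ 2 - (p ^ 2 - 1) := by
    have x1 := mul_nonneg (sub_nonneg.2 h3) hf.le
    have x2 := mul_nonneg (sub_nonneg.2 h3) (by linarith : 0 ≤ p + 1)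
    have x3 := mul_pos hf (by linarith : 0 < p - 1)
    linarith
  have key : a * (3 * ν - 2 * (p - 1)) - 2 * ((2 * p + 1) * ν - ν ^ 2 - (p ^ 2 - 1)) < 0 := by
    have x1 : a * (3 * ν - 2 * (p - 1)) < (p + 1 - ν) * (3 * ν - 2 * (p - 1)) :=
      mul_lt_mul_of_pos_right (by linarith) (by linarith)
    have x2 := mul_nonneg (by linarith : 0 ≤ ν) (sub_nonneg.2 h3)
    linarith
  have hν0 : 0 < ν := by linarith
  clear e hV hWB hNe hν ha h1 hΦ
  set c1 := (2 * p + 1) * ν - ν ^ 2 - (p ^ 2 - 1) with hc1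
  by_contra hcon
  push Not at hcon
  have := mul_nonneg c1pos.le hcon
  have e2 : c1 * (ν ^ 2 * (k ^ 2 - 2 * a) - 2 * ν * (k * (p + 1) - 2 * a) * (k - a)
        + (p ^ 2 - 1 + ν) * (k - a) ^ 2) =
      -(c1 * k - a * (ν * (p + 2) - (p ^ 2 - 1))) ^ 2 + a * ν ^ 2 * (a * (3 * ν - 2 * (p - 1)) - 2 * c1) := by
    rw [hc1]; ring
  rw [e2] at this
  have h5 : a * ν ^ 2 * (a * (3 * ν - 2 * (p - 1)) - 2 * c1) < 0 :=
    mul_neg_of_pos_of_neg (by positivity) key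
  linarith [sq_nonneg (c1 * k - a * (ν * (p + 2) - (p ^ 2 - 1)))]

lemma V_identity (η p ρ W t : ℝ) (hp : p + 1 ≠ 0) (hj : t + η ≠ 0) :
    let φ := W / (p + 1) - 1 / 2
    let n := 2 * η + 2
    let j := t + η
    let N := ρ * (W - 1) - η ^ 2
    let Φ := ρ * φ - η ^ 2 / 2
    let g := n * φ - η * (W - 1)
    let M := (p - 1) * W / (p + 1)
    let κ := 2 * φ + M * t
    let j' := -N - j ^ 2
    let W' := (p - 1) * W * t
    let N' := 2 * ρ * (W - 1) + ρ * W'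
    let M' := (p - 1) * W' / (p + 1)
    let g' := n * W' / (p + 1) - η * W'
    let κ' := 2 * (W' / (p + 1)) + (M' * t + M * j')
    let Q := 2 * Φ * g / j + N * M
    let Q' := (2 * (ρ * κ) * g + 2 * Φ * g') / j - 2 * Φ * g * j' / j ^ 2 + (N' * M + N * M')
    let B := ρ * W / (p + 1)
    let a := (p - 1) * B
    let k := 2 - η * (p - 1)
    let G := k * B - ρ
    let c := k ^ 2 * B - 2 * ρ
    let N₁ := k * (p + 1) * B - 2 * ρ
    Q ^ 2 - (Q' * κ - Q * κ') + (ρ * (p * W - 1) - η ^ 2) * κ ^ 2 =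
      (a ^ 2 * c - 2 * a * N₁ * G + p * a * G ^ 2 + (-2 * Φ) * a * G ^ 2 / j ^ 2
        - 2 * G * G ^ 2 / j) / ρ ^ 2 := by
  intro φ n j N Φ g M κ j' W' N' M' g' κ' Q Q' B a k G c N₁
  simp only [φ, n, j, N, Φ, g, M, κ, j', W', N', M', g', κ', Q, Q', B, a, k, G, c, N₁]
  field_simp
  ring

lemma V_nonpos (η p ρ W t : ℝ) (hp : 1 < p) (hρ : 0 < ρ) (hW : 0 < W)
    (hφ : 0 ≤ W / (p + 1) - 1 / 2)
    (hP : 0 < (t + η) ^ 2 / 2 + (ρ * (W / (p + 1) - 1 / 2) - η ^ 2 / 2))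
    (hκ : 0 < (t + η) * (2 * (W / (p + 1) - 1 / 2) + (p - 1) * W / (p + 1) * t)) :
    let j := t + η
    let Φ := ρ * (W / (p + 1) - 1 / 2) - η ^ 2 / 2
    let B := ρ * W / (p + 1)
    let a := (p - 1) * B
    let k := 2 - η * (p - 1)
    let G := k * B - ρ
    let c := k ^ 2 * B - 2 * ρ
    let N₁ := k * (p + 1) * B - 2 * ρ
    a ^ 2 * c - 2 * a * N₁ * G + p * a * G ^ 2 + (-2 * Φ) * a * G ^ 2 / j ^ 2
        - 2 * G * G ^ 2 / j ≤ 0 := by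
  intro j Φ B a k G c N₁
  have hj : j ≠ 0 := by
    intro h; simp only [j] at h; rw [h] at hκ; simp at hκ
  have hB : 0 < B := by positivity
  have ha : 0 < a := mul_pos (by linarith) hB
  have e : a ^ 2 * c - 2 * a * N₁ * G + p * a * G ^ 2 + (-2 * Φ) * a * G ^ 2 / j ^ 2
        - 2 * G * G ^ 2 / j = (p - 1) * a * (ρ * (ρ - 2 * B)) - 2 * G ^ 2 * ((G + a * j) / j)
        - a * G ^ 2 * (1 + 2 * Φ / j ^ 2) := by
    simp only [c, N₁]
    field_simp
    simp only [G, a]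
    ring
  rw [e]
  have h1 : ρ - 2 * B ≤ 0 := by
    have : B = ρ * (W / (p + 1)) := by simp only [B]; ring
    rw [this]; nlinarith
  have h2 : 0 ≤ (G + a * j) / j := by
    have : (G + a * j) / j = ρ * (j * (2 * (W / (p + 1) - 1 / 2) + (p - 1) * W / (p + 1) * t)) / j ^ 2 := by
      simp only [G, a, B, k]; field_simp; simp only [j]; ring
    rw [this]
    have := mul_pos hρ hκ
    positivity
  have h3 : 0 ≤ 1 + 2 * Φ / j ^ 2 := by
    have hj2 : 0 < j ^ 2 := by positivity
    have : -1 ≤ 2 * Φ / j ^ 2 := by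
      rw [le_div_iff₀ hj2]; simp only [Φ, j]; linarith
    linarith
  have := mul_nonneg (mul_nonneg (by linarith : 0 ≤ p - 1) ha.le) (mul_nonneg hρ.le (neg_nonneg.2 h1))
  have := mul_nonneg (sq_nonneg G) h2
  have := mul_nonneg (mul_nonneg ha.le (sq_nonneg G)) h3
  linarith

lemma le_of_hasDerivAt_nonneg {g g' : ℝ → ℝ} {a b : ℝ} (hab : a ≤ b) (hc : ContinuousOn g (Icc a b))
    (hd : ∀ x ∈ Ioo a b, HasDerivAt g (g' x) x) (h0 : ∀ x ∈ Ioo a b, 0 ≤ g' x) : g a ≤ g b := by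
  have : MonotoneOn g (Icc a b) := by
    apply monotoneOn_of_deriv_nonneg (convex_Icc a b) hc
    · intro x hx; rw [interior_Icc] at hx
      exact (hd x hx).differentiableAt.differentiableWithinAt
    · intro x hx; rw [interior_Icc] at hx
      rw [(hd x hx).deriv]; exact h0 x hx
  exact this (left_mem_Icc.2 hab) (right_mem_Icc.2 hab) hab

lemma lt_of_hasDerivAt_pos {g g' : ℝ → ℝ} {a b : ℝ} (hab : a < b) (hc : ContinuousOn g (Icc a b))
    (hd : ∀ x ∈ Ioo a b, HasDerivAt g (g' x) x) (h0 : ∀ x ∈ Ioo a b, 0 < g' x) : g a < g b := by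
  have : StrictMonoOn g (Icc a b) := by
    apply strictMonoOn_of_deriv_pos (convex_Icc a b) hc
    intro x hx; rw [interior_Icc] at hx
    rw [(hd x hx).deriv]; exact h0 x hx
  exact this (left_mem_Icc.2 hab.le) (right_mem_Icc.2 hab.le) hab

lemma exists_first_nonpos {g : ℝ → ℝ} {a b : ℝ} (hab : a ≤ b) (hc : ContinuousOn g (Icc a b))
    (ha : 0 < g a) (hb : g b ≤ 0) : ∃ x ∈ Ioc a b, g x = 0 ∧ ∀ y ∈ Ico a x, 0 < g y := by
  have hK : IsCompact (Icc a b ∩ g ⁻¹' Iic 0) :=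
    isCompact_Icc.of_isClosed_subset (hc.preimage_isClosed_of_isClosed isClosed_Icc isClosed_Iic)
      inter_subset_left
  obtain ⟨x, ⟨hx, hx0⟩, hmin⟩ := hK.exists_isLeast ⟨b, right_mem_Icc.2 hab, hb⟩
  have hx0 : g x ≤ 0 := hx0
  have hlt : ∀ y ∈ Ico a x, 0 < g y := by
    intro y hy
    by_contra h
    exact absurd (hmin ⟨⟨hy.1, hy.2.le.trans hx.2⟩, not_lt.1 h⟩) (not_le.2 hy.2)
  have hax : a < x := lt_of_le_of_ne hx.1 (by rintro rfl; linarith)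
  refine ⟨x, ⟨hax, hx.2⟩, le_antisymm hx0 ?_, hlt⟩
  have hcx : ContinuousWithinAt g (Ico a x) x :=
    (hc x hx).mono fun y hy => ⟨hy.1, hy.2.le.trans hx.2⟩
  have : (nhdsWithin x (Ico a x)).NeBot := by
    rw [← mem_closure_iff_nhdsWithin_neBot, closure_Ico hax.ne]
    exact right_mem_Icc.2 hax.le
  exact ge_of_tendsto hcx (eventually_nhdsWithin_of_forall fun y hy => (hlt y hy).le)

lemma exists_last_nonpos {g : ℝ → ℝ} {a b : ℝ} (hab : a ≤ b) (hc : ContinuousOn g (Icc a b))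
    (ha : g a ≤ 0) (hb : 0 < g b) : ∃ x ∈ Ico a b, g x = 0 ∧ ∀ y ∈ Ioc x b, 0 < g y := by
  have hc' : ContinuousOn (fun x => g (-x)) (Icc (-b) (-a)) :=
    hc.comp continuous_neg.continuousOn fun x hx => ⟨by linarith [hx.2], by linarith [hx.1]⟩
  obtain ⟨x, hx, h0, h1⟩ := exists_first_nonpos (neg_le_neg hab) hc' (by simpa using hb) (by simpa using ha)
  refine ⟨-x, ⟨by linarith [hx.2], by linarith [hx.1]⟩, h0, fun y hy => ?_⟩
  simpa using h1 (-y) ⟨by linarith [hy.2], by linarith [hy.1]⟩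

lemma eventually_right_of_deriv_pos {g : ℝ → ℝ} {g' x : ℝ} (h : HasDerivAt g g' x) (hg : 0 < g') :
    ∃ δ > 0, ∀ y ∈ Ioo x (x + δ), g x < g y := by
  have := (hasDerivAt_iff_tendsto_slope.1 h).eventually (lt_mem_nhds hg)
  rw [eventually_nhdsWithin_iff, Metric.eventually_nhds_iff] at this
  obtain ⟨δ, hδ, hh⟩ := this
  refine ⟨δ, hδ, fun y hy => ?_⟩
  have h1 := hh (y := y) (by rw [Real.dist_eq, abs_lt]; constructor <;> linarith [hy.1, hy.2]) hy.1.ne'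
  rw [slope_def_field] at h1
  have h2 := (div_pos_iff_of_pos_right (by linarith [hy.1] : 0 < y - x)).1 h1
  linarith

lemma eventually_left_of_deriv_pos {g : ℝ → ℝ} {g' x : ℝ} (h : HasDerivAt g g' x) (hg : 0 < g') :
    ∃ δ > 0, ∀ y ∈ Ioo (x - δ) x, g y < g x := by
  have h' : HasDerivAt (fun y => -g (-y)) g' (-x) := by
    have : HasDerivAt g g' (-(-x)) := by rwa [neg_neg]
    simpa [Function.comp_def] using (this.comp (-x) (hasDerivAt_neg (-x))).fun_neg
  obtain ⟨δ, hδ, hh⟩ := eventually_right_of_deriv_pos h' hg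
  refine ⟨δ, hδ, fun y hy => ?_⟩
  have := hh (-y) ⟨by linarith [hy.2], by linarith [hy.1]⟩
  simp only [neg_neg] at this
  linarith

lemma downcross {g : ℝ → ℝ} {a b : ℝ} (hab : a ≤ b) (hc : ContinuousOn g (Icc a b)) (ha : 0 < g a)
    (hb : g b < 0) (hd : ∀ x ∈ Icc a b, g x = 0 → ∃ g' < 0, HasDerivAt g g' x) :
    ∃ τ ∈ Ioo a b, g τ = 0 ∧ (∀ x ∈ Ico a τ, 0 < g x) ∧ ∀ x ∈ Ioc τ b, g x < 0 := by
  obtain ⟨τ, hτ, h0, h1⟩ := exists_first_nonpos hab hc ha hb.le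
  have hτb : τ < b := lt_of_le_of_ne hτ.2 (by rintro rfl; linarith)
  refine ⟨τ, ⟨hτ.1, hτb⟩, h0, h1, fun x hx => ?_⟩
  by_contra hgx
  push Not at hgx
  obtain ⟨g', hg', hd'⟩ := hd τ ⟨hτ.1.le, hτ.2⟩ h0
  obtain ⟨δ, hδ, hh⟩ := eventually_right_of_deriv_pos hd'.neg (neg_pos.2 hg')
  obtain ⟨w, hw1, hw2⟩ := exists_between (lt_min hx.1 (by linarith : τ < τ + δ))
  have hgw := hh w ⟨hw1, hw2.trans_le (min_le_right _ _)⟩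
  have hwx : w < x := hw2.trans_le (min_le_left _ _)
  simp only [Pi.neg_apply, h0, neg_zero] at hgw
  have hsub : Icc w x ⊆ Icc a b := Icc_subset_Icc (by linarith [hτ.1]) hx.2
  obtain ⟨m, hm, hm0, hm1⟩ := exists_first_nonpos (g := fun x => -g x) hwx.le (hc.mono hsub).neg hgw
    (by simpa using hgx)
  obtain ⟨k', hk', hdk⟩ := hd m (hsub ⟨hm.1.le, hm.2⟩) (by simpa using hm0)
  obtain ⟨ε, hε, hh2⟩ := eventually_left_of_deriv_pos hdk.neg (neg_pos.2 hk')
  obtain ⟨q, hq1, hq2⟩ := exists_between (max_lt hm.1 (by linarith : m - ε < m))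
  have h3 := hh2 q ⟨(le_max_right _ _).trans_lt hq1, hq2⟩
  have h4 := hm1 q ⟨((le_max_left _ _).trans_lt hq1).le, hq2⟩
  simp only [Pi.neg_apply] at h3
  linarith

/-- Antiderivative. -/
lemma exists_primitive {h : ℝ → ℝ} {a b : ℝ} (hab : a ≤ b) (hc : ContinuousOn h (Icc a b)) :
    ∃ H : ℝ → ℝ, Continuous H ∧ ∀ x ∈ Ioo a b, HasDerivAt H (h x) x := by
  have hext : Continuous (IccExtend hab (domRestrict (Icc a b) h)) :=
    (continuousOn_iff_continuous_domRestrict.1 hc).Icc_extend'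
  refine ⟨fun x => ∫ y in a..x, IccExtend hab (domRestrict (Icc a b) h) y, ?_, fun x hx => ?_⟩
  · exact intervalIntegral.continuous_primitive (fun _ _ => hext.intervalIntegrable _ _) a
  · have := intervalIntegral.integral_hasDerivAt_right (hext.intervalIntegrable a x)
      hext.aestronglyMeasurable.stronglyMeasurableAtFilter hext.continuousAt
    rwa [IccExtend_of_mem _ _ ⟨hx.1.le, hx.2.le⟩] at this

lemma barrier_pos {y y' G h : ℝ → ℝ} {a b : ℝ} (hab : a ≤ b)
    (hy : ∀ x ∈ Icc a b, HasDerivAt y (y' x) x) (hy' : ∀ x ∈ Icc a b, HasDerivAt y' (-G x * y x) x)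
    (hc : ContinuousOn h (Icc a b))
    (hr : ∀ x ∈ Ioo a b, ∃ h', HasDerivAt h h' x ∧ h' + h x ^ 2 + G x ≤ 0)
    (ha : 0 < y a) (hq : 0 ≤ y' a - h a * y a) :
    (∀ x ∈ Icc a b, 0 < y x) ∧ 0 ≤ y' b - h b * y b ∧
      (0 < y' a - h a * y a → 0 < y' b - h b * y b) := by
  obtain ⟨H, Hc, Hd⟩ := exists_primitive hab hc
  have yc : ContinuousOn y (Icc a b) := fun x hx => (hy x hx).continuousAt.continuousWithinAt
  have y'c : ContinuousOn y' (Icc a b) := fun x hx => (hy' x hx).continuousAt.continuousWithinAt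
  have hQc : ContinuousOn (fun x => exp (H x) * (y' x - h x * y x)) (Icc a b) := by fun_prop
  have hYc : ContinuousOn (fun x => exp (-H x) * y x) (Icc a b) := by fun_prop
  choose! h' hh' using hr
  have hQd : ∀ x ∈ Ioo a b, HasDerivAt (fun x => exp (H x) * (y' x - h x * y x))
      (exp (H x) * (-(h' x + h x ^ 2 + G x) * y x)) x := by
    intro x hx
    have hx' := Ioo_subset_Icc_self hx
    exact ((Hd x hx).exp.fun_mul ((hy' x hx').fun_sub ((hh' x hx).1.fun_mul (hy x hx')))).congr_deriv
      (by ring)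
  have hYd : ∀ x ∈ Ioo a b, HasDerivAt (fun x => exp (-H x) * y x)
      (exp (-H x) * (y' x - h x * y x)) x := by
    intro x hx
    have hx' := Ioo_subset_Icc_self hx
    exact ((Hd x hx).fun_neg.exp.fun_mul (hy x hx')).congr_deriv (by ring)
  have key : ∀ x ∈ Icc a b, (∀ w ∈ Ioo a x, 0 ≤ y w) →
      exp (H a) * (y' a - h a * y a) ≤ exp (H x) * (y' x - h x * y x) := by
    intro x hx hw
    refine le_of_hasDerivAt_nonneg hx.1 (hQc.mono (Icc_subset_Icc_right hx.2))
      (fun w hw' => hQd w ⟨hw'.1, hw'.2.trans_le hx.2⟩) fun w hw' => ?_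
    have h1 := hw w hw'
    have h2 := (hh' w ⟨hw'.1, hw'.2.trans_le hx.2⟩).2
    have h3 : 0 ≤ -(h' w + h w ^ 2 + G w) := by linarith
    positivity
  have pos : ∀ x ∈ Icc a b, 0 < y x := by
    intro x hx
    by_contra hcon
    obtain ⟨m, hm, hm0, hm1⟩ := exists_first_nonpos hx.1 (yc.mono (Icc_subset_Icc_right hx.2)) ha
      (not_lt.1 hcon)
    have h1 : exp (-H a) * y a ≤ exp (-H m) * y m := by
      refine le_of_hasDerivAt_nonneg hm.1.le (hYc.mono (Icc_subset_Icc_right (hm.2.trans hx.2)))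
        (fun w hw => hYd w ⟨hw.1, hw.2.trans_le (hm.2.trans hx.2)⟩) fun w hw => ?_
      have h2 := key w ⟨hw.1.le, hw.2.le.trans (hm.2.trans hx.2)⟩
        fun v hv => (hm1 v ⟨hv.1.le, hv.2.trans hw.2⟩).le
      have h3 : 0 ≤ y' w - h w * y w :=
        nonneg_of_mul_nonneg_right ((mul_nonneg (exp_pos _).le hq).trans h2) (exp_pos _)
      positivity
    rw [hm0, mul_zero] at h1
    have := mul_pos (exp_pos (-H a)) ha
    linarith
  have kb := key b (right_mem_Icc.2 hab) fun w hw => (pos w (Ioo_subset_Icc_self hw)).le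
  refine ⟨pos, nonneg_of_mul_nonneg_right ((mul_nonneg (exp_pos _).le hq).trans kb) (exp_pos _),
    fun hq' => ?_⟩
  exact pos_of_mul_pos_right ((mul_pos (exp_pos _) hq').trans_le kb) (exp_pos _).le

lemma barrier_pos_of_nonneg {y y' G h : ℝ → ℝ} {a b : ℝ} (hab : a ≤ b)
    (hy : ∀ x ∈ Icc a b, HasDerivAt y (y' x) x) (hy' : ∀ x ∈ Icc a b, HasDerivAt y' (-G x * y x) x)
    (hc : ContinuousOn h (Icc a b))
    (hr : ∀ x ∈ Ioo a b, ∃ h', HasDerivAt h h' x ∧ h' + h x ^ 2 + G x ≤ 0)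
    (ha : 0 ≤ y a) (hq : 0 < y' a - h a * y a) :
    (∀ x ∈ Ioc a b, 0 < y x) ∧ 0 < y' b - h b * y b := by
  rcases ha.lt_or_eq with ha | ha
  · obtain ⟨h1, -, h2⟩ := barrier_pos hab hy hy' hc hr ha hq.le
    exact ⟨fun x hx => h1 x ⟨hx.1.le, hx.2⟩, h2 hq⟩
  rcases hab.eq_or_lt with rfl | hab'
  · exact ⟨fun x hx => absurd hx.1 (not_lt.2 hx.2), hq⟩
  obtain ⟨δ, hδ, hh⟩ := eventually_right_of_deriv_pos (hy a (left_mem_Icc.2 hab))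
    (by rw [← ha] at hq; linarith)
  have yc : ContinuousOn y (Icc a b) := fun x hx => (hy x hx).continuousAt.continuousWithinAt
  have y'c : ContinuousOn y' (Icc a b) := fun x hx => (hy' x hx).continuousAt.continuousWithinAt
  have hQc : ContinuousOn (fun x => y' x - h x * y x) (Icc a b) := by fun_prop
  have hQ : ∀ᶠ x in nhdsWithin a (Icc a b), 0 < y' x - h x * y x :=
    (hQc a (left_mem_Icc.2 hab)).eventually (lt_mem_nhds hq)
  rw [eventually_nhdsWithin_iff, Metric.eventually_nhds_iff] at hQ
  obtain ⟨ε, hε, hQ⟩ := hQ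
  have main : ∀ s ∈ Ioo a b, s < a + δ → s < a + ε →
      (∀ x ∈ Icc s b, 0 < y x) ∧ 0 < y' b - h b * y b := by
    intro s hs h1 h2
    have hs' : Icc s b ⊆ Icc a b := Icc_subset_Icc_left hs.1.le
    have q0 := hQ (y := s) (by rw [Real.dist_eq, abs_lt]; constructor <;> linarith [hs.1])
      ⟨hs.1.le, hs.2.le⟩
    have y0 := hh s ⟨hs.1, h1⟩
    rw [← ha] at y0
    obtain ⟨h1, -, h2⟩ := barrier_pos hs.2.le (fun x hx => hy x (hs' hx)) (fun x hx => hy' x (hs' hx))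
      (hc.mono hs') (fun x hx => hr x ⟨hs.1.trans hx.1, hx.2⟩) y0 q0.le
    exact ⟨h1, h2 q0⟩
  have hlt : ∀ x ∈ Ioc a b, ∃ s ∈ Ioo a b, s ≤ x ∧ s < a + δ ∧ s < a + ε := by
    intro x hx
    obtain ⟨s, hs1, hs2⟩ := exists_between (lt_min hx.1 (lt_min (by linarith : a < a + δ)
      (by linarith : a < a + ε)))
    simp only [lt_min_iff] at hs2
    exact ⟨s, ⟨hs1, hs2.1.trans_le hx.2⟩, hs2.1.le, hs2.2⟩
  constructor
  · intro x hx
    obtain ⟨s, hs, h1, h2, h3⟩ := hlt x hx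
    exact (main s hs h2 h3).1 x ⟨h1, hx.2⟩
  · obtain ⟨s, hs, h1, h2, h3⟩ := hlt b ⟨hab', le_rfl⟩
    exact (main s hs h2 h3).2

lemma barrier_nonneg_of_tendsto {y y' G h : ℝ → ℝ} {b : ℝ}
    (hy : ∀ x ≤ b, HasDerivAt y (y' x) x) (hy' : ∀ x ≤ b, HasDerivAt y' (-G x * y x) x)
    (hr : ∀ x ≤ b, ∃ h', HasDerivAt h h' x ∧ h' + h x ^ 2 + G x ≤ 0)
    (hpos : ∀ x ≤ b, 0 ≤ y x) (hh : ∀ x ≤ b, 0 ≤ h x)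
    (hlim : Tendsto (fun x => y' x - h x * y x) atBot (nhds 0)) : 0 ≤ y' b - h b * y b := by
  by_contra hcon
  push Not at hcon
  choose! h' hh' using hr
  have hQd : ∀ x ≤ b, HasDerivAt (fun x => y' x - h x * y x)
      (-(h' x + h x ^ 2 + G x) * y x - h x * (y' x - h x * y x)) x := by
    intro x hx
    exact ((hy' x hx).fun_sub ((hh' x hx).1.fun_mul (hy x hx))).congr_deriv (by ring)
  set Q := fun x => y' x - h x * y x with hQ
  have mono : ∀ x ≤ b, (∀ w ∈ Ioo x b, Q w ≤ 0) → Q x ≤ Q b := by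
    intro x hx hw
    refine le_of_hasDerivAt_nonneg hx (fun w hw' => (hQd w hw'.2).continuousAt.continuousWithinAt)
      (fun w hw' => hQd w hw'.2.le) fun w hw' => ?_
    have h1 := hw w hw'
    have h2 := mul_nonneg (hh w hw'.2.le) (neg_nonneg.2 h1)
    have h3 := mul_nonneg (by linarith [(hh' w hw'.2.le).2] : 0 ≤ -(h' w + h w ^ 2 + G w)) (hpos w hw'.2.le)
    simp only [hQ] at h2
    linarith
  have neg : ∀ x ≤ b, Q x < 0 := by
    intro x hx
    by_contra hx0
    obtain ⟨m, hm, hm0, hm1⟩ := exists_last_nonpos (g := fun x => -Q x) hx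
      (fun w hw' => (hQd w hw'.2).continuousAt.neg.continuousWithinAt) (by linarith) (by simpa [hQ] using hcon)
    have := mono m hm.2.le fun w hw => by have := hm1 w ⟨hw.1, hw.2.le⟩; linarith
    have h5 : Q b < 0 := hcon
    linarith
  have hle : ∀ x ≤ b, Q x ≤ Q b := fun x hx => mono x hx fun w hw => (neg w hw.2.le).le
  have := le_of_tendsto hlim ((eventually_le_atBot b).mono hle)
  exact absurd hcon (not_lt.2 this)

/-- `F(u) = phi p (|u|^(p-1)) * u^2`. -/
noncomputable def phi (p W : ℝ) : ℝ := W / (p + 1) - 1 / 2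
noncomputable def Phi (η p ρ W : ℝ) : ℝ := ρ * phi p W - η ^ 2 / 2

noncomputable def bigN (η ρ W : ℝ) : ℝ := ρ * (W - 1) - η ^ 2
noncomputable def bigG (η p W : ℝ) : ℝ := (2 * η + 2) * phi p W - η * (W - 1)

noncomputable def kap (p W t : ℝ) : ℝ := 2 * phi p W + (p - 1) * W / (p + 1) * t
noncomputable def bigT (η p ρ W t : ℝ) : ℝ := bigN η ρ W * (t + η) + ρ * bigG η p W

noncomputable def hw (η p ρ W w : ℝ) : ℝ :=
  η ^ 2 * w / (1 + η * w) - ρ * (W - 1) * w + (2 * η + 2) * ρ * phi p W * w ^ 2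

noncomputable def hV (η p ρ W t : ℝ) : ℝ :=
  -(2 * Phi η p ρ W * bigG η p W / (t + η) + bigN η ρ W * ((p - 1) * W / (p + 1))) / kap p W t

noncomputable def hII (η p ρ W t : ℝ) : ℝ := -bigN η ρ W ^ 2 / bigT η p ρ W t

lemma riccati_quotient {a q k : ℝ} (V : ℝ) (hk : k ≠ 0) :
    (a / k ^ 2 + (q / k) ^ 2 + V) * k ^ 2 = a + q ^ 2 + V * k ^ 2 := by
  field_simp

lemma quotient_deriv_split {j : ℝ} (hj : j ≠ 0) {a b c : ℝ} :
    (a * j - b * c) / j ^ 2 = a / j - b * c / j ^ 2 := by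
  field_simp

/-- The quantities `ρ = r^2`, `W = |u|^(p-1)` and `t = r u' / u` as functions of `x = log r`,
where `u ≠ 0`. -/
structure CellODE (η p : ℝ) (ρ W t : ℝ → ℝ) (x : ℝ) : Prop where
  ρ_pos : 0 < ρ x
  W_pos : 0 < W x
  dρ : HasDerivAt ρ (2 * ρ x) x
  dW : HasDerivAt W ((p - 1) * W x * t x) x
  dt : HasDerivAt t (-2 * η * t x - ρ x * (W x - 1) - t x ^ 2) x
  energy : 0 < t x ^ 2 / 2 + ρ x * phi p (W x)
  pohozaev : 0 < (t x + η) ^ 2 / 2 + Phi η p (ρ x) (W x)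

/-- The standing assumptions on the parameters, with `η = (n - 2) / 2`. -/
structure Params (η p : ℝ) : Prop where
  η_ge : 1 / 2 ≤ η
  p_gt : 1 < p

namespace CellODE
variable {η p : ℝ} {ρ W t : ℝ → ℝ} {x : ℝ}

lemma dphi (h : CellODE η p ρ W t x) :
    HasDerivAt (fun x => phi p (W x)) ((p - 1) * W x * t x / (p + 1)) x :=
  (h.dW.div_const _).sub_const _

lemma dPhi (h : CellODE η p ρ W t x) :
    HasDerivAt (fun x => Phi η p (ρ x) (W x)) (ρ x * kap p (W x) (t x)) x :=
  ((h.dρ.fun_mul h.dphi).sub_const _).congr_deriv (by unfold kap; ring)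

lemma dkap (h : CellODE η p ρ W t x) :
    HasDerivAt (fun x => kap p (W x) (t x)) ((p - 1) * W x / (p + 1) *
      (2 * t x + (p - 1) * t x ^ 2 + (-2 * η * t x - ρ x * (W x - 1) - t x ^ 2))) x :=
  ((h.dphi.const_mul 2).fun_add (((h.dW.const_mul (p - 1)).div_const (p + 1)).fun_mul h.dt)).congr_deriv
    (by ring)

lemma dbigN (h : CellODE η p ρ W t x) : HasDerivAt (fun x => bigN η (ρ x) (W x))
    (2 * ρ x * (W x - 1) + ρ x * ((p - 1) * W x * t x)) x :=
  (h.dρ.fun_mul (h.dW.sub_const 1)).sub_const _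

lemma dbigG (h : CellODE η p ρ W t x) : HasDerivAt (fun x => bigG η p (W x))
    ((2 * η + 2) * ((p - 1) * W x * t x) / (p + 1) - η * ((p - 1) * W x * t x)) x :=
  ((h.dphi.const_mul _).fun_sub ((h.dW.sub_const 1).const_mul η)).congr_deriv (by ring)

lemma dbigT (h : CellODE η p ρ W t x) : HasDerivAt (fun x => bigT η p (ρ x) (W x) (t x))
    ((2 * ρ x * (W x - 1) + ρ x * ((p - 1) * W x * t x)) * (t x + η)
      + bigN η (ρ x) (W x) * (-bigN η (ρ x) (W x) - (t x + η) ^ 2) + 2 * ρ x * bigG η p (W x)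
      + ρ x * ((2 * η + 2) * ((p - 1) * W x * t x) / (p + 1) - η * ((p - 1) * W x * t x))) x :=
  ((h.dbigN.fun_mul (h.dt.add_const η)).fun_add (h.dρ.fun_mul h.dbigG)).congr_deriv
    (by unfold bigN; ring)

lemma dt_neg (h : CellODE η p ρ W t x) (hP : Params η p) :
    -2 * η * t x - ρ x * (W x - 1) - t x ^ 2 < 0 := by
  have h1 := h.pohozaev
  have h2 := mul_pos h.ρ_pos h.W_pos
  have h3 : 0 < ρ x * W x * (p - 1) / (p + 1) := by
    have := hP.p_gt; have : 0 < p - 1 := by linarith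
    positivity
  have hp : p + 1 ≠ 0 := by have := hP.p_gt; linarith
  have e : -2 * η * t x - ρ x * (W x - 1) - t x ^ 2 = -2 * ((t x + η) ^ 2 / 2 + Phi η p (ρ x) (W x))
    - ρ x * W x * (p - 1) / (p + 1) := by
    unfold Phi phi; field_simp; ring
  rw [e]; linarith

/-- `hw` is a Riccati subsolution for the equation of `y`. -/
lemma hw_riccati (h : CellODE η p ρ W t x) (hP : Params η p) (ht : t x ≠ 0) (hφ : phi p (W x) ≤ 0) :
    ∃ h', HasDerivAt (fun x => hw η p (ρ x) (W x) (t x)⁻¹) h' x ∧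
      h' + hw η p (ρ x) (W x) (t x)⁻¹ ^ 2 + (ρ x * (p * W x - 1) - η ^ 2) ≤ 0 := by
  have hp : p + 1 ≠ 0 := by have := hP.p_gt; linarith
  have hη := hP.η_ge
  have hj : t x + η ≠ 0 := by
    intro h0
    have := h.pohozaev
    unfold Phi at this
    have h2 := mul_nonneg h.ρ_pos.le (neg_nonneg.2 hφ)
    rw [h0] at this
    nlinarith
  have h1 : 1 + η * (t x)⁻¹ ≠ 0 := by
    intro h0; apply hj
    have : t x + η = t x * (1 + η * (t x)⁻¹) := by field_simp
    rw [this, h0, mul_zero]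
  have hd := ((((h.dt.inv ht).const_mul (η ^ 2)).fun_div (((h.dt.inv ht).const_mul η).const_add 1) h1).fun_sub
    ((h.dρ.fun_mul (h.dW.sub_const 1)).fun_mul (h.dt.inv ht))).fun_add
    (((h.dρ.const_mul (2 * η + 2)).fun_mul h.dphi).fun_mul ((h.dt.inv ht).fun_pow 2))
  refine ⟨_, hd, ?_⟩
  have h2 := w_nonpos η p (ρ x) (W x) (t x) hη hP.p_gt h.ρ_pos h.W_pos ht hφ h.energy h.pohozaev
  have h3 := mul_nonpos_of_nonneg_of_nonpos h.ρ_pos.le h2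
  have h4 := w_identity η p (ρ x) (W x) (t x) hp ht hj
  simp only at h4
  rw [← h4] at h3
  refine le_of_eq_of_le ?_ h3
  have e1 : hw η p (ρ x) (W x) (t x)⁻¹ = η ^ 2 / (t x + η) - ρ x * (W x - 1) / t x +
    (2 * η + 2) * ρ x * (W x / (p + 1) - 1 / 2) / t x ^ 2 := by
    unfold hw phi; field_simp
  rw [e1]
  rw [← add_sub_assoc, add_sub_right_comm]
  congr 3
  generalize -2 * η * t x - ρ x * (W x - 1) - t x ^ 2 = t'
  have h1' : 1 + η * (t x)⁻¹ = (t x + η) / t x := by field_simp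
  simp only [Pi.inv_apply, phi, Nat.cast_ofNat, Nat.add_one_sub_one, pow_one]
  rw [h1']
  field_simp
  ring

/-- `hV` is a Riccati subsolution for the equation of `y`. -/
lemma hV_riccati (h : CellODE η p ρ W t x) (hP : Params η p) (hφ : 0 ≤ phi p (W x))
    (hκ : 0 < (t x + η) * kap p (W x) (t x)) :
    ∃ h', HasDerivAt (fun x => hV η p (ρ x) (W x) (t x)) h' x ∧
      h' + hV η p (ρ x) (W x) (t x) ^ 2 + (ρ x * (p * W x - 1) - η ^ 2) ≤ 0 := by
  have hp : p + 1 ≠ 0 := by have := hP.p_gt; linarith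
  have hj : t x + η ≠ 0 := by rintro h0; rw [h0] at hκ; simp at hκ
  have hk : kap p (W x) (t x) ≠ 0 := by rintro h0; rw [h0] at hκ; simp at hκ
  have hd := (((((h.dPhi (η := η)).const_mul 2).fun_mul h.dbigG).fun_div (h.dt.add_const η) hj).fun_add
    (h.dbigN.fun_mul ((h.dW.const_mul (p - 1)).div_const (p + 1)))).fun_neg.fun_div h.dkap hk
  refine ⟨_, hd, ?_⟩
  have h2 := V_nonpos η p (ρ x) (W x) (t x) hP.p_gt h.ρ_pos h.W_pos hφ h.pohozaev hκ
  have h4 := V_identity η p (ρ x) (W x) (t x) hp hj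
  simp only at h4 h2
  have h3 := div_nonpos_of_nonpos_of_nonneg h2 (sq_nonneg (ρ x))
  rw [← h4] at h3
  have h5 := div_nonpos_of_nonpos_of_nonneg h3 (sq_nonneg (kap p (W x) (t x)))
  refine le_of_eq_of_le ?_ h5
  rw [eq_div_iff (pow_ne_zero 2 hk)]
  unfold hV
  rw [riccati_quotient _ hk, quotient_deriv_split hj]
  have ht : t x = t x + η - η := by ring
  generalize t x + η = j at ht hj ⊢
  rw [ht]
  unfold Phi bigN bigG kap phi
  have e : -2 * η * (j - η) - ρ x * (W x - 1) - (j - η) ^ 2 = -(ρ x * (W x - 1) - η ^ 2) - j ^ 2 := by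
    ring
  rw [e]
  generalize hM : (p + 1)⁻¹ = M
  simp only [div_eq_mul_inv, hM]
  ring

/-- `hII` is a Riccati subsolution for the equation of `y`. -/
lemma hII_riccati (h : CellODE η p ρ W t x) (hP : Params η p) (hΦ : 0 ≤ Phi η p (ρ x) (W x))
    (hT : bigT η p (ρ x) (W x) (t x) ≠ 0) :
    ∃ h', HasDerivAt (fun x => hII η p (ρ x) (W x) (t x)) h' x ∧
      h' + hII η p (ρ x) (W x) (t x) ^ 2 + (ρ x * (p * W x - 1) - η ^ 2) ≤ 0 := by
  have hp : p + 1 ≠ 0 := by have := hP.p_gt; linarith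
  have hd := (h.dbigN (η := η) |>.fun_pow 2).fun_neg.fun_div h.dbigT hT
  refine ⟨_, hd, ?_⟩
  have h2 := II_neg η p (ρ x) (W x) hP.η_ge hP.p_gt h.ρ_pos h.W_pos hΦ
  have h4 := II_identity η p (ρ x) (W x) (t x) hp
  simp only at h4 h2
  rw [← h4] at h2
  have h5 := div_nonpos_of_nonpos_of_nonneg h2.le (sq_nonneg (bigT η p (ρ x) (W x) (t x)))
  refine le_of_eq_of_le ?_ h5
  rw [eq_div_iff (pow_ne_zero 2 hT)]
  unfold hII
  rw [riccati_quotient _ hT]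
  unfold bigT bigN bigG phi
  ring

lemma bigT_deriv_lt (h : CellODE η p ρ W t x) (hP : Params η p) (hΦ : 0 ≤ Phi η p (ρ x) (W x))
    (hT : bigT η p (ρ x) (W x) (t x) = 0) :
    ∃ T', HasDerivAt (fun x => bigT η p (ρ x) (W x) (t x)) T' x ∧
      T' + bigN η (ρ x) (W x) ^ 2 < 0 := by
  have hp : p + 1 ≠ 0 := by have := hP.p_gt; linarith
  refine ⟨_, h.dbigT, ?_⟩
  have h2 := II_neg η p (ρ x) (W x) hP.η_ge hP.p_gt h.ρ_pos h.W_pos hΦ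
  have h4 := II_identity η p (ρ x) (W x) (t x) hp
  simp only at h4 h2
  rw [← h4] at h2
  change bigN η (ρ x) (W x) * (t x + η) + ρ x * bigG η p (W x) = 0 at hT
  simp only [bigN, bigG, phi] at hT ⊢
  rw [hT] at h2
  refine neg_of_mul_neg_right (a := (ρ x * (W x - 1) - η ^ 2) ^ 2) (lt_of_eq_of_lt ?_ h2) (sq_nonneg _)
  ring

lemma kap_deriv_neg (h : CellODE η p ρ W t x) (hP : Params η p) (hφ : 0 ≤ phi p (W x))
    (hκ : kap p (W x) (t x) = 0) :
    ∃ k' < 0, HasDerivAt (fun x => kap p (W x) (t x)) k' x := by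
  have hp := hP.p_gt
  have hp1 : 0 < p + 1 := by linarith
  refine ⟨_, ?_, h.dkap⟩
  have hM : 0 < (p - 1) * W x / (p + 1) := by
    have := h.W_pos; have : 0 < p - 1 := by linarith
    positivity
  apply mul_neg_of_pos_of_neg hM
  unfold kap at hκ
  have ht : t x ≤ 0 := by
    by_contra h0
    have := mul_pos hM (not_le.1 h0)
    linarith
  have h2 : 0 < 2 + (p - 1) * t x := by
    have : W x * (2 + (p - 1) * t x) = p + 1 := by
      unfold phi at hκ; field_simp at hκ; linarith
    exact pos_of_mul_pos_right (by rw [this]; exact hp1) h.W_pos.le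
  have h3 := mul_nonpos_of_nonpos_of_nonneg ht h2.le
  have h4 := h.dt_neg hP
  linarith

end CellODE

/-- A solution `u` and its variation in the variable `x = log r`: `D = r u'`, `y = r^η v` and
`y' = dy/dx`, with positive energy and positive Pohozaev functional. -/
structure LogFlow (η p : ℝ) (u D y y' : ℝ → ℝ) : Prop where
  u_deriv : ∀ x, HasDerivAt u (D x) x
  D_deriv : ∀ x, HasDerivAt D (-2 * η * D x - exp (2 * x) * (|u x| ^ (p - 1) - 1) * u x) x
  y_deriv : ∀ x, HasDerivAt y (y' x) x
  y'_deriv : ∀ x, HasDerivAt y' (-(exp (2 * x) * (p * |u x| ^ (p - 1) - 1) - η ^ 2) * y x) x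
  energy : ∀ x, 0 < D x ^ 2 / 2 + exp (2 * x) * phi p (|u x| ^ (p - 1)) * u x ^ 2
  pohozaev : ∀ x, 0 < (D x + η * u x) ^ 2 / 2 +
    Phi η p (exp (2 * x)) (|u x| ^ (p - 1)) * u x ^ 2

/-- The Wronskian of `y` with `exp (η x) * u x`. -/
noncomputable def wronsk (η : ℝ) (u D y y' : ℝ → ℝ) (x : ℝ) : ℝ :=
  exp (η * x) * (y' x * u x - y x * (D x + η * u x))

lemma hasDerivAt_exp_mul (c x : ℝ) : HasDerivAt (fun x => exp (c * x)) (c * exp (c * x)) x := by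
  simpa [mul_comm] using ((hasDerivAt_id x).const_mul c).exp

lemma hasDerivAt_abs_rpow_of_pos {p : ℝ} {u : ℝ → ℝ} {D x : ℝ} (hd : HasDerivAt u D x)
    (hu : 0 < u x) :
    HasDerivAt (fun x => |u x| ^ (p - 1)) ((p - 1) * |u x| ^ (p - 1) * (D / u x)) x := by
  have h1 : HasDerivAt (fun x => u x ^ (p - 1)) _ x := hd.rpow_const (p := p - 1) (Or.inl hu.ne')
  refine (h1.congr_of_eventuallyEq ?_).congr_deriv ?_
  · filter_upwards [hd.continuousAt.eventually (lt_mem_nhds hu)] with z hz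
    rw [abs_of_pos hz]
  · rw [abs_of_pos hu, Real.rpow_sub_one hu.ne' (p - 1)]
    field_simp

namespace LogFlow
variable {η p : ℝ} {u D y y' : ℝ → ℝ} {x a b : ℝ}

lemma neg_u (h : LogFlow η p u D y y') : LogFlow η p (fun x => -u x) (fun x => -D x) y y' where
  u_deriv x := (h.u_deriv x).fun_neg
  D_deriv x := (h.D_deriv x).fun_neg.congr_deriv (by rw [abs_neg]; ring)
  y_deriv := h.y_deriv
  y'_deriv x := by simpa only [abs_neg] using h.y'_deriv x
  energy x := by simpa only [abs_neg, neg_sq] using h.energy x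
  pohozaev x := by
    have := h.pohozaev x
    simp only [abs_neg, neg_sq]
    convert this using 3; ring

lemma neg_y (h : LogFlow η p u D y y') : LogFlow η p u D (fun x => -y x) (fun x => -y' x) where
  u_deriv := h.u_deriv
  D_deriv := h.D_deriv
  y_deriv x := (h.y_deriv x).fun_neg
  y'_deriv x := (h.y'_deriv x).fun_neg.congr_deriv (by ring)
  energy := h.energy
  pohozaev := h.pohozaev

lemma u_cont (h : LogFlow η p u D y y') : Continuous u :=
  continuous_iff_continuousAt.2 fun x => (h.u_deriv x).continuousAt

lemma D_cont (h : LogFlow η p u D y y') : Continuous D :=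
  continuous_iff_continuousAt.2 fun x => (h.D_deriv x).continuousAt

lemma y_cont (h : LogFlow η p u D y y') : Continuous y :=
  continuous_iff_continuousAt.2 fun x => (h.y_deriv x).continuousAt

lemma W_cont (h : LogFlow η p u D y y') (hp : 1 < p) : Continuous fun x => |u x| ^ (p - 1) :=
  h.u_cont.abs.rpow_const fun _ => Or.inr (by linarith)

lemma φ_cont (h : LogFlow η p u D y y') (hp : 1 < p) :
    Continuous fun x => phi p (|u x| ^ (p - 1)) :=
  ((h.W_cont hp).div_const _).sub continuous_const

lemma cell (h : LogFlow η p u D y y') (hu : 0 < u x) :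
    CellODE η p (fun x => exp (2 * x)) (fun x => |u x| ^ (p - 1)) (fun x => D x / u x) x where
  ρ_pos := exp_pos _
  W_pos := rpow_pos_of_pos (abs_pos.2 hu.ne') _
  dρ := hasDerivAt_exp_mul 2 x
  dW := hasDerivAt_abs_rpow_of_pos (h.u_deriv x) hu
  dt := ((h.D_deriv x).fun_div (h.u_deriv x) hu.ne').congr_deriv (by field_simp)
  energy := by
    have := div_pos (h.energy x) (pow_pos hu 2)
    refine lt_of_lt_of_eq this ?_
    field_simp
  pohozaev := by
    have := div_pos (h.pohozaev x) (pow_pos hu 2)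
    refine lt_of_lt_of_eq this ?_
    field_simp

lemma D_ne (h : LogFlow η p u D y y') (hφ : phi p (|u x| ^ (p - 1)) ≤ 0) : D x ≠ 0 := by
  intro h0
  have h1 := h.energy x
  rw [h0] at h1
  have := mul_nonneg (mul_nonneg (exp_pos (2 * x)).le (neg_nonneg.2 hφ)) (sq_nonneg (u x))
  linarith

lemma D_ne_of_zero (h : LogFlow η p u D y y') (hu : u x = 0) : D x ≠ 0 := by
  intro h0
  have h1 := h.energy x
  rw [h0, hu] at h1
  norm_num at h1

lemma D_add_ne (h : LogFlow η p u D y y') (hφ : phi p (|u x| ^ (p - 1)) ≤ 0) :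
    D x + η * u x ≠ 0 := by
  intro h0
  have h1 := h.pohozaev x
  rw [h0] at h1
  unfold Phi at h1
  have h2 := mul_nonneg (mul_nonneg (exp_pos (2 * x)).le (neg_nonneg.2 hφ)) (sq_nonneg (u x))
  have h3 := mul_nonneg (sq_nonneg η) (sq_nonneg (u x))
  nlinarith

lemma hw_contOn (h : LogFlow η p u D y y') (hp : 1 < p) {s : Set ℝ}
    (hφ : ∀ x ∈ s, phi p (|u x| ^ (p - 1)) ≤ 0) :
    ContinuousOn (fun x => hw η p (exp (2 * x)) (|u x| ^ (p - 1)) (u x / D x)) s := by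
  have hw' : ContinuousOn (fun x => u x / D x) s :=
    h.u_cont.continuousOn.div h.D_cont.continuousOn fun x hx => h.D_ne (hφ x hx)
  have hρ : ContinuousOn (fun x => exp (2 * x)) s := by fun_prop
  have hW := (h.W_cont hp).continuousOn (s := s)
  unfold hw
  refine ((ContinuousOn.div (hw'.const_mul _) (continuousOn_const.add (hw'.const_mul _)) ?_).sub
    ((hρ.mul (hW.sub continuousOn_const)).mul hw')).add
    (((hρ.const_mul _).mul (h.φ_cont hp).continuousOn).mul (hw'.pow 2))
  intro x hx h0
  replace h0 : 1 + η * (u x / D x) = 0 := h0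
  apply h.D_add_ne (hφ x hx)
  have := h.D_ne (hφ x hx)
  have e : D x + η * u x = D x * (1 + η * (u x / D x)) := by field_simp
  rw [e, h0, mul_zero]

lemma hw_ric (h : LogFlow η p u D y y') (hP : Params η p) (hu : 0 < u x)
    (hφ : phi p (|u x| ^ (p - 1)) ≤ 0) :
    ∃ h', HasDerivAt (fun x => hw η p (exp (2 * x)) (|u x| ^ (p - 1)) (u x / D x)) h' x ∧
      h' + hw η p (exp (2 * x)) (|u x| ^ (p - 1)) (u x / D x) ^ 2 +
        (exp (2 * x) * (p * |u x| ^ (p - 1) - 1) - η ^ 2) ≤ 0 := by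
  have := (h.cell hu).hw_riccati hP (div_ne_zero (h.D_ne hφ) hu.ne') hφ
  simpa only [inv_div] using this

lemma hw_barrier (h : LogFlow η p u D y y') (hP : Params η p) (hab : a ≤ b)
    (hu : ∀ x ∈ Ioo a b, 0 < u x) (hφ : ∀ x ∈ Icc a b, phi p (|u x| ^ (p - 1)) ≤ 0)
    (ha : 0 < y a)
    (hq : 0 ≤ y' a - hw η p (exp (2 * a)) (|u a| ^ (p - 1)) (u a / D a) * y a) :
    (∀ x ∈ Icc a b, 0 < y x) ∧
      0 ≤ y' b - hw η p (exp (2 * b)) (|u b| ^ (p - 1)) (u b / D b) * y b ∧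
      (0 < y' a - hw η p (exp (2 * a)) (|u a| ^ (p - 1)) (u a / D a) * y a →
        0 < y' b - hw η p (exp (2 * b)) (|u b| ^ (p - 1)) (u b / D b) * y b) :=
  barrier_pos hab (fun x _ => h.y_deriv x) (fun x _ => h.y'_deriv x) (h.hw_contOn hP.p_gt hφ)
    (fun x hx => h.hw_ric hP (hu x hx) (hφ x (Ioo_subset_Icc_self hx))) ha hq

lemma hw_barrier_zero (h : LogFlow η p u D y y') (hP : Params η p) (hab : a ≤ b)
    (hu : ∀ x ∈ Ioo a b, 0 < u x) (hφ : ∀ x ∈ Icc a b, phi p (|u x| ^ (p - 1)) ≤ 0)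
    (ha : 0 ≤ y a)
    (hq : 0 < y' a - hw η p (exp (2 * a)) (|u a| ^ (p - 1)) (u a / D a) * y a) :
    (∀ x ∈ Ioc a b, 0 < y x) ∧
      0 < y' b - hw η p (exp (2 * b)) (|u b| ^ (p - 1)) (u b / D b) * y b :=
  barrier_pos_of_nonneg hab (fun x _ => h.y_deriv x) (fun x _ => h.y'_deriv x)
    (h.hw_contOn hP.p_gt hφ)
    (fun x hx => h.hw_ric hP (hu x hx) (hφ x (Ioo_subset_Icc_self hx))) ha hq

lemma wronsk_deriv (h : LogFlow η p u D y y') (x : ℝ) : HasDerivAt (wronsk η u D y y')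
    (-(exp (η * x) * (exp (2 * x) * ((p - 1) * |u x| ^ (p - 1)) * (y x * u x)))) x :=
  ((hasDerivAt_exp_mul η x).fun_mul (((h.y'_deriv x).fun_mul (h.u_deriv x)).fun_sub
    ((h.y_deriv x).fun_mul ((h.D_deriv x).fun_add ((h.u_deriv x).const_mul η))))).congr_deriv
    (by ring)

lemma wronsk_cont (h : LogFlow η p u D y y') : Continuous (wronsk η u D y y') :=
  continuous_iff_continuousAt.2 fun x => (h.wronsk_deriv x).continuousAt

lemma wronsk_lt (h : LogFlow η p u D y y') (hP : Params η p) (hab : a < b)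
    (hu : ∀ x ∈ Ioo a b, 0 < u x) (hy : ∀ x ∈ Ioo a b, 0 < y x) :
    wronsk η u D y y' b < wronsk η u D y y' a := by
  have := lt_of_hasDerivAt_pos hab (g := fun x => -wronsk η u D y y' x)
    h.wronsk_cont.neg.continuousOn (fun x _ => (h.wronsk_deriv x).fun_neg) (fun x hx => by
      have h1 := hu x hx
      have h2 := hy x hx
      have h3 : 0 < p - 1 := by have := hP.p_gt; linarith
      have h4 : 0 < |u x| ^ (p - 1) := rpow_pos_of_pos (abs_pos.2 h1.ne') _
      rw [neg_neg]
      positivity)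
  simpa using this

lemma y'_neg_of_wronsk (hu : 0 < u x) (hy : y x = 0) (hX : wronsk η u D y y' x < 0) : y' x < 0 := by
  unfold wronsk at hX
  rw [hy, zero_mul, sub_zero] at hX
  exact neg_of_mul_neg_left (neg_of_mul_neg_right hX (exp_pos _).le) hu.le

end LogFlow

lemma bigT_eq {η p ρ W t : ℝ} (hp : 1 < p) :
    bigT η p ρ W t = ρ * kap p W t + 2 * Phi η p ρ W * (t + η) := by
  have : p + 1 ≠ 0 := by linarith
  unfold bigT bigN bigG kap Phi phi
  field_simp
  ring

/-- The points where the comparison functions on a nodal cell have to be exchanged. -/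
structure Switch (η p : ℝ) (ρ W t : ℝ → ℝ) (s x₁ τ x₂ e : ℝ) : Prop where
  s_le : s ≤ x₁
  x₁_lt : x₁ < τ
  lt_x₂ : τ < x₂
  x₂_le : x₂ ≤ e
  first : ∀ x ∈ Icc s x₁, 0 < (t x + η) * kap p (W x) (t x)
  Phi_x₁ : Phi η p (ρ x₁) (W x₁) = 0
  Phi_x₂ : Phi η p (ρ x₂) (W x₂) = 0
  middle : ∀ x ∈ Icc x₁ x₂, 0 ≤ Phi η p (ρ x) (W x)
  T_pos : ∀ x ∈ Ico x₁ τ, 0 < bigT η p (ρ x) (W x) (t x)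
  T_zero : bigT η p (ρ τ) (W τ) (t τ) = 0
  T_neg : ∀ x ∈ Ioc τ x₂, bigT η p (ρ x) (W x) (t x) < 0
  last : ∀ x ∈ Icc x₂ e, 0 < (t x + η) * kap p (W x) (t x)
  t_neg : t τ < 0

lemma exists_switch {η p s e : ℝ} {ρ W t : ℝ → ℝ} (hP : Params η p) (hse : s ≤ e)
    (h : ∀ x ∈ Icc s e, CellODE η p ρ W t x) (hφ : ∀ x ∈ Icc s e, 0 ≤ phi p (W x))
    (hs1 : Phi η p (ρ s) (W s) < 0) (hs2 : 0 < t s + η) (hs3 : 0 < kap p (W s) (t s))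
    (he1 : phi p (W e) = 0) (he2 : t e < 0) : ∃ x₁ τ x₂, Switch η p ρ W t s x₁ τ x₂ e := by
  have hp := hP.p_gt
  have hη : 0 < η := by have := hP.η_ge; linarith
  have hηsq : 0 < η ^ 2 := by positivity
  have ce : e ∈ Icc s e := right_mem_Icc.2 hse
  have ct : ContinuousOn (fun x => t x + η) (Icc s e) := fun x hx =>
    ((h x hx).dt.add_const η).continuousAt.continuousWithinAt
  have cΦ : ContinuousOn (fun x => Phi η p (ρ x) (W x)) (Icc s e) := fun x hx =>
    (h x hx).dPhi.continuousAt.continuousWithinAt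
  have cκ : ContinuousOn (fun x => kap p (W x) (t x)) (Icc s e) := fun x hx =>
    (h x hx).dkap.continuousAt.continuousWithinAt
  have cT : ContinuousOn (fun x => bigT η p (ρ x) (W x) (t x)) (Icc s e) := fun x hx =>
    (h x hx).dbigT.continuousAt.continuousWithinAt
  have je : t e + η < 0 := by
    have h1 := (h e ce).pohozaev
    unfold Phi at h1
    rw [he1] at h1
    by_contra h2
    have : (t e + η) ^ 2 ≤ η ^ 2 := by nlinarith
    linarith
  have Φe : Phi η p (ρ e) (W e) < 0 := by unfold Phi; rw [he1]; linarith
  have κe : kap p (W e) (t e) < 0 := by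
    unfold kap
    rw [he1]
    have := (h e ce).W_pos
    have h3 : 0 < (p - 1) * W e / (p + 1) := by
      have : 0 < p - 1 := by linarith
      positivity
    have := mul_neg_of_pos_of_neg h3 he2
    linarith
  obtain ⟨θ, hθ, -, θ1, θ2⟩ := downcross hse cκ hs3 κe
    (fun x hx h0 => (h x hx).kap_deriv_neg hP (hφ x hx) h0)
  obtain ⟨c, hc, c0, c1, c2⟩ := downcross hse ct hs2 je
    (fun x hx _ => ⟨_, (h x hx).dt_neg hP, (h x hx).dt.add_const η⟩)
  have hcI := Ioo_subset_Icc_self hc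
  have Φc : 0 < Phi η p (ρ c) (W c) := by
    have h1 := (h c hcI).pohozaev
    rw [c0] at h1
    linarith
  have Φinc : ∀ a b, s ≤ a → a ≤ b → b ≤ θ → Phi η p (ρ a) (W a) ≤ Phi η p (ρ b) (W b) := by
    intro a b h1 h2 h3
    refine le_of_hasDerivAt_nonneg (g := fun x => Phi η p (ρ x) (W x)) h2
      (cΦ.mono (Icc_subset_Icc h1 (h3.trans hθ.2.le)))
      (fun x hx => (h x ⟨h1.trans hx.1.le, hx.2.le.trans (h3.trans hθ.2.le)⟩).dPhi) fun x hx => ?_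
    exact mul_nonneg (h x ⟨h1.trans hx.1.le, hx.2.le.trans (h3.trans hθ.2.le)⟩).ρ_pos.le
      (θ1 x ⟨h1.trans hx.1.le, hx.2.trans_le h3⟩).le
  have Φdec : ∀ a b, θ ≤ a → a ≤ b → b ≤ e → Phi η p (ρ b) (W b) ≤ Phi η p (ρ a) (W a) := by
    intro a b h1 h2 h3
    have hI : ∀ x ∈ Ioo a b, x ∈ Icc s e := fun x hx =>
      ⟨hθ.1.le.trans (h1.trans hx.1.le), hx.2.le.trans h3⟩
    refine neg_le_neg_iff.1 (le_of_hasDerivAt_nonneg (g := fun x => -Phi η p (ρ x) (W x)) h2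
      (cΦ.mono (Icc_subset_Icc (hθ.1.le.trans h1) h3)).neg
      (fun x hx => (h x (hI x hx)).dPhi.fun_neg) fun x hx => ?_)
    exact neg_nonneg.2 (mul_nonpos_of_nonneg_of_nonpos (h x (hI x hx)).ρ_pos.le
      (θ2 x ⟨h1.trans_lt hx.1, hx.2.le.trans h3⟩).le)
  obtain ⟨x₁, h1, h1z, h1p⟩ := exists_last_nonpos hc.1.le
    (cΦ.mono (Icc_subset_Icc le_rfl hc.2.le)) hs1.le Φc
  obtain ⟨x₂, h2, h2z, h2p⟩ := exists_first_nonpos hc.2.le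
    (cΦ.mono (Icc_subset_Icc hc.1.le le_rfl)) Φc Φe.le
  have h1θ : x₁ < θ := by
    by_contra hh
    have := Φdec x₁ c (not_lt.1 hh) h1.2.le hc.2.le
    linarith
  have h2θ : θ < x₂ := by
    by_contra hh
    have := Φinc c x₂ hc.1.le h2.1.le (not_lt.1 hh)
    linarith
  have I1 : x₁ ∈ Icc s e := ⟨h1.1, h1.2.le.trans hc.2.le⟩
  have I2 : x₂ ∈ Icc s e := ⟨hc.1.le.trans h2.1.le, h2.2⟩
  have hmid : ∀ x ∈ Icc x₁ x₂, 0 ≤ Phi η p (ρ x) (W x) := by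
    intro x hx
    rcases le_total x c with hxc | hxc
    · rcases hx.1.eq_or_lt with rfl | hl
      · exact h1z.ge
      · exact (h1p x ⟨hl, hxc⟩).le
    · rcases hx.2.eq_or_lt with rfl | hl
      · exact h2z.ge
      · exact (h2p x ⟨hxc, hl⟩).le
  have Tx1 : 0 < bigT η p (ρ x₁) (W x₁) (t x₁) := by
    rw [bigT_eq hp, h1z]
    have := mul_pos (h x₁ I1).ρ_pos (θ1 x₁ ⟨h1.1, h1θ⟩)
    linarith
  have Tx2 : bigT η p (ρ x₂) (W x₂) (t x₂) < 0 := by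
    rw [bigT_eq hp, h2z]
    have := mul_neg_of_pos_of_neg (h x₂ I2).ρ_pos (θ2 x₂ ⟨h2θ, h2.2⟩)
    linarith
  have hIm : ∀ x ∈ Icc x₁ x₂, x ∈ Icc s e := fun x hx => ⟨h1.1.trans hx.1, hx.2.trans h2.2⟩
  obtain ⟨τ, hτ, τ0, τ1, τ2⟩ := downcross (h1.2.le.trans h2.1.le)
    (cT.mono (Icc_subset_Icc h1.1 h2.2)) Tx1 Tx2 (fun x hx h0 => by
      obtain ⟨T', hT, hT'⟩ := (h x (hIm x hx)).bigT_deriv_lt hP (hmid x hx) h0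
      exact ⟨T', by nlinarith [sq_nonneg (bigN η (ρ x) (W x))], hT⟩)
  refine ⟨x₁, τ, x₂, ⟨h1.1, hτ.1, hτ.2, h2.2, fun x hx => ?_, h1z, h2z, hmid, τ1, τ0, τ2,
    fun x hx => ?_, ?_⟩⟩
  · exact mul_pos (c1 x ⟨hx.1, hx.2.trans_lt h1.2⟩) (θ1 x ⟨hx.1, hx.2.trans_lt h1θ⟩)
  · exact mul_pos_of_neg_of_neg (c2 x ⟨h2.1.trans_le hx.1, hx.2⟩) (θ2 x ⟨h2θ.trans_le hx.1, hx.2⟩)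
  · by_contra ht
    push Not at ht
    have hτI := hIm τ (Ioo_subset_Icc_self hτ)
    have hΦ := hmid τ (Ioo_subset_Icc_self hτ)
    have hW := (h τ hτI).W_pos
    have hρ := (h τ hτI).ρ_pos
    have hφ' : 0 < phi p (W τ) := by
      unfold Phi at hΦ
      refine pos_of_mul_pos_right (a := ρ τ) (by linarith) hρ.le
    have hk : 0 < kap p (W τ) (t τ) := by
      unfold kap
      have : 0 < p - 1 := by linarith
      positivity
    simp only [bigT_eq hp] at τ0
    have : 0 < ρ τ * kap p (W τ) (t τ) := mul_pos hρ hk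
    have : 0 ≤ 2 * Phi η p (ρ τ) (W τ) * (t τ + η) := by positivity
    linarith

lemma hV_eq_hw {η p ρ W t : ℝ} (hp : 1 < p) (hφ : phi p W = 0) (ht : t ≠ 0) (hj : t + η ≠ 0) :
    hV η p ρ W t = hw η p ρ W t⁻¹ := by
  have hp1 : p + 1 ≠ 0 := by linarith
  have hp2 : p - 1 ≠ 0 := by linarith
  have hW : W = (p + 1) / 2 := by
    unfold phi at hφ
    field_simp at hφ
    linarith
  have h1 : 1 + η * t⁻¹ = (t + η) / t := by field_simp
  unfold hV hw kap bigG bigN Phi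
  rw [hφ, h1, hW]
  field_simp
  ring

lemma hV_eq_hII {η p ρ W t : ℝ} (hp : 1 < p) (hρ : 0 < ρ) (hΦ : Phi η p ρ W = 0)
    (hκ : kap p W t ≠ 0) : hV η p ρ W t = hII η p ρ W t := by
  have hp1 : p + 1 ≠ 0 := by linarith
  have hN : bigN η ρ W = ρ * ((p - 1) * W / (p + 1)) := by
    unfold Phi phi at hΦ
    unfold bigN
    field_simp at hΦ ⊢
    linarith
  have hρ' := hρ.ne'
  unfold hV hII
  rw [bigT_eq hp, hΦ, hN]
  field_simp
  ring

namespace LogFlow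
variable {η p : ℝ} {u D y y' : ℝ → ℝ} {a b s e : ℝ}

lemma hV_barrier (h : LogFlow η p u D y y') (hP : Params η p) (hab : a ≤ b)
    (hu : ∀ x ∈ Icc a b, 0 < u x) (hφ : ∀ x ∈ Icc a b, 0 ≤ phi p (|u x| ^ (p - 1)))
    (hκ : ∀ x ∈ Icc a b, 0 < (D x / u x + η) * kap p (|u x| ^ (p - 1)) (D x / u x))
    (ha : 0 ≤ y a) (hq : 0 ≤ y' a - hV η p (exp (2 * a)) (|u a| ^ (p - 1)) (D a / u a) * y a) :
    (0 < y a → (∀ x ∈ Icc a b, 0 < y x) ∧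
      0 ≤ y' b - hV η p (exp (2 * b)) (|u b| ^ (p - 1)) (D b / u b) * y b) ∧
    (0 < y' a - hV η p (exp (2 * a)) (|u a| ^ (p - 1)) (D a / u a) * y a →
      (∀ x ∈ Ioc a b, 0 < y x) ∧
      0 < y' b - hV η p (exp (2 * b)) (|u b| ^ (p - 1)) (D b / u b) * y b) := by
  have hr : ∀ x ∈ Icc a b, _ := fun x hx => (h.cell (hu x hx)).hV_riccati hP (hφ x hx) (hκ x hx)
  have hc : ContinuousOn (fun x => hV η p (exp (2 * x)) (|u x| ^ (p - 1)) (D x / u x))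
      (Icc a b) := fun x hx => by
    obtain ⟨_, h1, -⟩ := hr x hx
    exact h1.continuousAt.continuousWithinAt
  refine ⟨fun h0 => ?_, fun h0 => ?_⟩
  · obtain ⟨h1, h2, -⟩ := barrier_pos hab (fun x _ => h.y_deriv x) (fun x _ => h.y'_deriv x) hc
      (fun x hx => hr x (Ioo_subset_Icc_self hx)) h0 hq
    exact ⟨h1, h2⟩
  · exact barrier_pos_of_nonneg hab (fun x _ => h.y_deriv x) (fun x _ => h.y'_deriv x) hc
      (fun x hx => hr x (Ioo_subset_Icc_self hx)) ha h0

lemma hII_barrier (h : LogFlow η p u D y y') (hP : Params η p) (hab : a ≤ b)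
    (hu : ∀ x ∈ Icc a b, 0 < u x)
    (hΦ : ∀ x ∈ Icc a b, 0 ≤ Phi η p (exp (2 * x)) (|u x| ^ (p - 1)))
    (hT : ∀ x ∈ Icc a b, bigT η p (exp (2 * x)) (|u x| ^ (p - 1)) (D x / u x) ≠ 0)
    (ha : 0 ≤ y a) (hq : 0 ≤ y' a - hII η p (exp (2 * a)) (|u a| ^ (p - 1)) (D a / u a) * y a) :
    (0 < y a → (∀ x ∈ Icc a b, 0 < y x) ∧
      0 ≤ y' b - hII η p (exp (2 * b)) (|u b| ^ (p - 1)) (D b / u b) * y b) ∧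
    (0 < y' a - hII η p (exp (2 * a)) (|u a| ^ (p - 1)) (D a / u a) * y a →
      (∀ x ∈ Ioc a b, 0 < y x) ∧
      0 < y' b - hII η p (exp (2 * b)) (|u b| ^ (p - 1)) (D b / u b) * y b) := by
  have hr : ∀ x ∈ Icc a b, _ := fun x hx => (h.cell (hu x hx)).hII_riccati hP (hΦ x hx) (hT x hx)
  have hc : ContinuousOn (fun x => hII η p (exp (2 * x)) (|u x| ^ (p - 1)) (D x / u x))
      (Icc a b) := fun x hx => by
    obtain ⟨_, h1, -⟩ := hr x hx
    exact h1.continuousAt.continuousWithinAt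
  refine ⟨fun h0 => ?_, fun h0 => ?_⟩
  · obtain ⟨h1, h2, -⟩ := barrier_pos hab (fun x _ => h.y_deriv x) (fun x _ => h.y'_deriv x) hc
      (fun x hx => hr x (Ioo_subset_Icc_self hx)) h0 hq
    exact ⟨h1, h2⟩
  · exact barrier_pos_of_nonneg hab (fun x _ => h.y_deriv x) (fun x _ => h.y'_deriv x) hc
      (fun x hx => hr x (Ioo_subset_Icc_self hx)) ha h0

/-- The variation stays positive up to the switching point. -/
lemma pos_before_switch (h : LogFlow η p u D y y') (hP : Params η p) {x₁ τ x₂ : ℝ}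
    (hS : Switch η p (fun x => exp (2 * x)) (fun x => |u x| ^ (p - 1)) (fun x => D x / u x)
      s x₁ τ x₂ e) (hu : ∀ x ∈ Icc s e, 0 < u x)
    (hφ : ∀ x ∈ Icc s e, 0 ≤ phi p (|u x| ^ (p - 1))) (hy : 0 < y s)
    (hq : 0 ≤ y' s - hV η p (exp (2 * s)) (|u s| ^ (p - 1)) (D s / u s) * y s)
    (hX : wronsk η u D y y' s < 0) : ∀ x ∈ Icc s τ, 0 < y x := by
  obtain ⟨h1, h2, h3, h4, hκ, e1, -, hΦ, T1, T0, -, -, -⟩ := hS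
  have hp := hP.p_gt
  obtain ⟨p1, q1⟩ := (h.hV_barrier hP h1 (fun x hx => hu x ⟨hx.1, by linarith [hx.2]⟩)
    (fun x hx => hφ x ⟨hx.1, by linarith [hx.2]⟩) hκ hy.le hq).1 hy
  rw [hV_eq_hII hp (exp_pos _) e1 (right_ne_zero_of_mul (hκ x₁ (right_mem_Icc.2 h1)).ne')] at q1
  have hbar : ∀ x ∈ Ico x₁ τ, (∀ z ∈ Icc x₁ x, 0 < y z) ∧
      0 ≤ y' x - hII η p (exp (2 * x)) (|u x| ^ (p - 1)) (D x / u x) * y x := by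
    intro x hx
    have hy1 := p1 x₁ (right_mem_Icc.2 h1)
    exact (h.hII_barrier hP hx.1 (fun z hz => hu z ⟨by linarith [hz.1], by linarith [hz.2, hx.2]⟩)
      (fun z hz => hΦ z ⟨hz.1, by linarith [hz.2, hx.2]⟩)
      (fun z hz => (T1 z ⟨hz.1, by linarith [hz.2, hx.2]⟩).ne') hy1.le q1).1 hy1
  have hlt : ∀ x ∈ Ico s τ, 0 < y x := by
    intro x hx
    rcases le_total x x₁ with hx1 | hx1
    · exact p1 x ⟨hx.1, hx1⟩
    · exact (hbar x ⟨hx1, hx.2⟩).1 x (right_mem_Icc.2 hx1)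
  suffices hτ : 0 < y τ by
    intro x hx
    rcases hx.2.eq_or_lt with rfl | hl
    · exact hτ
    · exact hlt x ⟨hx.1, hl⟩
  have hsτ : s < τ := by linarith
  have hτI : τ ∈ Icc s e := ⟨hsτ.le, by linarith⟩
  have hge : 0 ≤ y τ := ge_of_tendsto (h.y_cont.continuousAt.tendsto.mono_left nhdsWithin_le_nhds)
    (by filter_upwards [Ioo_mem_nhdsLT hsτ] with x hx using (hlt x ⟨hx.1.le, hx.2⟩).le)
  refine hge.lt_of_ne fun h0 => ?_
  have hXτ := (h.wronsk_lt hP hsτ (fun x hx => hu x ⟨hx.1.le, hx.2.le.trans hτI.2⟩)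
    (fun x hx => hlt x ⟨hx.1.le, hx.2⟩)).trans hX
  have hy' := y'_neg_of_wronsk (hu τ hτI) h0.symm hXτ
  have hc := h.cell (hu τ hτI)
  obtain ⟨T', hT, hT'⟩ := hc.bigT_deriv_lt hP (hΦ τ ⟨h2.le, h3.le⟩) T0
  have hd := (hT.fun_mul (h.y'_deriv τ)).fun_add (((hc.dbigN (η := η)).fun_pow 2).fun_mul (h.y_deriv τ))
  have e0 : y τ = 0 := h0.symm
  obtain ⟨δ, hδ, hh⟩ := eventually_left_of_deriv_pos hd (by
    rw [T0, e0]
    have := mul_pos_of_neg_of_neg hT' hy'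
    linarith)
  have hm : max x₁ (τ - δ) < τ := max_lt h2 (by linarith)
  obtain ⟨x, hx1, hx2⟩ := exists_between hm
  have hlt' := hh x ⟨(le_max_right _ _).trans_lt hx1, hx2⟩
  have hxI : x ∈ Ico x₁ τ := ⟨((le_max_left _ _).trans_lt hx1).le, hx2⟩
  have hq' := (hbar x hxI).2
  have hTx := T1 x hxI
  rw [e0, T0] at hlt'
  have hTx : 0 < bigT η p (exp (2 * x)) (|u x| ^ (p - 1)) (D x / u x) := T1 x hxI
  have h5 := mul_nonneg hTx.le hq'
  have h6 : ∀ T N y y' : ℝ, T ≠ 0 → T * (y' - -N ^ 2 / T * y) = T * y' + N ^ 2 * y := by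
    intro T N y y' hT
    field_simp
    ring
  unfold hII at h5
  rw [h6 _ _ _ _ hTx.ne'] at h5
  linarith

/-- After a zero past the switching point the variation keeps its sign. -/
lemma neg_after_switch (h : LogFlow η p u D y y') (hP : Params η p) {x₁ τ' x₂ τ : ℝ}
    (hS : Switch η p (fun x => exp (2 * x)) (fun x => |u x| ^ (p - 1)) (fun x => D x / u x)
      s x₁ τ' x₂ e) (hu : ∀ x ∈ Ico s b, 0 < u x) (heb : e < b)
    (hφ : ∀ x ∈ Icc s e, 0 ≤ phi p (|u x| ^ (p - 1)))
    (hφ' : ∀ x ∈ Icc e b, phi p (|u x| ^ (p - 1)) ≤ 0)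
    (hτ : τ' < τ) (hτb : τ < b) (hy : y τ = 0) (hy' : y' τ < 0) :
    (∀ x ∈ Ioc τ b, y x < 0) ∧
      y' b - hw η p (exp (2 * b)) (|u b| ^ (p - 1)) (u b / D b) * y b < 0 := by
  obtain ⟨h1, h2, h3, h4, -, -, e2, hΦ, -, -, T2, hκ, -⟩ := hS
  have hp := hP.p_gt
  have hz := h.neg_y
  have hse : s ≤ e := by linarith
  have huI : ∀ x ∈ Icc s e, 0 < u x := fun x hx => hu x ⟨hx.1, hx.2.trans_lt heb⟩
  have key : ∃ σ, τ ≤ σ ∧ e ≤ σ ∧ σ < b ∧ (∀ x ∈ Ioc τ σ, 0 < -y x) ∧ 0 ≤ -y σ ∧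
      0 < -y' σ - hw η p (exp (2 * σ)) (|u σ| ^ (p - 1)) (u σ / D σ) * -y σ := by
    rcases le_or_gt e τ with hle | hlt
    · refine ⟨τ, le_rfl, hle, hτb, fun x hx => absurd hx.1 (not_lt.2 hx.2), by simp [hy], ?_⟩
      simpa [hy] using hy'
    have main : ∀ σ, τ ≤ σ → x₂ ≤ σ → σ ≤ e → 0 ≤ -y σ →
        0 < -y' σ - hV η p (exp (2 * σ)) (|u σ| ^ (p - 1)) (D σ / u σ) * -y σ →
        (∀ x ∈ Ioc τ σ, 0 < -y x) → (∀ x ∈ Ioc τ e, 0 < -y x) ∧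
        0 < -y' e - hV η p (exp (2 * e)) (|u e| ^ (p - 1)) (D e / u e) * -y e := by
      intro σ s1 s2 s3 s4 s5 s6
      obtain ⟨r1, r2⟩ := (hz.hV_barrier hP s3 (fun x hx => huI x ⟨by linarith [hx.1], hx.2⟩)
        (fun x hx => hφ x ⟨by linarith [hx.1], hx.2⟩)
        (fun x hx => hκ x ⟨s2.trans hx.1, hx.2⟩) s4 s5.le).2 s5
      refine ⟨fun x hx => ?_, r2⟩
      rcases le_or_gt x σ with hh | hh
      · exact s6 x ⟨hx.1, hh⟩
      · exact r1 x ⟨hh, hx.2⟩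
    have hend : (∀ x ∈ Ioc τ e, 0 < -y x) ∧
        0 < -y' e - hV η p (exp (2 * e)) (|u e| ^ (p - 1)) (D e / u e) * -y e := by
      rcases le_or_gt x₂ τ with hle | hlt2
      · exact main τ le_rfl hle hlt.le (by simp [hy]) (by simpa [hy] using hy')
          fun x hx => absurd hx.1 (not_lt.2 hx.2)
      · obtain ⟨r1, r2⟩ := (hz.hII_barrier hP hlt2.le
          (fun x hx => huI x ⟨by linarith [hx.1], hx.2.trans h4⟩)
          (fun x hx => hΦ x ⟨by linarith [hx.1], hx.2⟩)
          (fun x hx => (T2 x ⟨by linarith [hx.1], hx.2⟩).ne) (by simp [hy])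
          (by simpa [hy] using hy'.le)).2 (by simpa [hy] using hy')
        rw [← hV_eq_hII hp (exp_pos _) e2
          (right_ne_zero_of_mul (hκ x₂ (left_mem_Icc.2 h4)).ne')] at r2
        exact main x₂ hlt2.le le_rfl h4 (r1 x₂ (right_mem_Ioc.2 hlt2)).le r2 r1
    obtain ⟨r1, r2⟩ := hend
    have hφe : phi p (|u e| ^ (p - 1)) = 0 :=
      le_antisymm (hφ' e (left_mem_Icc.2 heb.le)) (hφ e (right_mem_Icc.2 hse))
    rw [hV_eq_hw hp hφe (div_ne_zero (h.D_ne hφe.le) (huI e (right_mem_Icc.2 hse)).ne')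
      (left_ne_zero_of_mul (hκ e (right_mem_Icc.2 h4)).ne'), inv_div] at r2
    exact ⟨e, hlt.le, le_rfl, heb, r1, (r1 e (right_mem_Ioc.2 hlt)).le, r2⟩
  obtain ⟨σ, s1, s2, s3, s4, s5, s6⟩ := key
  obtain ⟨r1, r2⟩ := hz.hw_barrier_zero hP s3.le (fun x hx => hu x ⟨by linarith [hx.1], hx.2⟩)
    (fun x hx => hφ' x ⟨s2.trans hx.1, hx.2⟩) s5 s6
  refine ⟨fun x hx => ?_, by linarith⟩
  rcases le_or_gt x σ with hh | hh
  · exact neg_pos.1 (s4 x ⟨hx.1, hh⟩)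
  · exact neg_pos.1 (r1 x ⟨hh, hx.2⟩)

end LogFlow

/-- The state of the flow at a point from which a nodal cell can be traversed. -/
structure CellEntry (η p : ℝ) (u D y y' : ℝ → ℝ) (s c : ℝ) : Prop where
  s_le : s ≤ c
  phi_nonneg : ∀ x ∈ Icc s c, 0 ≤ phi p (|u x| ^ (p - 1))
  phi_pos : 0 < phi p (|u c| ^ (p - 1))
  Phi_neg : Phi η p (exp (2 * s)) (|u s| ^ (p - 1)) < 0
  j_pos : 0 < D s / u s + η
  kap_pos : 0 < kap p (|u s| ^ (p - 1)) (D s / u s)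
  y_pos : 0 < y s
  q_nonneg : 0 ≤ y' s - hV η p (exp (2 * s)) (|u s| ^ (p - 1)) (D s / u s) * y s
  wronsk_neg : wronsk η u D y y' s < 0

namespace LogFlow
variable {η p : ℝ} {u D y y' : ℝ → ℝ} {a b c m s τ : ℝ}

lemma quot_lt (h : LogFlow η p u D y y') (hP : Params η p) (hab : a < b)
    (hu : ∀ x ∈ Icc a b, 0 < u x) : D b / u b < D a / u a := by
  have := lt_of_hasDerivAt_pos hab (g := fun x => -(D x / u x))
    (fun x hx => (h.cell (hu x hx)).dt.fun_neg.continuousAt.continuousWithinAt)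
    (fun x hx => (h.cell (hu x (Ioo_subset_Icc_self hx))).dt.fun_neg)
    (fun x hx => neg_pos.2 ((h.cell (hu x (Ioo_subset_Icc_self hx))).dt_neg hP))
  exact neg_lt_neg_iff.1 this

lemma D_pos_of_critical (h : LogFlow η p u D y y') (hP : Params η p) (hab : a < b)
    (hu : ∀ x ∈ Icc a b, 0 < u x) (hD : D b = 0) : 0 < D a := by
  have := h.quot_lt hP hab hu
  rw [hD, zero_div] at this
  exact (div_pos_iff_of_pos_right (hu a (left_mem_Icc.2 hab.le))).1 this

lemma D_neg_of_critical (h : LogFlow η p u D y y') (hP : Params η p) (hab : a < b)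
    (hu : ∀ x ∈ Icc a b, 0 < u x) (hD : D a = 0) : D b < 0 := by
  have := h.quot_lt hP hab hu
  rw [hD, zero_div] at this
  exact neg_of_div_neg_left this (hu b (right_mem_Icc.2 hab.le)).le

lemma dphi_flow (h : LogFlow η p u D y y') {x : ℝ} (hu : 0 < u x) :
    HasDerivAt (fun x => phi p (|u x| ^ (p - 1)))
      ((p - 1) * |u x| ^ (p - 1) * (D x / u x) / (p + 1)) x := (h.cell hu).dphi

lemma traverse (h : LogFlow η p u D y y') (hP : Params η p) (hE : CellEntry η p u D y y' s c)
    (hcm : c < m) (hu : ∀ x ∈ Ico s m, 0 < u x) (hD : ∀ x ∈ Ioo c m, D x < 0)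
    (hφm : phi p (|u m| ^ (p - 1)) < 0) (hτ : τ ∈ Ioo s m) (hy : y τ = 0)
    (hyp : ∀ x ∈ Ico s τ, 0 < y x) :
    (∀ x ∈ Ioc τ m, y x < 0) ∧
      y' m - hw η p (exp (2 * m)) (|u m| ^ (p - 1)) (u m / D m) * y m < 0 ∧
      ∃ τ' ∈ Ico s τ, D τ' < 0 := by
  have hp := hP.p_gt
  obtain ⟨hsc, f1, f2, g1, g2, g3, g4, g5, g6⟩ := hE
  obtain ⟨e, he, he0, he1, he2⟩ := downcross hcm.le (h.φ_cont hp).continuousOn f2 hφm (by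
    intro x hx h0
    have hxc : x ≠ c := by rintro rfl; exact f2.ne' h0
    have hxm : x ≠ m := by rintro rfl; exact hφm.ne h0
    have hx1 : c < x := lt_of_le_of_ne hx.1 hxc.symm
    have hx2 : x < m := lt_of_le_of_ne hx.2 hxm
    have hux := hu x ⟨hsc.trans hx.1, hx2⟩
    refine ⟨_, ?_, h.dphi_flow hux⟩
    have h3 : 0 < p - 1 := by linarith
    have h4 : 0 < |u x| ^ (p - 1) := rpow_pos_of_pos (abs_pos.2 hux.ne') _
    have h5 := div_neg_of_neg_of_pos (hD x ⟨hx1, hx2⟩) hux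
    exact div_neg_of_neg_of_pos (mul_neg_of_pos_of_neg (by positivity) h5) (by linarith))
  have hse : s ≤ e := hsc.trans he.1.le
  have huI : ∀ x ∈ Icc s e, 0 < u x := fun x hx => hu x ⟨hx.1, hx.2.trans_lt he.2⟩
  have hφI : ∀ x ∈ Icc s e, 0 ≤ phi p (|u x| ^ (p - 1)) := by
    intro x hx
    rcases le_or_gt x c with hh | hh
    · exact f1 x ⟨hx.1, hh⟩
    · rcases hx.2.eq_or_lt with rfl | hl
      · exact he0.ge
      · exact (he1 x ⟨hh.le, hl⟩).le
  have hDe : D e / u e < 0 :=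
    div_neg_of_neg_of_pos (hD e he) (huI e (right_mem_Icc.2 hse))
  obtain ⟨x₁, τ', x₂, hS⟩ := exists_switch hP hse (fun x hx => h.cell (huI x hx)) hφI g1 g2 g3 he0
    hDe
  have hpos := h.pos_before_switch hP hS huI hφI g4 g5 g6
  have hsτ' : s ≤ τ' := hS.s_le.trans hS.x₁_lt.le
  have hτ' : τ' < τ := by
    by_contra hh
    have := hpos τ ⟨hτ.1.le, not_lt.1 hh⟩
    linarith
  have hXτ := (h.wronsk_lt hP hτ.1 (fun x hx => hu x ⟨hx.1.le, hx.2.trans hτ.2⟩)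
    (fun x hx => hyp x ⟨hx.1.le, hx.2⟩)).trans g6
  have hy' := y'_neg_of_wronsk (hu τ ⟨hτ.1.le, hτ.2⟩) hy hXτ
  obtain ⟨r1, r2⟩ := h.neg_after_switch hP hS hu he.2 hφI
    (fun x hx => by
      rcases hx.1.eq_or_lt with rfl | hl
      · exact he0.le
      · exact (he2 x ⟨hl, hx.2⟩).le) hτ' hτ.2 hy hy'
  refine ⟨r1, r2, τ', ⟨hsτ', hτ'⟩, ?_⟩
  exact neg_of_div_neg_left hS.t_neg (hu τ' ⟨hsτ', hτ'.trans hτ.2⟩).le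

lemma phi_zero (hp : 1 < p) {x : ℝ} (hu : u x = 0) : phi p (|u x| ^ (p - 1)) < 0 := by
  rw [hu, abs_zero, zero_rpow (by linarith)]
  norm_num [phi]

lemma hw_zero {ρ W D : ℝ} : hw η p ρ W (0 / D) = 0 := by simp [hw]

lemma D_neg_of_zero (h : LogFlow η p u D y y') (hab : a < b) (hu : ∀ x ∈ Ico a b, 0 < u x)
    (hb : u b = 0) : D b < 0 := by
  refine lt_of_le_of_ne (not_lt.1 fun h0 => ?_) (h.D_ne_of_zero hb)
  obtain ⟨δ, hδ, hh⟩ := eventually_left_of_deriv_pos (h.u_deriv b) h0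
  obtain ⟨x, h1, h2⟩ := exists_between (max_lt hab (by linarith : b - δ < b))
  have := hh x ⟨(le_max_right _ _).trans_lt h1, h2⟩
  have := hu x ⟨(le_max_left _ _).trans h1.le, h2⟩
  linarith

lemma exit_zero (h : LogFlow η p u D y y') (hP : Params η p) (hE : CellEntry η p u D y y' s c)
    (hcm : c < m) (hu : ∀ x ∈ Ico s m, 0 < u x) (hD : ∀ x ∈ Ioo c m, D x < 0) (hm : u m = 0) :
    D m < 0 ∧ y m < 0 ∧ y' m < 0 := by
  have hsm := hE.s_le.trans_lt hcm
  have hDm := h.D_neg_of_zero hsm hu hm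
  have hex : ∃ x ∈ Icc s m, y x ≤ 0 := by
    by_contra hcon
    push Not at hcon
    have h1 := (h.wronsk_lt hP hsm (fun x hx => hu x ⟨hx.1.le, hx.2⟩)
      (fun x hx => hcon x (Ioo_subset_Icc_self hx))).trans hE.wronsk_neg
    unfold wronsk at h1
    rw [hm] at h1
    have h2 := hcon m (right_mem_Icc.2 hsm.le)
    have h3 := neg_of_mul_neg_right h1 (exp_pos _).le
    have := mul_neg_of_pos_of_neg h2 hDm
    linarith
  obtain ⟨x, hx, hyx⟩ := hex
  obtain ⟨τ, hτ, h0, hpos⟩ := exists_first_nonpos hx.1 h.y_cont.continuousOn hE.y_pos hyx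
  have hτm : τ < m := by
    refine lt_of_le_of_ne (hτ.2.trans hx.2) ?_
    rintro rfl
    have h1 := (h.wronsk_lt hP hsm (fun x hx => hu x ⟨hx.1.le, hx.2⟩)
      (fun x hx => hpos x ⟨hx.1.le, hx.2⟩)).trans hE.wronsk_neg
    unfold wronsk at h1
    rw [hm, h0] at h1
    simp at h1
  obtain ⟨r1, r2, -⟩ := h.traverse hP hE hcm hu hD (phi_zero hP.p_gt hm) ⟨hτ.1, hτm⟩ h0 hpos
  rw [hm, hw_zero, zero_mul, sub_zero] at r2
  exact ⟨hDm, r1 m (right_mem_Ioc.2 hτm), r2⟩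

lemma entry_of_zero (h : LogFlow η p u D y y') (hP : Params η p) (hac : a < c) (ha : u a = 0)
    (hu : ∀ x ∈ Ioc a c, 0 < u x) (hDc : D c = 0) (hDa : 0 < D a) (hy : 0 < y a) (hy' : 0 ≤ y' a) :
    ∃ s ∈ Ioo a c, CellEntry η p u D y y' s c ∧ ∀ x ∈ Icc a s, 0 < y x := by
  have hp := hP.p_gt
  have hη := hP.η_ge
  have φa := phi_zero hp ha
  have φc : 0 < phi p (|u c| ^ (p - 1)) := by
    by_contra hh
    exact h.D_ne (not_lt.1 hh) hDc
  have hDp : ∀ x ∈ Ioo a c, 0 < D x := fun x hx =>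
    h.D_pos_of_critical hP hx.2 (fun z hz => hu z ⟨hx.1.trans_le hz.1, hz.2⟩) hDc
  obtain ⟨s, hs, hs0, hs1⟩ := exists_last_nonpos hac.le (h.φ_cont hp).continuousOn φa.le φc
  have has : a < s := lt_of_le_of_ne hs.1 (by rintro rfl; exact φa.ne hs0)
  have hus := hu s ⟨has, hs.2.le⟩
  have hφle : ∀ x ∈ Icc a s, phi p (|u x| ^ (p - 1)) ≤ 0 := by
    intro x hx
    rw [← hs0]
    refine le_of_hasDerivAt_nonneg (g := fun x => phi p (|u x| ^ (p - 1))) hx.2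
      (h.φ_cont hp).continuousOn
      (fun z hz => h.dphi_flow (hu z ⟨hx.1.trans_lt hz.1, (hz.2.trans hs.2).le⟩)) fun z hz => ?_
    have h1 := hu z ⟨hx.1.trans_lt hz.1, (hz.2.trans hs.2).le⟩
    have h2 := hDp z ⟨hx.1.trans_lt hz.1, hz.2.trans hs.2⟩
    have h3 : 0 < p - 1 := by linarith
    positivity
  have ht : 0 < D s / u s := div_pos (hDp s ⟨has, hs.2⟩) hus
  obtain ⟨r1, r2, -⟩ := h.hw_barrier hP has.le (fun x hx => hu x ⟨hx.1, (hx.2.trans hs.2).le⟩) hφle hy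
    (by rwa [ha, hw_zero, zero_mul, sub_zero])
  refine ⟨s, ⟨has, hs.2⟩, ⟨hs.2.le, fun x hx => ?_, φc, ?_, by linarith, ?_, r1 s (right_mem_Icc.2 has.le),
    ?_, ?_⟩, r1⟩
  · rcases hx.1.eq_or_lt with rfl | hl
    · exact hs0.ge
    · exact (hs1 x ⟨hl, hx.2⟩).le
  · unfold Phi
    rw [hs0]
    have : 0 < η ^ 2 := by positivity
    linarith
  · unfold kap
    rw [hs0]
    have h3 : 0 < p - 1 := by linarith
    have h4 : 0 < |u s| ^ (p - 1) := rpow_pos_of_pos (abs_pos.2 hus.ne') _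
    have : 0 < (p - 1) * |u s| ^ (p - 1) / (p + 1) * (D s / u s) := by positivity
    linarith
  · rwa [hV_eq_hw hp hs0 ht.ne' (by linarith), inv_div]
  · refine (h.wronsk_lt hP has (fun x hx => hu x ⟨hx.1, (hx.2.trans hs.2).le⟩)
      (fun x hx => r1 x (Ioo_subset_Icc_self hx))).trans ?_
    unfold wronsk
    rw [ha]
    have : 0 < exp (η * a) * (y a * D a) := by positivity
    linarith

/-- Propagation of signs from one zero of `u` to the next. -/
lemma zero_to_zero (h : LogFlow η p u D y y') (hP : Params η p) (hab : a < b) (ha : u a = 0)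
    (hb : u b = 0) (hu : ∀ x ∈ Ioo a b, 0 < u x) (hDa : 0 < D a) (hy : 0 < y a) (hy' : 0 ≤ y' a) :
    D b < 0 ∧ y b < 0 ∧ y' b < 0 := by
  obtain ⟨c, hc, hDc⟩ := exists_hasDerivAt_eq_zero hab h.u_cont.continuousOn (ha.trans hb.symm)
    fun x _ => h.u_deriv x
  obtain ⟨s, hs, hE, -⟩ := h.entry_of_zero hP hc.1 ha (fun x hx => hu x ⟨hx.1, hx.2.trans_lt hc.2⟩)
    hDc hDa hy hy'
  exact h.exit_zero hP hE hc.2 (fun x hx => hu x ⟨hs.1.trans_le hx.1, hx.2⟩)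
    (fun x hx => h.D_neg_of_critical hP hx.1
      (fun z hz => hu z ⟨hc.1.trans_le hz.1, hz.2.trans_lt hx.2⟩) hDc) hb

end LogFlow

namespace LogFlow
variable {η p : ℝ} {u D y y' : ℝ → ℝ} {α b : ℝ}

lemma hV_limit {w : ℝ} (hp : 1 < p) (hη : η ≠ 0) (hφ : phi p w ≠ 0) :
    -(2 * Phi η p 0 w * bigG η p w / (0 + η) + bigN η 0 w * ((p - 1) * w / (p + 1))) / kap p w 0
      = η := by
  have hp1 : p + 1 ≠ 0 := by linarith
  have hW : (p - 1) * w / (p + 1) = w - 1 - 2 * phi p w := by unfold phi; field_simp; ring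
  have hk : kap p w 0 = 2 * phi p w := by unfold kap; ring
  rw [hk]
  unfold Phi bigG bigN
  rw [hW, zero_add]
  field_simp
  ring

/-- Signs at the first zero of `u`. -/
lemma origin_to_zero (h : LogFlow η p u D y y') (hP : Params η p) (hα : 0 < α)
    (hu : ∀ x < b, 0 < u x) (hb : u b = 0) (hφα : 0 < phi p (α ^ (p - 1)))
    (lu : Tendsto u atBot (nhds α)) (lD : Tendsto D atBot (nhds 0))
    (ly : Tendsto y atBot (nhds 0)) (ly' : Tendsto y' atBot (nhds 0))
    (hy : ∀ᶠ x in atBot, 0 < y x) : D b < 0 ∧ y b < 0 ∧ y' b < 0 := by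
  have hp := hP.p_gt
  have hη : 0 < η := by have := hP.η_ge; linarith
  have lt : Tendsto (fun x => D x / u x) atBot (nhds 0) := by
    have := lD.div lu hα.ne'
    rwa [zero_div] at this
  have lW : Tendsto (fun x => |u x| ^ (p - 1)) atBot (nhds (α ^ (p - 1))) := by
    have := (lu.abs).rpow_const (p := p - 1) (Or.inr (by linarith))
    rwa [abs_of_pos hα] at this
  set w := α ^ (p - 1) with hw
  have lρ : Tendsto (fun x : ℝ => exp (2 * x)) atBot (nhds 0) :=
    tendsto_exp_atBot.comp (tendsto_id.const_mul_atBot (by norm_num : (0 : ℝ) < 2))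
  have le : Tendsto (fun x : ℝ => exp (η * x)) atBot (nhds 0) :=
    tendsto_exp_atBot.comp (tendsto_id.const_mul_atBot hη)
  have lφ : Tendsto (fun x => phi p (|u x| ^ (p - 1))) atBot (nhds (phi p w)) :=
    (lW.div_const _).sub_const _
  have lΦ : Tendsto (fun x => Phi η p (exp (2 * x)) (|u x| ^ (p - 1))) atBot
      (nhds (Phi η p 0 w)) := (lρ.mul lφ).sub_const _
  have lN : Tendsto (fun x => bigN η (exp (2 * x)) (|u x| ^ (p - 1))) atBot
      (nhds (bigN η 0 w)) := (lρ.mul (lW.sub_const 1)).sub_const _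
  have lG : Tendsto (fun x => bigG η p (|u x| ^ (p - 1))) atBot (nhds (bigG η p w)) :=
    (lφ.const_mul _).sub ((lW.sub_const 1).const_mul _)
  have lκ : Tendsto (fun x => kap p (|u x| ^ (p - 1)) (D x / u x)) atBot (nhds (kap p w 0)) :=
    (lφ.const_mul 2).add (((lW.const_mul (p - 1)).div_const _).mul lt)
  have lj : Tendsto (fun x => D x / u x + η) atBot (nhds (0 + η)) := lt.add_const η
  have hκ0 : kap p w 0 = 2 * phi p w := by unfold kap; ring
  have lV : Tendsto (fun x => hV η p (exp (2 * x)) (|u x| ^ (p - 1)) (D x / u x)) atBot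
      (nhds η) := by
    have := ((((lΦ.const_mul 2).mul lG).div lj (by simpa using hη.ne')).add
      (lN.mul ((lW.const_mul (p - 1)).div_const (p + 1)))).neg.div lκ (by rw [hκ0]; positivity)
    rw [hV_limit hp hη.ne' hφα.ne'] at this
    exact this
  have lX : Tendsto (wronsk η u D y y') atBot (nhds 0) := by
    have := le.mul ((ly'.mul lu).sub (ly.mul (lD.add (lu.const_mul η))))
    simp only [zero_mul, sub_zero, zero_add, mul_zero] at this
    exact this
  have htneg : ∀ x < b, D x / u x < 0 := by
    have hle : ∀ x < b, D x / u x ≤ 0 := fun x hx => ge_of_tendsto lt (by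
      filter_upwards [eventually_lt_atBot x] with z hz
      exact (h.quot_lt hP hz fun q hq => hu q (hq.2.trans_lt hx)).le)
    exact fun x hx => (h.quot_lt hP (sub_one_lt x) fun q hq => hu q (hq.2.trans_lt hx)).trans_le
      (hle (x - 1) ((sub_one_lt x).trans hx))
  have hDneg : ∀ x < b, D x < 0 := fun x hx => neg_of_div_neg_left (htneg x hx) (hu x hx).le
  have hΦ0 : Phi η p 0 w < 0 := by
    unfold Phi
    have : 0 < η ^ 2 := by positivity
    linarith
  obtain ⟨s, hs⟩ := eventually_atBot.1 (((((((eventually_lt_atBot b).and hy).and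
    (lφ.eventually (lt_mem_nhds hφα))).and (lΦ.eventually (gt_mem_nhds hΦ0))).and
    (lj.eventually (lt_mem_nhds (by simpa using hη)))).and
    (lκ.eventually (lt_mem_nhds (by rw [hκ0]; positivity)))).and
    (lV.eventually (lt_mem_nhds hη)))
  obtain ⟨⟨⟨⟨⟨⟨hsb, hys⟩, hφs⟩, hΦs⟩, hjs⟩, hκs⟩, -⟩ := hs s le_rfl
  have hXle : ∀ x ≤ s, wronsk η u D y y' x ≤ 0 := fun x hx => ge_of_tendsto lX (by
      filter_upwards [eventually_lt_atBot x] with z hz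
      exact (h.wronsk_lt hP hz (fun q hq => hu q (by linarith [hq.2]))
        (fun q hq => (hs q (by linarith [hq.2])).1.1.1.1.1.2)).le)
  have hE : CellEntry η p u D y y' s s := by
    refine ⟨le_rfl, fun x hx => ?_, hφs, hΦs, hjs, hκs, hys, ?_, ?_⟩
    · rw [Icc_self, mem_singleton_iff] at hx
      rw [hx]; exact hφs.le
    · refine barrier_nonneg_of_tendsto (y := y) (y' := y')
        (h := fun x => hV η p (exp (2 * x)) (|u x| ^ (p - 1)) (D x / u x))
        (fun x _ => h.y_deriv x) (fun x _ => h.y'_deriv x) (fun x hx => ?_)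
        (fun x hx => (hs x hx).1.1.1.1.1.2.le) (fun x hx => (hs x hx).2.le) ?_
      · obtain ⟨⟨⟨⟨⟨⟨h1, h2⟩, h3⟩, h4⟩, h5⟩, h6⟩, -⟩ := hs x hx
        exact (h.cell (hu x h1)).hV_riccati hP h3.le (mul_pos h5 h6)
      · simpa using ly'.sub (lV.mul ly)
    · exact (h.wronsk_lt hP (sub_one_lt s) (fun q hq => hu q (by linarith [hq.2]))
        (fun q hq => (hs q hq.2.le).1.1.1.1.1.2)).trans_le (hXle (s - 1) (sub_one_lt s).le)
  exact h.exit_zero hP hE hsb (fun x hx => hu x hx.2) (fun x hx => hDneg x hx.2) hb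

end LogFlow

lemma hw_bounds {η p ρ W w t : ℝ} (hη : 0 < η) (hρ : 1 ≤ ρ) (hW0 : 0 < W) (hW : W < 1)
    (hφ : phi p W ≤ -1 / 4) (ht : t < 0) (hw' : w = t⁻¹)
    (hE : 0 < t ^ 2 / 2 + ρ * phi p W) (hPo : 0 < (t + η) ^ 2 / 2 + Phi η p ρ W) :
    hw η p ρ W w ≤ 0 ∧ -((2 * η + 4) * ρ) ≤ hw η p ρ W w := by
  have hφ0 : phi p W < 0 := by linarith
  have hj : t + η < -η := by
    by_contra hh
    unfold Phi at hPo
    have h1 := mul_neg_of_pos_of_neg (by linarith : 0 < ρ) hφ0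
    have : (t + η) ^ 2 ≤ η ^ 2 := by nlinarith
    linarith
  have hw0 : w < 0 := by rw [hw']; exact inv_lt_zero.2 ht
  have htw : t * w = 1 := by rw [hw']; exact mul_inv_cancel₀ ht.ne
  have e1 : η ^ 2 * w / (1 + η * w) = η ^ 2 / (t + η) := by
    have h1 : 1 + η * w = (t + η) * w := by rw [add_mul, htw]
    rw [h1, mul_div_mul_right _ _ hw0.ne]
  have hj0 : t + η < 0 := by linarith
  have b1 : η ^ 2 / (t + η) ≤ 0 := div_nonpos_of_nonneg_of_nonpos (sq_nonneg _) hj0.le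
  have b2 : -η ≤ η ^ 2 / (t + η) := by rw [le_div_iff_of_neg hj0]; nlinarith
  have c1 : 0 < w ^ 2 := pow_two_pos_of_ne_zero hw0.ne
  have c2 : ρ * -phi p W * w ^ 2 ≤ 1 / 2 := by
    have : (t * w) ^ 2 = 1 := by rw [htw]; norm_num
    nlinarith
  have c3 : ρ * w ^ 2 ≤ 2 := by nlinarith
  have c4 : 0 ≤ ρ * -phi p W * w ^ 2 := by
    have : 0 < -phi p W := by linarith
    positivity
  have d1 : ρ * (W - 1) * w ≤ ρ * -w := by
    have : 0 ≤ ρ * -w * W := by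
      have : 0 < -w := by linarith
      positivity
    nlinarith
  have d0 : 0 ≤ ρ * (W - 1) * w := mul_nonneg_of_nonpos_of_nonpos (by nlinarith) hw0.le
  have d2 : ρ * -w ≤ ρ + 2 := by
    have : -w ≤ 1 + w ^ 2 := by nlinarith [sq_nonneg (w + 1)]
    nlinarith
  unfold hw
  rw [e1]
  constructor <;> nlinarith

namespace LogFlow
variable {η p : ℝ} {u D y y' : ℝ → ℝ} {a c s R : ℝ}

lemma flux_deriv (h : LogFlow η p u D y y') (x : ℝ) :
    HasDerivAt (fun x => exp (η * x) * (y' x - η * y x))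
      (exp (η * x) * (exp (2 * x) * (1 - p * |u x| ^ (p - 1)) * y x)) x :=
  ((hasDerivAt_exp_mul η x).fun_mul ((h.y'_deriv x).fun_sub ((h.y_deriv x).const_mul η))).congr_deriv
    (by ring)

lemma scaled_deriv (h : LogFlow η p u D y y') (x : ℝ) :
    HasDerivAt (fun x => exp (-η * x) * y x) (exp (-η * x) * (y' x - η * y x)) x :=
  ((hasDerivAt_exp_mul (-η) x).fun_mul (h.y_deriv x)).congr_deriv (by ring)

lemma exists_zero (h : LogFlow η p u D y y') (hP : Params η p) (hE : CellEntry η p u D y y' s c)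
    (hu : ∀ x, s ≤ x → 0 < u x) (hD : ∀ x, c < x → D x < 0) (lu : Tendsto u atTop (nhds 0))
    (hR : ∀ x, R ≤ x → p * |u x| ^ (p - 1) ≤ 1) : ∃ x, s ≤ x ∧ y x ≤ 0 := by
  by_contra hcon
  push Not at hcon
  set r := max (c + 1) R with hr
  have hcr : c < r := (lt_add_one c).trans_le (le_max_left _ _)
  have hsr : s < r := hE.s_le.trans_lt hcr
  have hflux : ∀ x, r ≤ x →
      exp (η * x) * (y' x - η * y x) * u x < wronsk η u D y y' s := by
    intro x hx
    have h1 := h.wronsk_lt hP (hsr.trans_le hx) (fun q hq => hu q hq.1.le)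
      (fun q hq => hcon q hq.1.le)
    have h2 := mul_pos (exp_pos (η * x)) (mul_pos (hcon x (hsr.le.trans hx))
      (neg_pos.2 (hD x (hcr.trans_le hx))))
    unfold wronsk at h1 ⊢
    linarith
  have hmono : ∀ x, r ≤ x →
      exp (η * r) * (y' r - η * y r) ≤ exp (η * x) * (y' x - η * y x) := by
    intro x hx
    refine le_of_hasDerivAt_nonneg (g := fun x => exp (η * x) * (y' x - η * y x)) hx
      (fun q _ => (h.flux_deriv q).continuousAt.continuousWithinAt) (fun q _ => h.flux_deriv q)
      fun q hq => ?_
    have h1 := hR q ((le_max_right _ _).trans hq.1.le)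
    have h2 := hcon q (hsr.le.trans hq.1.le)
    have h3 : 0 ≤ 1 - p * |u q| ^ (p - 1) := by linarith
    positivity
  set M := exp (η * r) * (y' r - η * y r)
  have hlim : Tendsto (fun x => M * u x) atTop (nhds 0) := by simpa using lu.const_mul M
  have := le_of_tendsto hlim (b := wronsk η u D y y' s) (by
    filter_upwards [eventually_ge_atTop r] with x hx
    exact (mul_le_mul_of_nonneg_right (hmono x hx) (hu x (hsr.le.trans hx)).le).trans
      (hflux x hx).le)
  linarith [hE.wronsk_neg]

lemma unbounded_of_flux_pos (h : LogFlow η p u D y y') (hη : 0 < η) (hR0 : 0 ≤ R)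
    (hR : ∀ x, R ≤ x → p * |u x| ^ (p - 1) ≤ 1 / 2) (hy : ∀ x, R ≤ x → 0 < y x)
    (hM : 0 < y' R - η * y R) :
    (∀ x, R ≤ x → 0 < y' x - η * y x) ∧ Tendsto (fun x => exp (-η * x) * y x) atTop atTop := by
  have hpos : ∀ x, R ≤ x → 0 < y' x - η * y x := by
    intro x hx
    have h1 := le_of_hasDerivAt_nonneg (g := fun x => exp (η * x) * (y' x - η * y x)) hx
      (fun q _ => (h.flux_deriv q).continuousAt.continuousWithinAt) (fun q _ => h.flux_deriv q)
      fun q hq => by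
        have h1 := hR q hq.1.le
        have h2 := hy q hq.1.le
        have h3 : 0 ≤ 1 - p * |u q| ^ (p - 1) := by linarith
        positivity
    have h2 := (mul_pos (exp_pos (η * R)) hM).trans_le h1
    exact pos_of_mul_pos_right h2 (exp_pos _).le
  have hv : ∀ x, R ≤ x → exp (-η * R) * y R ≤ exp (-η * x) * y x := fun x hx =>
    le_of_hasDerivAt_nonneg (g := fun x => exp (-η * x) * y x) hx
      (fun q _ => (h.scaled_deriv q).continuousAt.continuousWithinAt) (fun q _ => h.scaled_deriv q)
      fun q hq => mul_nonneg (exp_pos _).le (hpos q hq.1.le).le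
  set v := exp (-η * R) * y R with hvd
  have hv0 : 0 < v := mul_pos (exp_pos _) (hy R le_rfl)
  set K := min (v / (4 * η)) (exp (-η * R) * (y' R - η * y R)) with hK
  have hK0 : 0 < K := lt_min (by positivity) (by positivity)
  have hslope : ∀ x, R ≤ x → K ≤ exp (-η * x) * (y' x - η * y x) := by
    intro x hx
    have h1 := le_of_hasDerivAt_nonneg
      (g := fun x => exp (η * x) * (y' x - η * y x) - K * exp (2 * η * x)) hx
      (fun q _ => ((h.flux_deriv q).fun_sub
        ((hasDerivAt_exp_mul (2 * η) q).const_mul K)).continuousAt.continuousWithinAt)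
      (fun q _ => (h.flux_deriv q).fun_sub ((hasDerivAt_exp_mul (2 * η) q).const_mul K))
      fun q hq => by
        have h1 := hR q hq.1.le
        have h2 := hv q hq.1.le
        have h3 : y q = exp (η * q) * (exp (-η * q) * y q) := by
          rw [← mul_assoc, ← exp_add]; simp
        have h4 : 1 ≤ exp (2 * q) := one_le_exp (by linarith [hq.1])
        have h5 : exp (2 * η * q) = exp (η * q) * exp (η * q) := by rw [← exp_add]; congr 1; ring
        have h6 : K * (4 * η) ≤ v := by
          rw [← le_div_iff₀ (by positivity)]; exact min_le_left _ _
        have h7 : 1 / 2 ≤ exp (2 * q) * (1 - p * |u q| ^ (p - 1)) := by nlinarith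
        have h8 : K * (2 * η) ≤ exp (2 * q) * (1 - p * |u q| ^ (p - 1)) * (exp (-η * q) * y q) := by
          nlinarith
        rw [h3, h5]
        have := mul_nonneg (mul_pos (exp_pos (η * q)) (exp_pos (η * q))).le (sub_nonneg.2 h8)
        linarith
    have e : ∀ x, exp (η * x) * (y' x - η * y x) - K * exp (2 * η * x)
        = exp (2 * η * x) * (exp (-η * x) * (y' x - η * y x) - K) := by
      intro x
      have : exp (η * x) = exp (2 * η * x) * exp (-η * x) := by rw [← exp_add]; congr 1; ring
      rw [this]; ring
    simp only [e] at h1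
    have h2 : 0 ≤ exp (2 * η * R) * (exp (-η * R) * (y' R - η * y R) - K) :=
      mul_nonneg (exp_pos _).le (sub_nonneg.2 (min_le_right _ _))
    have := nonneg_of_mul_nonneg_right (h2.trans h1) (exp_pos _)
    linarith
  refine ⟨hpos, ?_⟩
  have hlin : ∀ x, R ≤ x → v + K * (x - R) ≤ exp (-η * x) * y x := by
    intro x hx
    have := le_of_hasDerivAt_nonneg (g := fun x => exp (-η * x) * y x - K * x) hx
      (fun q _ => ((h.scaled_deriv q).fun_sub
        ((hasDerivAt_id' q).const_mul K)).continuousAt.continuousWithinAt)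
      (fun q _ => (h.scaled_deriv q).fun_sub ((hasDerivAt_id' q).const_mul K))
      fun q hq => by linarith [hslope q hq.1.le]
    linarith
  refine tendsto_atTop_mono' _ ((eventually_ge_atTop R).mono hlin)
    (tendsto_atTop_add_const_left _ _ (Tendsto.const_mul_atTop hK0 ?_))
  exact tendsto_atTop_add_const_right _ (-R) tendsto_id

lemma exists_flux_pos (h : LogFlow η p u D y y') (hP : Params η p) (hR0 : 0 ≤ R)
    (hu : ∀ x, R ≤ x → 0 < u x) (hD : ∀ x, R ≤ x → D x < 0)
    (hR : ∀ x, R ≤ x → p * |u x| ^ (p - 1) ≤ 1 / 2) (hy : ∀ x, R ≤ x → 0 < y x)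
    (hq : ∀ x, R ≤ x →
      0 < y' x - hw η p (exp (2 * x)) (|u x| ^ (p - 1)) (u x / D x) * y x) :
    ∃ x, R ≤ x ∧ 0 < y' x - η * y x := by
  have hp := hP.p_gt
  have hη : 0 < η := by have := hP.η_ge; linarith
  by_contra hcon
  push Not at hcon
  have hW : ∀ x, R ≤ x → 0 < |u x| ^ (p - 1) ∧ |u x| ^ (p - 1) < 1 ∧
      phi p (|u x| ^ (p - 1)) ≤ -1 / 4 := by
    intro x hx
    have h1 : 0 < |u x| ^ (p - 1) := rpow_pos_of_pos (abs_pos.2 (hu x hx).ne') _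
    have h2 := hR x hx
    have h3 : |u x| ^ (p - 1) < 1 / 2 := by nlinarith
    refine ⟨h1, by linarith, ?_⟩
    unfold phi
    have : |u x| ^ (p - 1) / (p + 1) ≤ 1 / 4 := by
      rw [div_le_iff₀ (by linarith)]; linarith
    linarith
  have hρ : ∀ x, R ≤ x → 1 ≤ exp (2 * x) := fun x hx => one_le_exp (by linarith)
  have hb : ∀ x, R ≤ x → hw η p (exp (2 * x)) (|u x| ^ (p - 1)) (u x / D x) ≤ 0 ∧
      -((2 * η + 4) * exp (2 * x)) ≤ hw η p (exp (2 * x)) (|u x| ^ (p - 1)) (u x / D x) := by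
    intro x hx
    obtain ⟨h1, h2, h3⟩ := hW x hx
    exact hw_bounds hη (hρ x hx) h1 h2 h3 (div_neg_of_neg_of_pos (hD x hx) (hu x hx))
      (inv_div _ _).symm (h.cell (hu x hx)).energy (h.cell (hu x hx)).pohozaev
  have hric : ∀ x, R ≤ x → _ := fun x hx => h.hw_ric hP (hu x hx) (by linarith [(hW x hx).2.2])
  choose! h' hd' hr' using hric
  set q := fun x => y' x - hw η p (exp (2 * x)) (|u x| ^ (p - 1)) (u x / D x) * y x with hqd
  have hqder : ∀ x, R ≤ x → HasDerivAt q _ x := fun x hx =>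
    (h.y'_deriv x).fun_sub ((hd' x hx).fun_mul (h.y_deriv x))
  have hqmono : ∀ x, R ≤ x → q R ≤ q x := by
    intro x hx
    refine le_of_hasDerivAt_nonneg hx
      (fun z hz => (hqder z hz.1).continuousAt.continuousWithinAt) (fun z hz => hqder z hz.1.le)
      fun z hz => ?_
    have h1 := mul_nonneg (neg_nonneg.2 (hr' z hz.1.le)) (hy z hz.1.le).le
    have h2 := mul_nonneg (neg_nonneg.2 (hb z hz.1.le).1) (hq z hz.1.le).le
    linarith
  have hε : 0 < q R := hq R le_rfl
  set ε := q R
  set k := ε / (2 * (3 * η + 4)) with hk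
  have hk0 : 0 < k := by positivity
  have hlow : ∀ x, R ≤ x → ε ≤ (3 * η + 4) * (exp (2 * x) * y x) := by
    intro x hx
    have h1 : ε ≤ y' x - hw η p (exp (2 * x)) (|u x| ^ (p - 1)) (u x / D x) * y x := hqmono x hx
    have h2 := hcon x hx
    have h3 := mul_le_mul_of_nonneg_right (hb x hx).2 (hy x hx).le
    have h4 : η * y x ≤ η * (exp (2 * x) * y x) :=
      mul_le_mul_of_nonneg_left (le_mul_of_one_le_left (hy x hx).le (hρ x hx)) hη.le
    linarith
  have hlin : ∀ x, R ≤ x →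
      exp (η * R) * (y' R - η * y R) + k * (x - R) ≤ exp (η * x) * (y' x - η * y x) := by
    intro x hx
    have := le_of_hasDerivAt_nonneg (g := fun x => exp (η * x) * (y' x - η * y x) - k * x) hx
      (fun z _ => ((h.flux_deriv z).fun_sub
        ((hasDerivAt_id' z).const_mul k)).continuousAt.continuousWithinAt)
      (fun z _ => (h.flux_deriv z).fun_sub ((hasDerivAt_id' z).const_mul k))
      fun z hz => by
        have h1 := hlow z hz.1.le
        have h2 : 1 ≤ exp (η * z) := one_le_exp (mul_nonneg hη.le (hR0.trans hz.1.le))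
        have h3 := hR z hz.1.le
        have h4 : k * 2 ≤ exp (2 * z) * y z := by
          rw [hk]
          have : ε / (2 * (3 * η + 4)) * 2 = ε / (3 * η + 4) := by field_simp
          rw [this, div_le_iff₀ (by positivity)]
          linarith
        have h5 : k ≤ exp (2 * z) * (1 - p * |u z| ^ (p - 1)) * y z := by
          have := mul_nonneg (mul_pos (exp_pos (2 * z)) (hy z hz.1.le)).le
            (by linarith : 0 ≤ 1 - p * |u z| ^ (p - 1) - 1 / 2)
          linarith
        have h6 := mul_le_mul h2 h5 hk0.le (exp_pos _).le
        linarith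
    linarith
  have hle : ∀ x, R ≤ x → exp (η * R) * (y' R - η * y R) + k * (x - R) ≤ 0 := fun x hx =>
    (hlin x hx).trans (mul_nonpos_of_nonneg_of_nonpos (exp_pos _).le (hcon x hx))
  have hlim : Tendsto (fun x => exp (η * R) * (y' R - η * y R) + k * (x - R)) atTop atTop :=
    tendsto_atTop_add_const_left _ _ (Tendsto.const_mul_atTop hk0
      (tendsto_atTop_add_const_right _ (-R) tendsto_id))
  obtain ⟨x, hx1, hx2⟩ := ((hlim.eventually_gt_atTop 0).and (eventually_ge_atTop R)).exists
  linarith [hle x hx2]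

/-- The variation after the last zero of `u`. -/
lemma last_cell (h : LogFlow η p u D y y') (hP : Params η p) (hac : a < c) (ha : u a = 0)
    (hu : ∀ x, a < x → 0 < u x) (hDc : D c = 0) (hDa : 0 < D a) (hy : 0 < y a) (hy' : 0 ≤ y' a)
    (lu : Tendsto u atTop (nhds 0)) :
    ∃ τ, a < τ ∧ c < τ ∧ y τ = 0 ∧ (∀ x, a ≤ x → y x = 0 → x = τ) ∧
      (∃ R, ∀ x, R ≤ x → y' x - η * y x < 0) ∧
      Tendsto (fun x => exp (-η * x) * y x) atTop atBot := by
  have hp := hP.p_gt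
  have hη : 0 < η := by have := hP.η_ge; linarith
  obtain ⟨s, hs, hE, hpos⟩ := h.entry_of_zero hP hac ha (fun x hx => hu x hx.1) hDc hDa hy hy'
  have hD : ∀ x, c < x → D x < 0 := fun x hx =>
    h.D_neg_of_critical hP hx (fun z hz => hu z (hac.trans_le hz.1)) hDc
  have hus : ∀ x, s ≤ x → 0 < u x := fun x hx => hu x (hs.1.trans_le hx)
  have lW : Tendsto (fun x => p * |u x| ^ (p - 1)) atTop (nhds 0) := by
    have := (lu.abs.rpow_const (p := p - 1) (Or.inr (by linarith))).const_mul p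
    rwa [abs_zero, zero_rpow (by linarith), mul_zero] at this
  obtain ⟨R, hR⟩ := eventually_atTop.1 (lW.eventually (ge_mem_nhds (by norm_num : (0 : ℝ) < 1 / 2)))
  obtain ⟨x, hsx, hyx⟩ := h.exists_zero hP hE hus hD lu (R := R)
    fun x hx => (hR x hx).trans (by norm_num)
  obtain ⟨τ, hτ, hτ0, hτp⟩ := exists_first_nonpos hsx h.y_cont.continuousOn hE.y_pos hyx
  have hφ : ∀ x, R ≤ x → phi p (|u x| ^ (p - 1)) < 0 := by
    intro x hx
    have h1 := hR x hx
    have h2 : 0 ≤ |u x| ^ (p - 1) := rpow_nonneg (abs_nonneg _) _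
    unfold phi
    have : |u x| ^ (p - 1) / (p + 1) < 1 / 2 := by
      rw [div_lt_iff₀ (by linarith)]; nlinarith
    linarith
  have htr : ∀ m, max R (max c τ) < m → _ := fun m hm =>
    h.traverse hP hE (((le_max_left c τ).trans (le_max_right R _)).trans_lt hm)
      (fun x hx => hus x hx.1) (fun x hx => hD x hx.1)
      (hφ m ((le_max_left _ _).trans hm.le))
      ⟨hτ.1, ((le_max_right c τ).trans (le_max_right R _)).trans_lt hm⟩ hτ0 hτp
  have hneg : ∀ x, τ < x → y x < 0 := by
    intro x hx
    refine (htr (max (max R (max c τ)) x + 1) ?_).1 x ⟨hx, ?_⟩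
    · exact (le_max_left _ _).trans_lt (lt_add_one _)
    · exact (le_max_right _ _).trans (lt_add_one _).le
  have hcτ : c < τ := by
    obtain ⟨-, -, τ', h1, h2⟩ := htr _ (lt_add_one _)
    refine lt_trans ?_ h1.2
    by_contra hh
    rcases (not_lt.1 hh).eq_or_lt with rfl | hl
    · exact h2.ne hDc
    · have := h.D_pos_of_critical hP hl (fun z hz => hus z (h1.1.trans hz.1)) hDc
      linarith
  set r := max 0 (max R (max c τ)) + 1 with hr
  have hr1 : max R (max c τ) < r := (le_max_right _ _).trans_lt (lt_add_one _)
  have hrR : R ≤ r := (le_max_left _ _).trans hr1.le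
  have hrτ : τ < r := ((le_max_right c τ).trans (le_max_right R _)).trans_lt hr1
  have hr0 : 0 ≤ r := (le_max_left _ _).trans (lt_add_one _).le
  have hz := h.neg_y
  obtain ⟨r', hrr', hfl⟩ := hz.exists_flux_pos hP hr0
    (fun x hx => hu x ((hac.trans hcτ).trans (hrτ.trans_le hx)))
    (fun x hx => hD x (hcτ.trans (hrτ.trans_le hx))) (fun x hx => hR x (hrR.trans hx))
    (fun x hx => neg_pos.2 (hneg x (hrτ.trans_le hx))) (fun x hx => by
      have := (htr x (hr1.trans_le hx)).2.1
      linarith)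
  obtain ⟨h1, h2⟩ := hz.unbounded_of_flux_pos hη (hr0.trans hrr')
    (fun x hx => hR x (hrR.trans (hrr'.trans hx)))
    (fun x hx => neg_pos.2 (hneg x (hrτ.trans_le (hrr'.trans hx)))) hfl
  refine ⟨τ, hac.trans hcτ, hcτ, hτ0, fun x hx h0 => ?_, ⟨r', fun x hx => ?_⟩, ?_⟩
  · rcases lt_trichotomy x τ with hl | rfl | hg
    · exfalso
      rcases le_total x s with h3 | h3
      · exact (hpos x ⟨hx, h3⟩).ne' h0
      · exact (hτp x ⟨h3, hl⟩).ne' h0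
    · rfl
    · exact absurd h0 (hneg x hg).ne
  · linarith [h1 x hx]
  · rw [← tendsto_neg_atTop_iff]
    simpa only [mul_neg] using h2

end LogFlow

/-- A solution of the radial equation in the variable `log r`. -/
structure RadialFlow (η p : ℝ) (u D : ℝ → ℝ) : Prop where
  u_deriv : ∀ x, HasDerivAt u (D x) x
  D_deriv : ∀ x, HasDerivAt D (-2 * η * D x - exp (2 * x) * (|u x| ^ (p - 1) - 1) * u x) x

lemma phi_mul_sq {p : ℝ} (hp : 1 < p) (s : ℝ) :
    phi p (|s| ^ (p - 1)) * s ^ 2 = |s| ^ (p + 1) / (p + 1) - s ^ 2 / 2 := by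
  have : |s| ^ (p + 1) = |s| ^ (p - 1) * s ^ 2 := by
    rw [← sq_abs s, ← rpow_natCast, ← rpow_add_of_nonneg (abs_nonneg s) (by linarith) (by norm_num)]
    congr 1
    push_cast
    ring
  rw [this]
  unfold phi
  ring

lemma hasDerivAt_phi_mul_sq {p : ℝ} (hp : 1 < p) {u : ℝ → ℝ} {d x : ℝ} (hu : HasDerivAt u d x) :
    HasDerivAt (fun x => phi p (|u x| ^ (p - 1)) * u x ^ 2)
      ((|u x| ^ (p - 1) - 1) * u x * d) x := by
  simp only [phi_mul_sq hp]
  have h1 := (hasDerivAt_abs_rpow (u x) (by linarith : 1 < p + 1)).comp x hu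
  refine ((h1.div_const (p + 1)).fun_sub ((hu.fun_pow 2).div_const 2)).congr_deriv ?_
  have : p + 1 - 2 = p - 1 := by ring
  rw [this]
  field_simp
  ring

namespace RadialFlow

variable {η p : ℝ} {u D : ℝ → ℝ}

lemma neg (h : RadialFlow η p u D) : RadialFlow η p (fun x => -u x) (fun x => -D x) where
  u_deriv x := (h.u_deriv x).fun_neg
  D_deriv x := by
    refine (h.D_deriv x).fun_neg.congr_deriv ?_
    rw [abs_neg]
    ring

lemma u_cont (h : RadialFlow η p u D) : Continuous u :=
  continuous_iff_continuousAt.2 fun x => (h.u_deriv x).continuousAt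

lemma D_cont (h : RadialFlow η p u D) : Continuous D :=
  continuous_iff_continuousAt.2 fun x => (h.D_deriv x).continuousAt

lemma energy_deriv (h : RadialFlow η p u D) (hp : 1 < p) (x : ℝ) :
    HasDerivAt (fun x => (exp (-x) * D x) ^ 2 / 2 + phi p (|u x| ^ (p - 1)) * u x ^ 2)
      (-((2 * η + 1) * (exp (-x) * D x) ^ 2)) x := by
  have h0 : HasDerivAt (fun x => exp (-x)) (-exp (-x)) x := by
    simpa using hasDerivAt_exp_mul (-1) x
  refine ((((h0.fun_mul (h.D_deriv x)).fun_pow 2).div_const 2).fun_add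
    (hasDerivAt_phi_mul_sq hp (h.u_deriv x))).congr_deriv ?_
  have e : exp (-x) ^ 2 * exp (2 * x) = 1 := by
    rw [← exp_nat_mul, ← exp_add]
    norm_num
  push_cast
  linear_combination (-(|u x| ^ (p - 1) - 1) * u x * D x) * e

lemma energy_antitone (h : RadialFlow η p u D) (hη : 0 ≤ η) (hp : 1 < p) :
    Antitone fun x => (exp (-x) * D x) ^ 2 / 2 + phi p (|u x| ^ (p - 1)) * u x ^ 2 := by
  refine antitone_of_deriv_nonpos (fun x => (h.energy_deriv hp x).differentiableAt) fun x => ?_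
  rw [(h.energy_deriv hp x).deriv]
  have : 0 ≤ (2 * η + 1) * (exp (-x) * D x) ^ 2 := by positivity
  linarith

lemma energy_tendsto {l : Filter ℝ} {α : ℝ} (hp : 1 < p) (lu : Tendsto u l (nhds α))
    (lD : Tendsto (fun x => exp (-x) * D x) l (nhds 0)) :
    Tendsto (fun x => (exp (-x) * D x) ^ 2 / 2 + phi p (|u x| ^ (p - 1)) * u x ^ 2) l
      (nhds (phi p (|α| ^ (p - 1)) * α ^ 2)) := by
  have h1 : Tendsto (fun x => |u x| ^ (p - 1)) l (nhds (|α| ^ (p - 1))) :=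
    lu.abs.rpow_const (Or.inr (by linarith))
  simpa [phi] using ((lD.pow 2).div_const 2).add
    (((h1.div_const (p + 1)).sub_const (1 / 2)).mul (lu.pow 2))

lemma energy_pos (h : RadialFlow η p u D) (hη : 0 ≤ η) (hp : 1 < p)
    (lu : Tendsto u atTop (nhds 0)) (lD : Tendsto (fun x => exp (-x) * D x) atTop (nhds 0))
    (hne : ∀ᶠ x in atTop, u x ≠ 0) (x : ℝ) :
    0 < (exp (-x) * D x) ^ 2 / 2 + phi p (|u x| ^ (p - 1)) * u x ^ 2 := by
  have hanti := h.energy_antitone hη hp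
  have hl := energy_tendsto hp lu lD
  norm_num at hl
  have hnn : ∀ x, 0 ≤ (exp (-x) * D x) ^ 2 / 2 + phi p (|u x| ^ (p - 1)) * u x ^ 2 := fun x =>
    le_of_tendsto hl ((eventually_ge_atTop x).mono fun y hy => hanti hy)
  refine (hnn x).lt_of_ne' fun h0 => ?_
  have hz : ∀ y, x < y → D y = 0 := by
    intro y hy
    have hev : (fun x => (exp (-x) * D x) ^ 2 / 2 + phi p (|u x| ^ (p - 1)) * u x ^ 2)
        =ᶠ[nhds y] fun _ => 0 := by
      filter_upwards [Ioi_mem_nhds hy] with q hq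
      exact le_antisymm (h0 ▸ hanti (le_of_lt hq)) (hnn q)
    have h1 := (h.energy_deriv hp y).unique ((hasDerivAt_const y (0 : ℝ)).congr_of_eventuallyEq hev)
    have h2 : (2 * η + 1) * (exp (-y) * D y) ^ 2 = 0 := by linarith
    rcases mul_eq_zero.1 h2 with h3 | h3
    · linarith
    · exact (mul_eq_zero.1 (pow_eq_zero_iff two_ne_zero |>.1 h3)).resolve_left (exp_pos _).ne'
  obtain ⟨q, hq, hxq⟩ := (hne.and (eventually_gt_atTop x)).exists
  refine hq (tendsto_nhds_unique ?_ lu)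
  refine tendsto_const_nhds.congr' ?_
  filter_upwards [eventually_ge_atTop q] with y hy
  have h1 := le_of_hasDerivAt_nonneg hy (g := u) h.u_cont.continuousOn
    (fun w _ => h.u_deriv w) fun w hw => (hz w (hxq.trans hw.1)).ge
  have h2 := le_of_hasDerivAt_nonneg hy (g := fun w => -u w) h.u_cont.neg.continuousOn
    (fun w _ => (h.u_deriv w).fun_neg) fun w hw => by rw [hz w (hxq.trans hw.1), neg_zero]
  exact le_antisymm h1 (neg_le_neg_iff.1 h2)

/-- The Pohozaev functional. -/
noncomputable def poh (η p : ℝ) (u D : ℝ → ℝ) (x : ℝ) : ℝ :=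
  exp (2 * η * x) * (D x ^ 2 / 2 + η * D x * u x + exp (2 * x) * (phi p (|u x| ^ (p - 1)) * u x ^ 2))

lemma poh_deriv (h : RadialFlow η p u D) (hp : 1 < p) (x : ℝ) : HasDerivAt (poh η p u D)
    (exp (2 * η * x) * (exp (2 * x) * u x ^ 2 * bigG η p (|u x| ^ (p - 1)))) x := by
  refine ((hasDerivAt_exp_mul (2 * η) x).fun_mul (((((h.D_deriv x).fun_pow 2).div_const 2).fun_add
    (((h.D_deriv x).const_mul η).fun_mul (h.u_deriv x))).fun_add ((hasDerivAt_exp_mul 2 x).fun_mul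
    (hasDerivAt_phi_mul_sq hp (h.u_deriv x))))).congr_deriv ?_
  unfold bigG
  push_cast
  ring

lemma poh_cont (h : RadialFlow η p u D) (hp : 1 < p) : Continuous (poh η p u D) :=
  continuous_iff_continuousAt.2 fun x => (h.poh_deriv hp x).continuousAt

lemma bigG_lt_bigG {W₁ W₂ : ℝ} (hp : 1 < p) (hκ : η * p < η + 2) (hW : W₁ < W₂) :
    bigG η p W₁ < bigG η p W₂ := by
  have : bigG η p W₂ - bigG η p W₁ = (η + 2 - η * p) / (p + 1) * (W₂ - W₁) := by
    unfold bigG phi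
    field_simp
    ring
  have h1 : 0 < (η + 2 - η * p) / (p + 1) * (W₂ - W₁) :=
    mul_pos (div_pos (by linarith) (by linarith)) (by linarith)
  linarith

lemma poh_gt {x : ℝ} (hE : 0 < (exp (-x) * D x) ^ 2 / 2 + phi p (|u x| ^ (p - 1)) * u x ^ 2) :
    exp (2 * η * x) * (η * D x * u x) < poh η p u D x := by
  have e : exp (-x) ^ 2 * exp (2 * x) = 1 := by
    rw [← exp_nat_mul, ← exp_add]
    norm_num
  have h1 := mul_pos (exp_pos (2 * x)) hE
  unfold poh
  refine mul_lt_mul_of_pos_left ?_ (exp_pos _)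
  have : exp (2 * x) * ((exp (-x) * D x) ^ 2 / 2 + phi p (|u x| ^ (p - 1)) * u x ^ 2) =
      D x ^ 2 / 2 + exp (2 * x) * (phi p (|u x| ^ (p - 1)) * u x ^ 2) := by
    linear_combination (D x ^ 2 / 2) * e
  linarith

lemma poh_pos_of_mul_nonneg {x : ℝ} (hη : 0 ≤ η)
    (hE : 0 < (exp (-x) * D x) ^ 2 / 2 + phi p (|u x| ^ (p - 1)) * u x ^ 2)
    (h : 0 ≤ D x * u x) : 0 < poh η p u D x := by
  refine lt_of_le_of_lt ?_ (poh_gt hE)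
  rw [mul_assoc η]
  positivity

lemma u_lt (h : RadialFlow η p u D) {a b : ℝ} (hab : a < b) (hD : ∀ x ∈ Ioo a b, D x < 0) :
    u b < u a := by
  have := lt_of_hasDerivAt_pos hab (g := fun x => -u x) h.u_cont.neg.continuousOn
    (fun x _ => (h.u_deriv x).fun_neg) fun x hx => by linarith [hD x hx]
  simpa using this

lemma poh_lt_left (h : RadialFlow η p u D) (hp : 1 < p) (hκ : η * p < η + 2) {a b : ℝ}
    (hab : a < b) (hub : 0 < u b) (hD : ∀ x ∈ Ioo a b, D x < 0)
    (hG : 0 ≤ bigG η p (|u b| ^ (p - 1))) : poh η p u D a < poh η p u D b := by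
  refine lt_of_hasDerivAt_pos hab (h.poh_cont hp).continuousOn (fun x _ => h.poh_deriv hp x)
    fun x hx => ?_
  have h1 := h.u_lt hx.2 fun q hq => hD q ⟨hx.1.trans hq.1, hq.2⟩
  have h2 : 0 < bigG η p (|u x| ^ (p - 1)) := hG.trans_lt (bigG_lt_bigG hp hκ
    (rpow_lt_rpow (abs_nonneg _) (by rwa [abs_of_pos hub, abs_of_pos (hub.trans h1)])
      (by linarith)))
  have h3 : 0 < u x := hub.trans h1
  positivity

lemma poh_lt_right (h : RadialFlow η p u D) (hp : 1 < p) (hκ : η * p < η + 2) {a b : ℝ}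
    (hab : a < b) (hu : ∀ x ∈ Ioo a b, 0 < u x) (hD : ∀ x ∈ Ioo a b, D x < 0)
    (hG : bigG η p (|u a| ^ (p - 1)) ≤ 0) : poh η p u D b < poh η p u D a := by
  refine neg_lt_neg_iff.1 (lt_of_hasDerivAt_pos hab (g := fun x => -poh η p u D x)
    (h.poh_cont hp).neg.continuousOn (fun x _ => (h.poh_deriv hp x).fun_neg) fun x hx => ?_)
  have h1 := h.u_lt hx.1 fun q hq => hD q ⟨hq.1, hq.2.trans hx.2⟩
  have h3 := hu x hx
  have h2 : bigG η p (|u x| ^ (p - 1)) < 0 := lt_of_lt_of_le (bigG_lt_bigG hp hκ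
    (rpow_lt_rpow (abs_nonneg _) (by rwa [abs_of_pos h3, abs_of_pos (h3.trans h1)])
      (by linarith))) hG
  rw [← mul_neg, ← mul_neg]
  have := neg_pos.2 h2
  positivity

lemma poh_tendsto_atBot (hη : 0 < η) {α : ℝ} (hp : 1 < p) (lu : Tendsto u atBot (nhds α))
    (lD : Tendsto D atBot (nhds 0)) : Tendsto (poh η p u D) atBot (nhds 0) := by
  have he : ∀ c : ℝ, 0 < c → Tendsto (fun x => exp (c * x)) atBot (nhds 0) := fun c hc =>
    tendsto_exp_atBot.comp (tendsto_id.const_mul_atBot hc)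
  have h1 : Tendsto (fun x => |u x| ^ (p - 1)) atBot (nhds (|α| ^ (p - 1))) :=
    lu.abs.rpow_const (Or.inr (by linarith))
  have h2 : Tendsto (fun x => phi p (|u x| ^ (p - 1)) * u x ^ 2) atBot
      (nhds (phi p (|α| ^ (p - 1)) * α ^ 2)) :=
    ((h1.div_const (p + 1)).sub_const (1 / 2)).mul (lu.pow 2)
  have h3 := (he (2 * η) (by linarith)).mul ((((lD.pow 2).div_const 2).add
    ((lD.const_mul η).mul lu)).add ((he 2 two_pos).mul h2))
  rwa [zero_mul] at h3

lemma poh_pos_of_pos (h : RadialFlow η p u D) (hη : 0 < η) (hp : 1 < p) (hκ : η * p < η + 2)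
    (hE : ∀ x, 0 < (exp (-x) * D x) ^ 2 / 2 + phi p (|u x| ^ (p - 1)) * u x ^ 2)
    (lP : Tendsto (poh η p u D) atBot (nhds 0)) (lu : Tendsto u atTop (nhds 0)) {x : ℝ}
    (hx : 0 < u x) (hDx : D x < 0) : 0 < poh η p u D x := by
  have hg : Continuous fun x => min (u x) (-D x) := h.u_cont.min h.D_cont.neg
  have hgx : 0 < min (u x) (-D x) := lt_min hx (by linarith)
  rcases le_or_gt 0 (bigG η p (|u x| ^ (p - 1))) with hG | hG
  · by_cases hex : ∃ a < x, min (u a) (-D a) ≤ 0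
    · obtain ⟨a, hax, ha⟩ := hex
      obtain ⟨c, hc, hc0, hcx⟩ := exists_last_nonpos hax.le hg.continuousOn ha hgx
      have hD : ∀ q ∈ Ioo c x, D q < 0 := fun q hq => by
        linarith [(lt_min_iff.1 (hcx q ⟨hq.1, hq.2.le⟩)).2]
      have huc := hx.trans (h.u_lt hc.2 hD)
      have hDc : D c = 0 := by
        rcases min_choice (u c) (-D c) with h1 | h1 <;> rw [h1] at hc0 <;> linarith
      exact (poh_pos_of_mul_nonneg hη.le (hE c) (by rw [hDc, zero_mul])).trans
        (h.poh_lt_left hp hκ hc.2 hx hD hG)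
    · push Not at hex
      have hD : ∀ q < x, D q < 0 := fun q hq => by linarith [(lt_min_iff.1 (hex q hq)).2]
      have h1 : 0 ≤ poh η p u D (x - 1) := by
        refine le_of_tendsto lP ?_
        filter_upwards [eventually_lt_atBot (x - 1)] with q hq
        refine (h.poh_lt_left hp hκ hq (lt_min_iff.1 (hex _ (by linarith))).1
          (fun w hw => hD w (by linarith [hw.2])) (hG.trans (bigG_lt_bigG hp hκ ?_).le)).le
        have h2 := h.u_lt (by linarith : x - 1 < x) fun w hw => hD w hw.2
        exact rpow_lt_rpow (abs_nonneg _) (by rwa [abs_of_pos hx, abs_of_pos (hx.trans h2)])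
          (by linarith)
      exact h1.trans_lt (h.poh_lt_left hp hκ (by linarith) hx (fun w hw => hD w hw.2) hG)
  · by_cases hex : ∃ b > x, min (u b) (-D b) ≤ 0
    · obtain ⟨b, hxb, hb⟩ := hex
      obtain ⟨c, hc, hc0, hcx⟩ := exists_first_nonpos hxb.le hg.continuousOn hgx hb
      have hq : ∀ q ∈ Ioo x c, 0 < u q ∧ D q < 0 := fun q hq => by
        have := lt_min_iff.1 (hcx q ⟨hq.1.le, hq.2⟩)
        exact ⟨this.1, by linarith⟩
      refine (poh_pos_of_mul_nonneg hη.le (hE c) ?_).trans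
        (h.poh_lt_right hp hκ hc.1 (fun q hq' => (hq q hq').1) (fun q hq' => (hq q hq').2) hG.le)
      rcases min_choice (u c) (-D c) with h1 | h1
      · rw [h1] at hc0
        rw [hc0, mul_zero]
      · rw [h1] at hc0
        rw [neg_eq_zero.1 hc0, zero_mul]
    · push Not at hex
      have hu : ∀ q, x < q → 0 < u q := fun q hq => (lt_min_iff.1 (hex q hq)).1
      have hD : ∀ q, x < q → D q < 0 := fun q hq => by linarith [(lt_min_iff.1 (hex q hq)).2]
      obtain ⟨X, hX⟩ := eventually_atTop.1 ((lu.eventually (Iio_mem_nhds one_pos)).and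
        (eventually_gt_atTop x))
      have hmono : ∀ q, X ≤ q → exp (2 * η * X) * D X ≤ exp (2 * η * q) * D q := by
        intro q hq
        refine le_of_hasDerivAt_nonneg hq (g := fun x => exp (2 * η * x) * D x)
          (fun w _ => ((hasDerivAt_exp_mul (2 * η) w).fun_mul
            (h.D_deriv w)).continuousAt.continuousWithinAt)
          (fun w _ => (hasDerivAt_exp_mul (2 * η) w).fun_mul (h.D_deriv w)) fun w hw => ?_
        obtain ⟨h1, h2⟩ := hX w hw.1.le
        have h3 := hu w h2
        have h4 : 0 ≤ 1 - |u w| ^ (p - 1) := by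
          have := rpow_le_one (abs_nonneg (u w)) (by rw [abs_of_pos h3]; exact h1.le)
            (by linarith : 0 ≤ p - 1)
          linarith
        have h5 : 0 ≤ exp (2 * η * w) * (exp (2 * w) * (1 - |u w| ^ (p - 1)) * u w) := by
          positivity
        linarith
      have h1 : 0 ≤ poh η p u D (x + 1) := by
        have hl : Tendsto (fun q => η * (exp (2 * η * X) * D X) * u q) atTop (nhds 0) := by
          simpa using lu.const_mul (η * (exp (2 * η * X) * D X))
        refine le_of_tendsto hl ?_
        filter_upwards [eventually_gt_atTop (x + 1), eventually_ge_atTop X] with q hq hqX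
        have h2 := h.poh_lt_right hp hκ hq (fun w hw => hu w (by linarith [hw.1]))
          (fun w hw => hD w (by linarith [hw.1])) ((bigG_lt_bigG hp hκ ?_).le.trans hG.le)
        · have h3 := poh_gt (η := η) (hE q)
          have h4 := mul_le_mul_of_nonneg_right (hmono q hqX)
            (mul_nonneg hη.le (hu q (by linarith)).le)
          linarith
        · have h2 := h.u_lt (by linarith : x < x + 1) fun w hw => hD w hw.1
          exact rpow_lt_rpow (abs_nonneg _)
            (by rwa [abs_of_pos hx, abs_of_pos (hu _ (by linarith))]) (by linarith)
      exact h1.trans_lt (h.poh_lt_right hp hκ (by linarith) (fun w hw => hu w hw.1)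
        (fun w hw => hD w hw.1) hG.le)

lemma poh_neg : poh η p (fun x => -u x) (fun x => -D x) = poh η p u D := by
  funext x
  unfold poh
  rw [abs_neg]
  ring

lemma poh_pos (h : RadialFlow η p u D) (hη : 0 < η) (hp : 1 < p) (hκ : η * p < η + 2)
    (hE : ∀ x, 0 < (exp (-x) * D x) ^ 2 / 2 + phi p (|u x| ^ (p - 1)) * u x ^ 2)
    (lP : Tendsto (poh η p u D) atBot (nhds 0)) (lu : Tendsto u atTop (nhds 0)) (x : ℝ) :
    0 < poh η p u D x := by
  rcases le_or_gt 0 (D x * u x) with h0 | h0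
  · exact poh_pos_of_mul_nonneg hη.le (hE x) h0
  · rcases mul_neg_iff.1 h0 with ⟨h1, h2⟩ | ⟨h1, h2⟩
    · rw [← poh_neg]
      refine h.neg.poh_pos_of_pos hη hp hκ (fun x => ?_) (by rwa [poh_neg])
        (by simpa using lu.neg) (by linarith) (by linarith)
      rw [abs_neg, mul_neg, neg_sq, neg_sq]
      exact hE x
    · exact h.poh_pos_of_pos hη hp hκ hE lP lu h2 h1

end RadialFlow

namespace LogFlow

variable {η p : ℝ} {u D y y' : ℝ → ℝ} {a b c : ℝ}

lemma pos_of_ne_zero (h : LogFlow η p u D y y') {x : ℝ} (hax : a < x) (ha : u a = 0)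
    (hDa : 0 < D a) (hne : ∀ q ∈ Ioc a x, u q ≠ 0) : 0 < u x := by
  by_contra! hx
  obtain ⟨δ, hδ, h1⟩ := eventually_right_of_deriv_pos (h.u_deriv a) hDa
  obtain ⟨q, hq1, hq2⟩ := exists_between (lt_min hax (lt_add_of_pos_right a hδ))
  have h2 := h1 q ⟨hq1, hq2.trans_le (min_le_right _ _)⟩
  rw [ha] at h2
  obtain ⟨w, hw, hw0, -⟩ := exists_first_nonpos (hq2.trans_le (min_le_left _ _)).le
    h.u_cont.continuousOn h2 hx
  exact hne w ⟨hq1.trans hw.1, hw.2⟩ hw0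

lemma neg_of_ne_zero (h : LogFlow η p u D y y') {x : ℝ} (hax : a < x) (ha : u a = 0)
    (hDa : D a < 0) (hne : ∀ q ∈ Ioc a x, u q ≠ 0) : u x < 0 := by
  have := h.neg_u.pos_of_ne_zero hax (by rw [ha, neg_zero]) (neg_pos.2 hDa)
    fun q hq => neg_ne_zero.2 (hne q hq)
  exact neg_pos.1 this

/-- The signs of `u'`, `y` and `y'` agree. -/
def SameSign (D y y' : ℝ → ℝ) (a : ℝ) : Prop :=
  (0 < D a ∧ 0 < y a ∧ 0 ≤ y' a) ∨ (D a < 0 ∧ y a < 0 ∧ y' a ≤ 0)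

lemma sameSign_next (h : LogFlow η p u D y y') (hP : Params η p) (hab : a < b) (ha : u a = 0)
    (hb : u b = 0) (hne : ∀ x ∈ Ioo a b, u x ≠ 0) (hs : SameSign D y y' a) :
    SameSign D y y' b := by
  rcases hs with ⟨h1, h2, h3⟩ | ⟨h1, h2, h3⟩
  · obtain ⟨h4, h5, h6⟩ := h.zero_to_zero hP hab ha hb (fun x hx => h.pos_of_ne_zero hx.1 ha h1
      fun q hq => hne q ⟨hq.1, hq.2.trans_lt hx.2⟩) h1 h2 h3
    exact Or.inr ⟨h4, h5, h6.le⟩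
  · obtain ⟨h4, h5, h6⟩ := h.neg_u.neg_y.zero_to_zero hP hab (neg_eq_zero.2 ha)
      (neg_eq_zero.2 hb) (fun x hx => neg_pos.2 (h.neg_of_ne_zero hx.1 ha h1
      fun q hq => hne q ⟨hq.1, hq.2.trans_lt hx.2⟩)) (neg_pos.2 h1) (neg_pos.2 h2)
      (neg_nonneg.2 h3)
    exact Or.inl ⟨neg_neg_iff_pos.1 h4, neg_neg_iff_pos.1 h5, (neg_neg_iff_pos.1 h6).le⟩

lemma sameSign_first {α : ℝ} (h : LogFlow η p u D y y') (hP : Params η p) (hα : 0 < α)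
    (hb : u b = 0) (hne : ∀ x < b, u x ≠ 0) (hφα : 0 < phi p (α ^ (p - 1)))
    (lu : Tendsto u atBot (nhds α)) (lD : Tendsto D atBot (nhds 0))
    (ly : Tendsto y atBot (nhds 0)) (ly' : Tendsto y' atBot (nhds 0))
    (hy : ∀ᶠ x in atBot, 0 < y x) : SameSign D y y' b := by
  have hu : ∀ x < b, 0 < u x := by
    intro x hx
    by_contra! hx0
    obtain ⟨q, hq, hqx⟩ := ((lu.eventually (Ioi_mem_nhds hα)).and (eventually_lt_atBot x)).exists
    obtain ⟨w, hw, hw0, -⟩ := exists_first_nonpos hqx.le h.u_cont.continuousOn hq hx0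
    exact hne w (hw.2.trans_lt hx) hw0
  obtain ⟨h4, h5, h6⟩ := h.origin_to_zero hP hα hu hb hφα lu lD ly ly' hy
  exact Or.inr ⟨h4, h5, h6.le⟩

lemma last_cell_of_sameSign (h : LogFlow η p u D y y') (hP : Params η p) (hac : a < c)
    (ha : u a = 0) (hne : ∀ x, a < x → u x ≠ 0) (hDc : D c = 0) (hs : SameSign D y y' a)
    (lu : Tendsto u atTop (nhds 0)) :
    ∃ τ, a < τ ∧ c < τ ∧ y τ = 0 ∧ (∀ x, a ≤ x → y x = 0 → x = τ) ∧
      ((∃ R, ∀ x, R ≤ x → y' x - η * y x < 0) ∧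
          Tendsto (fun x => exp (-η * x) * y x) atTop atBot ∨
        (∃ R, ∀ x, R ≤ x → 0 < y' x - η * y x) ∧
          Tendsto (fun x => exp (-η * x) * y x) atTop atTop) := by
  rcases hs with ⟨h1, h2, h3⟩ | ⟨h1, h2, h3⟩
  · obtain ⟨τ, h4, h5, h6, h7, h8, h9⟩ := h.last_cell hP hac ha
      (fun x hx => h.pos_of_ne_zero hx ha h1 fun q hq => hne q hq.1) hDc h1 h2 h3 lu
    exact ⟨τ, h4, h5, h6, h7, Or.inl ⟨h8, h9⟩⟩
  · obtain ⟨τ, h4, h5, h6, h7, ⟨R, h8⟩, h9⟩ := h.neg_u.neg_y.last_cell hP hac (neg_eq_zero.2 ha)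
      (fun x hx => neg_pos.2 (h.neg_of_ne_zero hx ha h1 fun q hq => hne q hq.1))
      (neg_eq_zero.2 hDc) (neg_pos.2 h1) (neg_pos.2 h2) (neg_nonneg.2 h3) (by simpa using lu.neg)
    refine ⟨τ, h4, h5, neg_eq_zero.1 h6, fun x hx hx0 => h7 x hx (neg_eq_zero.2 hx0),
      Or.inr ⟨⟨R, fun x hx => by linarith [h8 x hx]⟩, ?_⟩⟩
    have := tendsto_neg_atBot_atTop.comp h9
    simpa [Function.comp_def] using this

lemma sameSign_zeros {α : ℝ} (h : LogFlow η p u D y y') (hP : Params η p) (hα : 0 < α)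
    (hφα : 0 < phi p (α ^ (p - 1)))
    (lu : Tendsto u atBot (nhds α)) (lD : Tendsto D atBot (nhds 0))
    (ly : Tendsto y atBot (nhds 0)) (ly' : Tendsto y' atBot (nhds 0))
    (hy : ∀ᶠ x in atBot, 0 < y x) {k : ℕ} {a : Fin k → ℝ} (ha : StrictMono a)
    (hu : ∀ i, u (a i) = 0) (hall : ∀ x, u x = 0 → ∃ i, x = a i) (i : ℕ) (hi : i < k) :
    SameSign D y y' (a ⟨i, hi⟩) := by
  induction i with
  | zero =>
    refine h.sameSign_first hP hα (hu _) (fun x hx hx0 => ?_) hφα lu lD ly ly' hy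
    obtain ⟨j, rfl⟩ := hall x hx0
    exact absurd (ha.lt_iff_lt.1 hx) (Nat.not_lt_zero _)
  | succ i ih =>
    refine h.sameSign_next hP (ha (Fin.mk_lt_mk.2 i.lt_succ_self)) (hu _) (hu _)
      (fun x hx hx0 => ?_) (ih (by omega))
    obtain ⟨j, rfl⟩ := hall x hx0
    have h1 := Fin.lt_def.1 (ha.lt_iff_lt.1 hx.1)
    have h2 := Fin.lt_def.1 (ha.lt_iff_lt.1 hx.2)
    simp only at h1 h2
    omega

end LogFlow

lemma hasDerivAt_comp_exp {w w' : ℝ → ℝ}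
    (h : ∀ r ∈ Ici (0 : ℝ), HasDerivWithinAt w (w' r) (Ici 0) r) (x : ℝ) :
    HasDerivAt (fun x => w (exp x)) (w' (exp x) * exp x) x :=
  ((h _ (exp_pos x).le).hasDerivAt (Ici_mem_nhds (exp_pos x))).comp x (hasDerivAt_exp x)

lemma tendsto_comp_exp_atBot {w w' : ℝ → ℝ}
    (h : ∀ r ∈ Ici (0 : ℝ), HasDerivWithinAt w (w' r) (Ici 0) r) :
    Tendsto (fun x => w (exp x)) atBot (nhds (w 0)) :=
  (h 0 self_mem_Ici).continuousWithinAt.tendsto.comp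
    (tendsto_nhdsWithin_iff.2 ⟨tendsto_exp_atBot, Eventually.of_forall fun x => (exp_pos x).le⟩)

section
variable {n : ℕ} {p α η : ℝ} {u u' u'' v v' v'' : ℝ → ℝ}

lemma IsSolution.radialFlow (hu : IsSolution n p α u u' u'') (hη : 2 * η = n - 2) :
    RadialFlow η p (fun x => u (exp x)) (fun x => exp x * u' (exp x)) where
  u_deriv x := (hasDerivAt_comp_exp hu.hasDeriv1 x).congr_deriv (mul_comm _ _)
  D_deriv x := by
    refine ((hasDerivAt_exp x).fun_mul (hasDerivAt_comp_exp hu.hasDeriv2 x)).congr_deriv ?_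
    have h := hu.ode _ (exp_pos x)
    have e : exp (2 * x) = exp x * exp x := by rw [← exp_add, two_mul]
    have e1 : exp x * exp x * (((n : ℝ) - 1) / exp x * u' (exp x)) =
        (n - 1) * (exp x * u' (exp x)) := by
      have := (exp_pos x).ne'
      field_simp
    unfold f at h
    rw [e]
    linear_combination exp x * exp x * h - e1 + exp x * u' (exp x) * hη

lemma IsSolution.logFlow (hu : IsSolution n p α u u' u'') (hv : IsVariation n p u v v' v'')
    (hη : 2 * η = n - 2) (hη0 : 0 < η) (hp : 1 < p) (hκ : η * p < η + 2) (hdec : Decaying u u')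
    (hne : ∀ᶠ r in atTop, u r ≠ 0) :
    LogFlow η p (fun x => u (exp x)) (fun x => exp x * u' (exp x))
      (fun x => exp (η * x) * v (exp x))
      (fun x => exp (η * x) * (exp x * v' (exp x) + η * v (exp x))) := by
  have hR := hu.radialFlow hη
  have lu : Tendsto (fun x => u (exp x)) atTop (nhds 0) := hdec.1.comp tendsto_exp_atTop
  have hcancel : ∀ x, exp (-x) * (exp x * u' (exp x)) = u' (exp x) := fun x => by
    rw [← mul_assoc, ← exp_add, neg_add_cancel, exp_zero, one_mul]
  have hE := hR.energy_pos hη0.le hp lu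
    (by simpa only [hcancel, Function.comp_def] using hdec.2.comp tendsto_exp_atTop)
    (tendsto_exp_atTop.eventually hne)
  have lu' := tendsto_comp_exp_atBot hu.hasDeriv1
  have lD : Tendsto (fun x => exp x * u' (exp x)) atBot (nhds 0) := by
    simpa using tendsto_exp_atBot.mul (tendsto_comp_exp_atBot hu.hasDeriv2)
  refine ⟨hR.u_deriv, hR.D_deriv, fun x => ?_, fun x => ?_, fun x => ?_, fun x => ?_⟩
  · exact ((hasDerivAt_exp_mul η x).fun_mul
      (hasDerivAt_comp_exp hv.hasDeriv1 x)).congr_deriv (by ring)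
  · refine ((hasDerivAt_exp_mul η x).fun_mul (((hasDerivAt_exp x).fun_mul (hasDerivAt_comp_exp
      hv.hasDeriv2 x)).fun_add ((hasDerivAt_comp_exp hv.hasDeriv1 x).const_mul η))).congr_deriv ?_
    have h := hv.ode _ (exp_pos x)
    have e : exp (2 * x) = exp x * exp x := by rw [← exp_add, two_mul]
    have e1 : exp x * exp x * (((n : ℝ) - 1) / exp x * v' (exp x)) =
        (n - 1) * (exp x * v' (exp x)) := by
      have := (exp_pos x).ne'
      field_simp
    unfold fder at h
    rw [e]
    linear_combination exp (η * x) * (exp x * exp x * h - e1 + exp x * v' (exp x) * hη)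
  · have h := mul_pos (exp_pos (2 * x)) (hE x)
    rw [hcancel] at h
    have e : exp (2 * x) = exp x * exp x := by rw [← exp_add, two_mul]
    rw [e] at h ⊢
    linarith
  · have h := hR.poh_pos hη0 hp hκ hE (RadialFlow.poh_tendsto_atBot hη0 hp lu' lD) lu x
    unfold RadialFlow.poh at h
    have h1 := pos_of_mul_pos_right h (exp_pos _).le
    unfold Phi
    linarith

lemma IsSolution.phi_pos (hu : IsSolution n p α u u' u'') (hα : 0 < α)
    (hη : 2 * η = n - 2) (hη0 : 0 < η) (hp : 1 < p) (hdec : Decaying u u')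
    (hne : ∀ᶠ r in atTop, u r ≠ 0) : 0 < phi p (α ^ (p - 1)) := by
  have hR := hu.radialFlow hη
  have hcancel : ∀ x, exp (-x) * (exp x * u' (exp x)) = u' (exp x) := fun x => by
    rw [← mul_assoc, ← exp_add, neg_add_cancel, exp_zero, one_mul]
  have hE := hR.energy_pos hη0.le hp (hdec.1.comp tendsto_exp_atTop)
    (by simpa only [hcancel, Function.comp_def] using hdec.2.comp tendsto_exp_atTop)
    (tendsto_exp_atTop.eventually hne) 0
  have l1 := RadialFlow.energy_tendsto (D := fun x => exp x * u' (exp x)) hp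
    (tendsto_comp_exp_atBot hu.hasDeriv1)
    (by simpa only [hcancel, hu.initDeriv] using tendsto_comp_exp_atBot hu.hasDeriv2)
  have h1 := ge_of_tendsto l1 ((eventually_le_atBot 0).mono fun x hx =>
    hR.energy_antitone hη0.le hp hx)
  rw [hu.init, abs_of_pos hα] at h1
  exact pos_of_mul_pos_left (hE.trans_le h1) (sq_nonneg α)

end

/-- for a bound state with exactly `k` zeros and largest critical point `c > z_k`,
the variation `v` has exactly one zero `τ` in `[z_k, ∞)`, with `τ > c`; moreover `v` is
strictly monotone for large `r` and `|v(r)| → ∞` as `r → ∞`. -/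
theorem statement5 (n : ℕ) (hn : 3 ≤ n) (p : ℝ) (hp1 : 1 < p)
    (hp2 : p < ((n : ℝ) + 2) / ((n : ℝ) - 2))
    (α : ℝ) (hα : 0 < α) (u u' u'' v v' v'' : ℝ → ℝ)
    (hu : IsSolution n p α u u' u'') (hv : IsVariation n p u v v' v'')
    (hdec : Decaying u u') (hsign : ChangesSign u)
    (k : ℕ) (hk : 0 < k) (z : Fin k → ℝ) (hz : ExactZeros u k z)
    (c : ℝ) (hc1 : z ⟨k - 1, by omega⟩ < c) (hc2 : u' c = 0)
    (hc3 : ∀ r : ℝ, z ⟨k - 1, by omega⟩ < r → u' r = 0 → r = c) :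
    ∃ τ : ℝ, z ⟨k - 1, by omega⟩ ≤ τ ∧ v τ = 0 ∧
      (∀ r : ℝ, z ⟨k - 1, by omega⟩ ≤ r → v r = 0 → r = τ) ∧
      c < τ ∧
      (∃ R : ℝ, StrictMonoOn v (Set.Ici R) ∨ StrictAntiOn v (Set.Ici R)) ∧
      Filter.Tendsto (fun r => |v r|) Filter.atTop Filter.atTop := by
  obtain ⟨hmono, hz0, hall⟩ := hz
  have hn' : (3 : ℝ) ≤ n := by exact_mod_cast hn
  obtain ⟨η, hη⟩ : ∃ η : ℝ, 2 * η = n - 2 := ⟨(n - 2) / 2, by ring⟩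
  have hη2 : 1 / 2 ≤ η := by linarith
  have hη0 : 0 < η := by linarith
  have hκ : η * p < η + 2 := by
    rw [lt_div_iff₀ (by linarith)] at hp2
    nlinarith
  have hP : Params η p := ⟨hη2, hp1⟩
  set zl := z ⟨k - 1, by omega⟩ with hzl
  have hzl0 : 0 < zl := (hz0 _).1
  have hne' : ∀ r, zl < r → u r ≠ 0 := by
    intro r hr h0
    obtain ⟨i, rfl⟩ := hall r (hzl0.trans hr) h0
    have := Fin.lt_def.1 (hmono.lt_iff_lt.1 hr)
    simp only at this
    omega
  have hne : ∀ᶠ r in atTop, u r ≠ 0 := (eventually_gt_atTop zl).mono hne'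
  have hF := hu.logFlow hv hη hη0 hp1 hκ hdec hne
  have he : Tendsto (fun x => exp (η * x)) atBot (nhds 0) :=
    tendsto_exp_atBot.comp (tendsto_id.const_mul_atBot hη0)
  have lv := tendsto_comp_exp_atBot hv.hasDeriv1
  have lv' := tendsto_comp_exp_atBot hv.hasDeriv2
  have hvpos : ∀ᶠ x in atBot, 0 < exp (η * x) * v (exp x) := by
    rw [hv.init] at lv
    exact (lv.eventually (Ioi_mem_nhds one_pos)).mono fun x hx => mul_pos (exp_pos _) hx
  have hS := hF.sameSign_zeros hP hα (hu.phi_pos hα hη hη0 hp1 hdec hne)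
    (by simpa only [hu.init] using tendsto_comp_exp_atBot hu.hasDeriv1)
    (by simpa using tendsto_exp_atBot.mul (tendsto_comp_exp_atBot hu.hasDeriv2))
    (by simpa using he.mul lv)
    (by simpa using he.mul ((tendsto_exp_atBot.mul lv').add (lv.const_mul η))) hvpos
    (a := fun i => log (z i)) (fun i j hij => log_lt_log (hz0 i).1 (hmono hij))
    (fun i => by rw [exp_log (hz0 i).1, (hz0 i).2])
    (fun x hx => by
      obtain ⟨i, hi⟩ := hall _ (exp_pos x) hx
      exact ⟨i, by rw [← hi, log_exp]⟩) (k - 1) (by omega)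
  have hc0 : 0 < c := hzl0.trans hc1
  obtain ⟨t, h1, h2, h3, h4, h5⟩ := hF.last_cell_of_sameSign hP (log_lt_log hzl0 hc1)
    (by rw [exp_log hzl0, (hz0 _).2]) (fun x hx => hne' _ ((log_lt_iff_lt_exp hzl0).1 hx))
    (by rw [exp_log hc0, hc2, mul_zero]) hS (hdec.1.comp tendsto_exp_atTop)
  have hvd : ∀ r, 0 < r → HasDerivAt v (v' r) r := fun r hr =>
    (hv.hasDeriv1 r hr.le).hasDerivAt (Ici_mem_nhds hr)
  have hvc : ∀ R, ContinuousOn v (Ici (exp R)) := fun R r hr =>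
    (hvd r ((exp_pos R).trans_le hr)).continuousAt.continuousWithinAt
  have hq : ∀ x, exp (η * x) * (exp x * v' (exp x) + η * v (exp x)) -
      η * (exp (η * x) * v (exp x)) = exp (η * x) * exp x * v' (exp x) := fun x => by ring
  have hcancel : ∀ x, exp (-η * x) * (exp (η * x) * v (exp x)) = v (exp x) := fun x => by
    rw [← mul_assoc, ← exp_add, neg_mul, neg_add_cancel, exp_zero, one_mul]
  have hlog : ∀ l : Filter ℝ, Tendsto (fun x => v (exp x)) atTop l → Tendsto v atTop l := by
    intro l hl
    refine (hl.comp tendsto_log_atTop).congr' ?_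
    filter_upwards [eventually_gt_atTop 0] with r hr
    simp [exp_log hr]
  simp only [hq, hcancel] at h5
  refine ⟨exp t, ((log_lt_iff_lt_exp hzl0).1 h1).le,
    (mul_eq_zero.1 h3).resolve_left (exp_pos _).ne', fun r hr hr0 => ?_,
    (log_lt_iff_lt_exp hc0).1 h2, ?_, ?_⟩
  · have hr' := hzl0.trans_le hr
    rw [← h4 (log r) (log_le_log hzl0 hr) (by rw [exp_log hr', hr0, mul_zero]), exp_log hr']
  · rcases h5 with ⟨⟨R, hR⟩, -⟩ | ⟨⟨R, hR⟩, -⟩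
    · refine ⟨exp R, Or.inr (strictAntiOn_of_deriv_neg (convex_Ici _) (hvc R) fun r hr => ?_)⟩
      rw [interior_Ici] at hr
      have hr0 : 0 < r := (exp_pos R).trans hr
      have := hR (log r) ((le_log_iff_exp_le hr0).2 (le_of_lt hr))
      rw [(hvd r hr0).deriv]
      rw [exp_log hr0] at this
      exact neg_of_mul_neg_right this (by positivity)
    · refine ⟨exp R, Or.inl (strictMonoOn_of_deriv_pos (convex_Ici _) (hvc R) fun r hr => ?_)⟩
      rw [interior_Ici] at hr
      have hr0 : 0 < r := (exp_pos R).trans hr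
      have := hR (log r) ((le_log_iff_exp_le hr0).2 (le_of_lt hr))
      rw [(hvd r hr0).deriv]
      rw [exp_log hr0] at this
      exact pos_of_mul_pos_right this (by positivity)
  · rcases h5 with ⟨-, h⟩ | ⟨-, h⟩
    · exact tendsto_abs_atBot_atTop.comp (hlog _ h)
    · exact tendsto_abs_atTop_atTop.comp (hlog _ h)
end

section
/- Let u be a solution of the IVP with initial value α > 0, α ≠ 1. Then: (i) the energy E(r) = u'(r)²/2 + F(u(r)) is strictly decreasing on (0,∞); (ii) if 0 < r̄ < r̂ and |u(r̂)| = |u(r̄)|, then |u'(r̂)| < |u'(r̄)|; (iii) if α > 1 then sup_{r ≥ 0} |u(r)| = α, while if α < 1 then α < sup_{r ≥ 0} |u(r)| < α_*, where α_* = ((p+1)/2)^{1/(p−1)}. -/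
open Real Filter Set

open scoped Topology

theorem eq_zero_or_abs_eq_one_of_f_eq_zero {p s : ℝ} (hp : 1 < p) (hs : f p s = 0) :
    s = 0 ∨ |s| = 1 := by
  have h : s * (|s| ^ (p - 1) - 1) = 0 := by rw [← hs, f]; ring
  rcases mul_eq_zero.1 h with h | h
  · exact Or.inl h
  · exact Or.inr ((rpow_left_inj (abs_nonneg s) zero_le_one (sub_pos.2 hp).ne').1
      ((sub_eq_zero.1 h).trans (one_rpow _).symm))

theorem continuous_abs_rpow {q : ℝ} (hq : 0 < q) : Continuous fun s : ℝ => |s| ^ q :=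
  continuous_abs.rpow_const fun _ => Or.inr hq.le

theorem continuous_f {p : ℝ} (hp : 1 < p) : Continuous (f p) := by
  have := continuous_abs_rpow (sub_pos.2 hp)
  unfold f
  fun_prop

theorem differentiableAt_f {p c : ℝ} (hc : c ≠ 0) : DifferentiableAt ℝ (f p) c := by
  unfold f
  exact differentiableAt_id.neg.add
    (((differentiableAt_abs hc).rpow_const (Or.inl (abs_ne_zero.2 hc))).mul differentiableAt_id)

/-- Near a zero `c` the nonlinearity factors as a continuous function times `s - c`. -/
theorem exists_continuous_factor_f {p c : ℝ} (hp : 1 < p) (hc : f p c = 0) :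
    ∃ g : ℝ → ℝ, Continuous g ∧ ∀ s, f p s = g s * (s - c) := by
  by_cases h0 : c = 0
  · subst h0
    refine ⟨fun s => -1 + |s| ^ (p - 1), ?_, fun s => by rw [f]; ring⟩
    exact continuous_const.add (continuous_abs_rpow (sub_pos.2 hp))
  · refine ⟨dslope (f p) c, ?_, fun s => ?_⟩
    · rw [← continuousOn_univ, continuousOn_dslope univ_mem]
      exact ⟨(continuous_f hp).continuousOn, differentiableAt_f h0⟩
    · have := sub_smul_dslope (f p) c s
      rw [hc, smul_eq_mul] at this
      linarith

theorem F_abs (p s : ℝ) : F p |s| = F p s := by simp [F]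

theorem hasDerivAt_F {p : ℝ} (hp : 1 < p) (s : ℝ) : HasDerivAt (F p) (f p s) s := by
  have h1 := hasDerivAt_abs_rpow s (p := p + 1) (by linarith)
  have h2 := (((hasDerivAt_id s).pow 2).neg.div_const 2).add (h1.div_const (p + 1))
  refine h2.congr_deriv ?_
  have : p + 1 ≠ 0 := by linarith
  rw [f, show p + 1 - 2 = p - 1 by ring]
  simp only [id]
  field_simp
  ring

theorem continuous_F {p : ℝ} (hp : 1 < p) : Continuous (F p) :=
  continuous_iff_continuousAt.2 fun s => (hasDerivAt_F hp s).continuousAt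

theorem strictMonoOn_F {p : ℝ} (hp : 1 < p) : StrictMonoOn (F p) (Ici 1) := by
  refine strictMonoOn_of_deriv_pos (convex_Ici 1) (continuous_F hp).continuousOn fun s hs => ?_
  rw [interior_Ici, mem_Ioi] at hs
  rw [(hasDerivAt_F hp s).deriv, f, abs_of_pos (by linarith)]
  nlinarith [one_lt_rpow hs (sub_pos.2 hp)]

theorem strictAntiOn_F {p : ℝ} (hp : 1 < p) : StrictAntiOn (F p) (Icc 0 1) := by
  refine strictAntiOn_of_deriv_neg (convex_Icc 0 1) (continuous_F hp).continuousOn fun s hs => ?_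
  rw [interior_Icc] at hs
  rw [(hasDerivAt_F hp s).deriv, f, abs_of_pos hs.1]
  nlinarith [rpow_lt_one hs.1.le hs.2 (sub_pos.2 hp), hs.1]

theorem lt_of_F_neg {p s : ℝ} (hp : 1 < p) (hs : 0 ≤ s) (h : F p s < 0) :
    s < ((p + 1) / 2) ^ (1 / (p - 1)) := by
  have hp' : 0 < p - 1 := sub_pos.2 hp
  have hs0 : 0 < s := hs.lt_of_ne' fun h0 => by
    rw [h0, F, abs_zero, zero_rpow (by linarith)] at h
    norm_num at h
  have h1 : s ^ (p - 1) < (p + 1) / 2 := by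
    rw [F, abs_of_pos hs0, show p + 1 = (p - 1) + 2 by ring, rpow_add hs0, rpow_two] at h
    by_contra! hle
    have : s ^ 2 / 2 ≤ s ^ (p - 1) * s ^ 2 / (p - 1 + 2) := by
      rw [div_le_div_iff₀ (by norm_num) (by linarith)]
      nlinarith [mul_le_mul_of_nonneg_right hle (sq_nonneg s)]
    linarith
  have h2 := rpow_lt_rpow (rpow_nonneg hs _) h1 (one_div_pos.2 hp')
  rwa [← rpow_mul hs, mul_one_div_cancel hp'.ne', rpow_one] at h2

namespace IsSolution

variable {n : ℕ} {p α : ℝ} {u u' u'' : ℝ → ℝ}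

theorem hasDerivAt (hu : IsSolution n p α u u' u'') {r : ℝ} (hr : 0 < r) :
    HasDerivAt u (u' r) r :=
  (hu.hasDeriv1 r hr.le).hasDerivAt (Ici_mem_nhds hr)

theorem hasDerivAt' (hu : IsSolution n p α u u' u'') {r : ℝ} (hr : 0 < r) :
    HasDerivAt u' (u'' r) r :=
  (hu.hasDeriv2 r hr.le).hasDerivAt (Ici_mem_nhds hr)

theorem continuousOn (hu : IsSolution n p α u u' u'') : ContinuousOn u (Ici 0) :=
  fun r hr => (hu.hasDeriv1 r hr).continuousWithinAt

theorem continuousOn' (hu : IsSolution n p α u u' u'') : ContinuousOn u' (Ici 0) :=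
  fun r hr => (hu.hasDeriv2 r hr).continuousWithinAt

theorem eq_of_stationary (hn : 1 ≤ n) (hp : 1 < p) (hu : IsSolution n p α u u' u'') {m ε : ℝ}
    (hε : 0 < ε) (hεm : ε ≤ m) (hf : f p (u m) = 0) (hm : u' m = 0) : u ε = u m := by
  obtain ⟨g, hg, hfg⟩ := exists_continuous_factor_f hp hf
  have hsub : Icc ε m ⊆ Ici 0 := fun r hr => hε.le.trans hr.1
  obtain ⟨B, hB⟩ := isCompact_Icc.exists_bound_of_continuousOn
    (hg.comp_continuousOn (hu.continuousOn.mono hsub))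
  have hn' : (0 : ℝ) ≤ (n : ℝ) - 1 := by
    have : (1 : ℝ) ≤ n := by exact_mod_cast hn
    linarith
  set c := u m with hc
  set K : ℝ := 1 + 2 * (((n : ℝ) - 1) / ε) + B with hK
  have hder : ∀ r, 0 < r → HasDerivAt
      (fun r => ((u r - c) ^ 2 + u' r ^ 2) * exp (K * r))
      ((2 * (u r - c) * u' r + 2 * u' r * u'' r) * exp (K * r) +
        ((u r - c) ^ 2 + u' r ^ 2) * (exp (K * r) * K)) r := by
    intro r hr
    have h1 := ((hu.hasDerivAt hr).sub_const c).pow 2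
    have h2 := (hu.hasDerivAt' hr).pow 2
    have h3 := ((hasDerivAt_id r).const_mul K).exp
    refine ((h1.add h2).mul h3).congr_deriv ?_
    simp
  have hmono : MonotoneOn (fun r => ((u r - c) ^ 2 + u' r ^ 2) * exp (K * r)) (Icc ε m) := by
    refine monotoneOn_of_deriv_nonneg (convex_Icc ε m)
      (fun r hr => (hder r (hε.trans_le hr.1)).continuousAt.continuousWithinAt) ?_ ?_
    · rw [interior_Icc]
      exact fun r hr => (hder r (hε.trans hr.1)).differentiableAt.differentiableWithinAt
    · rw [interior_Icc]
      intro r hr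
      have hr0 := hε.trans hr.1
      rw [(hder r hr0).deriv]
      have hode := hu.ode r hr0
      rw [hfg] at hode
      have hgB := abs_le.1 (hB r (Ioo_subset_Icc_self hr))
      simp only [Function.comp] at hgB
      have hdiv : ((n : ℝ) - 1) / r ≤ ((n : ℝ) - 1) / ε :=
        div_le_div_of_nonneg_left hn' hε hr.1.le
      have hdε : 0 ≤ ((n : ℝ) - 1) / ε := div_nonneg hn' hε.le
      have hu2 : u'' r = -(((n : ℝ) - 1) / r * u' r) - g (u r) * (u r - c) := by linarith
      have key : 0 ≤ 2 * (u r - c) * u' r + 2 * u' r * u'' r +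
          ((u r - c) ^ 2 + u' r ^ 2) * K := by
        rw [hu2, hK]
        generalize ((n : ℝ) - 1) / r = d at *
        generalize ((n : ℝ) - 1) / ε = e at *
        generalize u r - c = x
        generalize u' r = y
        generalize g (u r) = z at *
        have k1 : 0 ≤ (e - d) * y ^ 2 := mul_nonneg (by linarith) (sq_nonneg y)
        have k2 : 0 ≤ e * x ^ 2 := mul_nonneg hdε (sq_nonneg x)
        have k3 : 0 ≤ (B - z) * (x + y) ^ 2 := mul_nonneg (by linarith) (sq_nonneg _)
        have k4 : 0 ≤ (B + z) * (x - y) ^ 2 := mul_nonneg (by linarith) (sq_nonneg _)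
        nlinarith [sq_nonneg (x + y)]
      have := mul_nonneg key (exp_pos (K * r)).le
      linarith
  have h := hmono (left_mem_Icc.2 hεm) (right_mem_Icc.2 hεm) hεm
  simp only [← hc, hm, sub_self] at h
  have h0 : (u ε - c) ^ 2 + u' ε ^ 2 ≤ 0 := by
    by_contra! hpos
    have := mul_pos hpos (exp_pos (K * ε))
    norm_num at h
    linarith
  have : (u ε - c) ^ 2 = 0 := le_antisymm (by nlinarith [sq_nonneg (u' ε)]) (sq_nonneg _)
  exact sub_eq_zero.1 (pow_eq_zero_iff two_ne_zero |>.1 this)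

theorem init_eq_of_stationary (hn : 1 ≤ n) (hp : 1 < p) (hu : IsSolution n p α u u' u'') {m : ℝ}
    (hm0 : 0 < m) (hf : f p (u m) = 0) (hm : u' m = 0) : α = u m := by
  have h1 : Tendsto u (𝓝[>] 0) (𝓝 (u 0)) :=
    (hu.continuousOn 0 self_mem_Ici).mono Ioi_subset_Ici_self
  have h2 : Tendsto u (𝓝[>] 0) (𝓝 (u m)) := by
    refine tendsto_const_nhds.congr' ?_
    filter_upwards [Ioc_mem_nhdsGT hm0] with r hr
    exact (hu.eq_of_stationary hn hp hr.1 hr.2 hf hm).symm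
  rw [← hu.init]
  exact tendsto_nhds_unique h1 h2

theorem hasDerivAt_energy (hp : 1 < p) (hu : IsSolution n p α u u' u'') {r : ℝ} (hr : 0 < r) :
    HasDerivAt (fun r => u' r ^ 2 / 2 + F p (u r)) (-(((n : ℝ) - 1) / r * u' r ^ 2)) r := by
  have h1 := ((hu.hasDerivAt' hr).pow 2).div_const 2
  have h2 := (hasDerivAt_F hp (u r)).comp r (hu.hasDerivAt hr)
  refine (h1.add h2).congr_deriv ?_
  have hode := hu.ode r hr
  have : u'' r = -(((n : ℝ) - 1) / r * u' r) - f p (u r) := by linarith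
  rw [this]
  norm_num
  ring

theorem continuousOn_energy (hp : 1 < p) (hu : IsSolution n p α u u' u'') :
    ContinuousOn (fun r => u' r ^ 2 / 2 + F p (u r)) (Ici 0) :=
  ((hu.continuousOn'.pow 2).div_const 2).add ((continuous_F hp).comp_continuousOn hu.continuousOn)

theorem antitoneOn_energy (hn : 1 ≤ n) (hp : 1 < p) (hu : IsSolution n p α u u' u'') :
    AntitoneOn (fun r => u' r ^ 2 / 2 + F p (u r)) (Ici 0) := by
  refine antitoneOn_of_deriv_nonpos (convex_Ici 0) (hu.continuousOn_energy hp) ?_ ?_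
  · rw [interior_Ici]
    exact fun r hr => (hu.hasDerivAt_energy hp hr).differentiableAt.differentiableWithinAt
  · rw [interior_Ici]
    intro r hr
    have hn' : (1 : ℝ) ≤ n := by exact_mod_cast hn
    rw [(hu.hasDerivAt_energy hp hr).deriv, neg_nonpos]
    exact mul_nonneg (div_nonneg (by linarith) (le_of_lt hr)) (sq_nonneg _)

theorem strictAntiOn_energy (hn : 2 ≤ n) (hp : 1 < p) (hα : 0 < α) (hα1 : α ≠ 1)
    (hu : IsSolution n p α u u' u'') :
    StrictAntiOn (fun r => u' r ^ 2 / 2 + F p (u r)) (Ici 0) := by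
  have hanti := hu.antitoneOn_energy (by omega) hp
  intro x hx y hy hxy
  refine (hanti hx hy hxy.le).lt_of_ne fun heq => ?_
  have hx0 : 0 ≤ x := hx
  have hzero : ∀ r ∈ Ioo x y, u' r = 0 := by
    intro r hr
    have hr0 : 0 < r := hx0.trans_lt hr.1
    have hev : (fun r => u' r ^ 2 / 2 + F p (u r)) =ᶠ[𝓝 r]
        fun _ => u' x ^ 2 / 2 + F p (u x) := by
      filter_upwards [Ioo_mem_nhds hr.1 hr.2] with t ht
      have ht0 : t ∈ Ici (0 : ℝ) := hx0.trans ht.1.le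
      exact le_antisymm (hanti hx ht0 ht.1.le) (heq.symm.trans_le (hanti ht0 hy ht.2.le))
    have h := (hu.hasDerivAt_energy hp hr0).unique
      ((hasDerivAt_const r _).congr_of_eventuallyEq hev)
    have hn' : (2 : ℝ) ≤ n := by exact_mod_cast hn
    have hd : ((n : ℝ) - 1) / r ≠ 0 := (div_pos (by linarith) hr0).ne'
    simpa [hd] using h
  obtain ⟨m, hm⟩ := nonempty_Ioo.2 hxy
  have hm0 : 0 < m := hx0.trans_lt hm.1
  have hev : u' =ᶠ[𝓝 m] fun _ => 0 := by
    filter_upwards [Ioo_mem_nhds hm.1 hm.2] with t ht using hzero t ht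
  have h2 : u'' m = 0 :=
    (hu.hasDerivAt' hm0).unique ((hasDerivAt_const m _).congr_of_eventuallyEq hev)
  have hf : f p (u m) = 0 := by
    have := hu.ode m hm0
    rwa [h2, hzero m hm, mul_zero, zero_add, zero_add] at this
  have hαm := hu.init_eq_of_stationary (by omega) hp hm0 hf (hzero m hm)
  rw [← hαm] at hf
  rcases eq_zero_or_abs_eq_one_of_f_eq_zero hp hf with h | h
  · exact hα.ne' h
  · exact hα1 (by rwa [abs_of_pos hα] at h)

theorem F_le_energy_init (hn : 1 ≤ n) (hp : 1 < p) (hu : IsSolution n p α u u' u'') {r : ℝ}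
    (hr : 0 ≤ r) : F p |u r| ≤ F p α := by
  have h := hu.antitoneOn_energy hn hp self_mem_Ici hr hr
  simp only [hu.init, hu.initDeriv] at h
  rw [F_abs]
  nlinarith [sq_nonneg (u' r)]

end IsSolution

/-- energy monotonicity and the supremum of `|u|`. -/
theorem statement6 (n : ℕ) (hn : 3 ≤ n) (p : ℝ) (hp1 : 1 < p)
    (hp2 : p < ((n : ℝ) + 2) / ((n : ℝ) - 2))
    (α : ℝ) (hα : 0 < α) (hα1 : α ≠ 1)
    (u u' u'' : ℝ → ℝ) (hu : IsSolution n p α u u' u'') :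
    StrictAntiOn (fun r => u' r ^ 2 / 2 + F p (u r)) (Set.Ioi 0) ∧
    (∀ r1 r2 : ℝ, 0 < r1 → r1 < r2 → |u r2| = |u r1| → |u' r2| < |u' r1|) ∧
    (1 < α → sSup ((fun r => |u r|) '' Set.Ici 0) = α) ∧
    (α < 1 → α < sSup ((fun r => |u r|) '' Set.Ici 0) ∧
      sSup ((fun r => |u r|) '' Set.Ici 0) < ((p + 1) / 2) ^ (1 / (p - 1))) := by
  have hanti := hu.strictAntiOn_energy (by omega) hp1 hα hα1
  have hF : ∀ r ∈ Ici (0 : ℝ), F p |u r| ≤ F p α := fun r hr =>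
    hu.F_le_energy_init (by omega) hp1 hr
  refine ⟨hanti.mono Ioi_subset_Ici_self, fun r1 r2 h1 h12 habs => ?_, fun hα2 => ?_,
    fun hα2 => ?_⟩
  · have h := hanti h1.le (h1.trans h12).le h12
    simp only [← F_abs p (u _), habs] at h
    exact sq_lt_sq.1 (by linarith)
  · refine IsGreatest.csSup_eq ⟨⟨0, self_mem_Ici, ?_⟩, ?_⟩
    · simp [hu.init, hα.le]
    · rintro _ ⟨r, hr, rfl⟩
      by_contra! hlt
      exact (strictMonoOn_F hp1 hα2.le (hα2.trans hlt).le hlt).not_ge (hF r hr)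
  · have hFα : F p α < 0 := by
      have h := strictAntiOn_F hp1 ⟨le_rfl, zero_le_one⟩ ⟨hα.le, hα2.le⟩ hα
      rwa [show F p 0 = 0 by simp [F, zero_rpow (by linarith : p + 1 ≠ 0)]] at h
    have hbdd : BddAbove ((fun r => |u r|) '' Ici 0) := by
      refine ⟨((p + 1) / 2) ^ (1 / (p - 1)), ?_⟩
      rintro _ ⟨r, hr, rfl⟩
      exact (lt_of_F_neg hp1 (abs_nonneg _) ((hF r hr).trans_lt hFα)).le
    constructor
    · refine lt_of_lt_of_le ?_ (le_csSup hbdd ⟨1, mem_Ici.2 zero_le_one, rfl⟩)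
      by_contra! hle
      have h1 := (strictAntiOn_F hp1).antitoneOn ⟨abs_nonneg _, hle.trans hα2.le⟩
        ⟨hα.le, hα2.le⟩ hle
      have h2 := hanti self_mem_Ici (zero_le_one' ℝ) one_pos
      simp only [hu.init, hu.initDeriv] at h2
      rw [F_abs] at h1
      nlinarith [sq_nonneg (u' 1)]
    · have hmem := csSup_mem_closure (nonempty_Ici.image fun r => |u r|) hbdd
      have hclosed : IsClosed {s | 0 ≤ s ∧ F p s ≤ F p α} :=
        isClosed_Ici.inter (isClosed_le (continuous_F hp1) continuous_const)
      have hsub : (fun r => |u r|) '' Ici 0 ⊆ {s | 0 ≤ s ∧ F p s ≤ F p α} := by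
        rintro _ ⟨r, hr, rfl⟩
        exact ⟨abs_nonneg _, hF r hr⟩
      have h := closure_minimal hsub hclosed hmem
      exact lt_of_F_neg hp1 h.1 (h.2.trans_lt hFα)
end
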